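/- Suppose there exist a constant C > 0 and a function g(s) = C·(1 + log s)^5 such that every graph G with d(G) ≥ C and every D > 0 with s = D/d(G) contains either a minor J with d(J) ≥ D, or a subgraph H with v(H) ≤ g(s)·D^2/d(G) and d(H) ≥ d(G)/g(s). Then there exists a constant C' > 0 such that for every integer t ≥ 3, every graph with no K_t minor has chromatic number at most C' · t · (g(3.2·√(log t)) + (log log t)^2). -/

import Mathlib

open SimpleGraph

/-- Density of a graph: `e(G) / v(G)`. -/
noncomputable def SimpleGraph.density {V : Type*} (G : SimpleGraph V) : ℝ :=
  (Nat.card G.edgeSet : ℝ) / (Nat.card V : ℝ)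

/-- Density of a subgraph: its number of edges divided by its number of vertices. -/
noncomputable def SimpleGraph.Subgraph.density {V : Type*} {G : SimpleGraph V}
    (H : G.Subgraph) : ℝ :=
  (Nat.card H.edgeSet : ℝ) / (Nat.card H.verts : ℝ)

/-- A model of `H` in `G`: pairwise disjoint branch sets, each inducing a connected
subgraph of `G`, with an edge of `G` between branch sets of adjacent vertices of `H`. -/
def SimpleGraph.IsMinorModel {V : Type*} {W : Type*} (G : SimpleGraph V) (H : SimpleGraph W)
    (X : W → Set V) : Prop :=
  (Pairwise fun i j => Disjoint (X i) (X j)) ∧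
  (∀ i, (G.induce (X i)).Connected) ∧
  (∀ i j, H.Adj i j → ∃ u ∈ X i, ∃ v ∈ X j, G.Adj u v)

/-- `G` has an `H` minor iff `G` contains a model of `H`. -/
def SimpleGraph.HasMinor {V : Type*} {W : Type*} (G : SimpleGraph V) (H : SimpleGraph W) : Prop :=
  ∃ X : W → Set V, G.IsMinorModel H X

namespace CD

section basics
variable {V : Type*} {G : SimpleGraph V}

def Cn (G : SimpleGraph V) (S : Finset V) : Prop :=
  S.Nonempty ∧ ∀ A ⊆ S, A.Nonempty → (∀ a ∈ A, ∀ b ∈ S, G.Adj a b → b ∈ A) → A = S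

def Adjs (G : SimpleGraph V) (S T : Finset V) : Prop := ∃ u ∈ S, ∃ v ∈ T, G.Adj u v

def Col (G : SimpleGraph V) (S : Finset V) (n : ℕ) : Prop :=
  ∃ f : V → ℕ, (∀ v ∈ S, f v < n) ∧ ∀ u ∈ S, ∀ v ∈ S, G.Adj u v → f u ≠ f v

lemma Adjs.symm {S T : Finset V} (h : Adjs G S T) : Adjs G T S := by
  obtain ⟨u, hu, v, hv, h⟩ := h
  exact ⟨v, hv, u, hu, h.symm⟩

lemma Adjs.mono {S T S' T' : Finset V} (h : Adjs G S T) (h1 : S ⊆ S') (h2 : T ⊆ T') :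
    Adjs G S' T' := by
  obtain ⟨u, hu, v, hv, h⟩ := h
  exact ⟨u, h1 hu, v, h2 hv, h⟩

lemma Cn.singleton (v : V) : Cn G {v} := by
  refine ⟨⟨v, by simp⟩, fun A hA hne _ => ?_⟩
  exact (Finset.Nonempty.subset_singleton_iff hne).1 hA

lemma Cn.mono {G' : SimpleGraph V} {S : Finset V} (h : Cn G S)
    (hle : ∀ a ∈ S, ∀ b ∈ S, G.Adj a b → G'.Adj a b) : Cn G' S :=
  ⟨h.1, fun A hA hne hcl => h.2 A hA hne fun a ha b hb hab => hcl a ha b hb (hle a (hA ha) b hb hab)⟩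

variable [DecidableEq V]

lemma Cn.union {S T : Finset V} (hS : Cn G S) (hT : Cn G T) {u v : V} (hu : u ∈ S) (hv : v ∈ T)
    (h : u = v ∨ G.Adj u v) : Cn G (S ∪ T) := by
  refine ⟨⟨u, by simp [hu]⟩, fun A hA hne hcl => ?_⟩
  have k1 : ∀ S' ⊆ S ∪ T, Cn G S' → (∃ a ∈ A, a ∈ S') → S' ⊆ A := by
    intro S' hS' hc ⟨a, ha, ha'⟩
    have := hc.2 (A ∩ S') Finset.inter_subset_right ⟨a, by simp [ha, ha']⟩ (by
      intro c hc' b hb hcb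
      rw [Finset.mem_inter] at hc' ⊢
      exact ⟨hcl c hc'.1 b (hS' hb) hcb, hb⟩)
    rw [← this]; exact Finset.inter_subset_left
  have kS := k1 S Finset.subset_union_left hS
  have kT := k1 T Finset.subset_union_right hT
  obtain ⟨a, ha⟩ := hne
  apply Finset.Subset.antisymm hA
  apply Finset.union_subset_iff.2
  rcases Finset.mem_union.1 (hA ha) with h1 | h1
  · have hSA := kS ⟨a, ha, h1⟩
    refine ⟨hSA, kT ⟨v, ?_, hv⟩⟩
    rcases h with h | h
    · rw [← h]; exact hSA hu
    · exact hcl u (hSA hu) v (by simp [hv]) h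
  · have hTA := kT ⟨a, ha, h1⟩
    refine ⟨kS ⟨u, ?_, hu⟩, hTA⟩
    rcases h with h | h
    · rw [h]; exact hTA hv
    · exact hcl v (hTA hv) u (by simp [hu]) h.symm

lemma Cn.union_inter {S T : Finset V} (hS : Cn G S) (hT : Cn G T) {u : V} (hu : u ∈ S)
    (hv : u ∈ T) : Cn G (S ∪ T) := hS.union hT hu hv (Or.inl rfl)

lemma Cn.insert {S : Finset V} (hS : Cn G S) {u v : V} (hu : u ∈ S) (h : G.Adj u v) :
    Cn G (insert v S) := by
  have := hS.union (Cn.singleton v) hu (Finset.mem_singleton_self v) (Or.inr h)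
  rwa [Finset.union_comm] at this

/-- the component of `a` in `S` -/
lemma exists_comp (G : SimpleGraph V) {S : Finset V} {a : V} (ha : a ∈ S) :
    ∃ C ⊆ S, a ∈ C ∧ Cn G C ∧ ∀ c ∈ C, ∀ b ∈ S, G.Adj c b → b ∈ C := by
  classical
  obtain ⟨C, hC, hmax⟩ := Finset.exists_max_image (S.powerset.filter fun C => a ∈ C ∧ Cn G C)
    Finset.card ⟨{a}, by simp [ha, Cn.singleton]⟩
  simp only [Finset.mem_filter, Finset.mem_powerset] at hC hmax
  refine ⟨C, hC.1, hC.2.1, hC.2.2, fun c hc b hb hcb => ?_⟩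
  by_contra hbC
  have := hmax (Insert.insert b C) ⟨Finset.insert_subset hb hC.1, by simp [hC.2.1],
    hC.2.2.insert hc hcb⟩
  rw [Finset.card_insert_of_notMem hbC] at this
  omega

lemma not_Cn_split {S : Finset V} (hne : S.Nonempty) (h : ¬ Cn G S) :
    ∃ A ⊆ S, A.Nonempty ∧ (S \ A).Nonempty ∧ ∀ a ∈ A, ∀ b ∈ S \ A, ¬ G.Adj a b := by
  unfold Cn at h
  push Not at h
  obtain ⟨A, hA, h1, h2, h3⟩ := h hne
  refine ⟨A, hA, h1, ?_, fun a ha b hb hab => ?_⟩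
  · rw [Finset.sdiff_nonempty]
    exact fun h => h3 (Finset.Subset.antisymm hA h)
  · rw [Finset.mem_sdiff] at hb
    exact hb.2 (h2 a ha b hb.1 hab)

/-- first hit -/
lemma FH {Q B : Finset V} (hQ : Cn G Q) {a b : V} (ha : a ∈ Q) (haB : a ∉ B) (hb : b ∈ Q)
    (hbB : b ∈ B) : ∃ Y ⊆ Q \ B, ∃ c ∈ Y, ∃ b' ∈ Q ∩ B, a ∈ Y ∧ Cn G Y ∧ G.Adj c b' := by
  obtain ⟨C, hC, haC, hCC, hcl⟩ := exists_comp G (S := Q \ B) (a := a) (by simp [ha, haB])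
  by_contra hcon
  push Not at hcon
  have : C = Q := hQ.2 C (hC.trans Finset.sdiff_subset) ⟨a, haC⟩ (by
    intro c hc d hd hcd
    by_cases hdB : d ∈ B
    · exact absurd hcd (hcon C hC c hc d (by simp [hd, hdB]) haC hCC)
    · exact hcl c hc d (by simp [hd, hdB]) hcd)
  rw [← this] at hb
  have := hC hb
  simp [hbB] at this

/-- trimmed first hit -/
lemma FHt {P T : Finset V} {A : Finset V} (hP : Cn G P) (hA : ∃ a ∈ P, a ∈ A)
    (hT : ∃ a ∈ P, a ∈ T) :
    ∃ P' ⊆ P, ∃ s ∈ P', Cn G P' ∧ s ∈ T ∧ (∃ a ∈ P', a ∈ A) ∧ (∀ v ∈ P', v ∈ T → v = s) ∧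
      ∀ v ∈ P', v ≠ s → ∃ Q ⊆ P', Cn G Q ∧ v ∈ Q ∧ (∃ a ∈ Q, a ∈ A) ∧ Disjoint Q T := by
  obtain ⟨a, haP, haA⟩ := hA
  obtain ⟨b, hbP, hbT⟩ := hT
  by_cases haT : a ∈ T
  · exact ⟨{a}, by simpa using haP, a, by simp, Cn.singleton a, haT, ⟨a, by simp, haA⟩,
      by simp, by simp⟩
  · obtain ⟨Y, hY, c, hc, s, hs, haY, hYC, hadj⟩ := FH hP haP haT hbP hbT
    rw [Finset.mem_inter] at hs
    have hd : Disjoint Y T := by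
      rw [Finset.disjoint_left]; intro v hv; exact (Finset.mem_sdiff.1 (hY hv)).2
    refine ⟨Insert.insert s Y, Finset.insert_subset hs.1 (hY.trans Finset.sdiff_subset), s,
      by simp, hYC.insert hc hadj, hs.2, ⟨a, by simp [haY], haA⟩, ?_, ?_⟩
    · intro v hv hvT
      rcases Finset.mem_insert.1 hv with h | h
      · exact h
      · exact absurd hvT (Finset.disjoint_left.1 hd h)
    · intro v hv hne
      rcases Finset.mem_insert.1 hv with h | h
      · exact absurd h hne
      · exact ⟨Y, Finset.subset_insert _ _, hYC, h, ⟨a, haY, haA⟩, hd⟩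

/-- `X` separates `A` from `B`. -/
def Sep (G : SimpleGraph V) (A B X : Finset V) : Prop :=
  ∀ Q, Cn G Q → (∃ a ∈ Q, a ∈ A) → (∃ b ∈ Q, b ∈ B) → ∃ x ∈ Q, x ∈ X

lemma Sep.symm {A B X : Finset V} (h : Sep G A B X) : Sep G B A X :=
  fun Q h1 h2 h3 => h Q h1 h3 h2

lemma menger_aux {G' : SimpleGraph V} {A B S X : Finset V} {x y : V}
    (hG : ∀ a b, G.Adj a b → G'.Adj a b ∨ (a = x ∧ b = y) ∨ (a = y ∧ b = x))
    (hS : Sep G' A B S) {Cb : Finset V} (hCb : Cn G' Cb) (hy : y ∈ Cb) (hB : ∃ b ∈ Cb, b ∈ B)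
    (hd : ∀ v ∈ Cb, v ∉ S) (hSx : Sep G A B (insert x S))
    (hX : Sep G' A (insert x S) X) : Sep G A B X := by
  intro Q hQ hQA hQB
  obtain ⟨b, hbQ, hb⟩ := hSx Q hQ hQA hQB
  obtain ⟨a, haQ, haA⟩ := hQA
  by_cases haS : a ∈ insert x S
  · obtain ⟨z, hz, hzX⟩ := hX {a} (Cn.singleton a) ⟨a, by simp, haA⟩ ⟨a, by simp, haS⟩
    rw [Finset.mem_singleton] at hz
    exact ⟨z, hz ▸ haQ, hzX⟩
  obtain ⟨Y, hY, c, hc, s, hs, haY, hYC, hadj⟩ := FH hQ haQ haS hbQ hb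
  have hYx : ∀ v ∈ Y, v ≠ x ∧ v ∉ S := fun v hv => by
    have := (Finset.mem_sdiff.1 (hY hv)).2
    simpa using this
  have hYC' : Cn G' Y := hYC.mono (by
    intro u hu v hv huv
    rcases hG u v huv with h | h | h
    · exact h
    · exact absurd h.1 (hYx u hu).1
    · exact absurd h.2 (hYx v hv).1)
  have hadj' : G'.Adj c s := by
    rcases hG c s hadj with h | h | h
    · exact h
    · exact absurd h.1 (hYx c hc).1
    · exfalso
      obtain ⟨z, hz, hzS⟩ := hS (Y ∪ Cb) (hYC'.union_inter hCb (h.1 ▸ hc) hy)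
        ⟨a, by simp [haY], haA⟩ (by obtain ⟨b, h1, h2⟩ := hB; exact ⟨b, by simp [h1], h2⟩)
      rcases Finset.mem_union.1 hz with hz | hz
      · exact (hYx z hz).2 hzS
      · exact hd z hz hzS
  rw [Finset.mem_inter] at hs
  obtain ⟨z, hz, hzX⟩ := hX (Insert.insert s Y) (hYC'.insert hc hadj') ⟨a, by simp [haY], haA⟩
    ⟨s, by simp, hs.2⟩
  refine ⟨z, ?_, hzX⟩
  rcases Finset.mem_insert.1 hz with h | h
  · rw [h]; exact hs.1
  · exact (Finset.mem_sdiff.1 (hY h)).1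

theorem menger [Fintype V] (G : SimpleGraph V) (A B : Finset V) (k : ℕ)
    (h : ∀ X, Sep G A B X → k ≤ X.card) :
    ∃ P : Fin k → Finset V, (∀ i, Cn G (P i)) ∧ (∀ i, ∃ a ∈ P i, a ∈ A) ∧
      (∀ i, ∃ b ∈ P i, b ∈ B) ∧ ∀ i j, i ≠ j → Disjoint (P i) (P j) := by
  classical
  induction hn : G.edgeSet.ncard using Nat.strong_induction_on generalizing G A B with
  | _ n ih =>
  by_cases hE : G.edgeSet.Nonempty
  swap
  · rw [Set.not_nonempty_iff_eq_empty, SimpleGraph.edgeSet_eq_empty] at hE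
    subst hE
    have h1 : k ≤ (A ∩ B).card := h _ (by
      rintro Q hQ ⟨a, ha, haA⟩ ⟨b, hb, hbB⟩
      have : {a} = Q := hQ.2 {a} (by simpa using ha) (by simp) (by simp)
      subst this
      rw [Finset.mem_singleton] at hb
      subst hb
      exact ⟨b, by simp, by simp [haA, hbB]⟩)
    obtain ⟨T, hT, hTk⟩ := Finset.exists_subset_card_eq h1
    let e := T.equivFin.symm.trans (Equiv.refl _)
    have e2 : Fin k ≃ T := (finCongr hTk.symm).trans e
    refine ⟨fun i => {(e2 i : V)}, fun i => Cn.singleton _, fun i => ⟨e2 i, by simp, ?_⟩,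
      fun i => ⟨e2 i, by simp, ?_⟩, fun i j hij => ?_⟩
    · exact (Finset.mem_inter.1 (hT (e2 i).2)).1
    · exact (Finset.mem_inter.1 (hT (e2 i).2)).2
    · rw [Finset.disjoint_singleton]
      intro h
      exact hij (e2.injective (Subtype.ext h))
  obtain ⟨e, he⟩ := hE
  set G' := G.deleteEdges {e} with hG'
  have hle : G' ≤ G := G.deleteEdges_le _
  have hlt : G'.edgeSet.ncard < n := by
    rw [← hn]
    apply Set.ncard_lt_ncard _ (Set.toFinite _)
    rw [hG', SimpleGraph.edgeSet_deleteEdges]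
    exact ⟨Set.diff_subset, fun h => (h he).2 rfl⟩
  by_cases hG'k : ∀ X, Sep G' A B X → k ≤ X.card
  · obtain ⟨P, h1, h2⟩ := ih _ hlt G' A B hG'k rfl
    exact ⟨P, fun i => (h1 i).mono fun a _ b _ hab => hle hab, h2⟩
  push Not at hG'k
  obtain ⟨S, hS, hSk⟩ := hG'k
  -- S is not a separator in G
  have : ¬ Sep G A B S := fun h' => by have := h S h'; omega
  unfold Sep at this
  push Not at this
  obtain ⟨Q, hQ, ⟨a, haQ, haA⟩, ⟨b, hbQ, hbB⟩, hQS⟩ := this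
  obtain ⟨Ca, hCaQ, haCa, hCa, hcla⟩ := exists_comp G' haQ
  obtain ⟨Cb, hCbQ, hbCb, hCb, hclb⟩ := exists_comp G' hbQ
  have hdis : ∀ v, v ∈ Ca → v ∉ Cb := by
    intro v hv hv'
    obtain ⟨z, hz, hzS⟩ := hS (Ca ∪ Cb) (hCa.union_inter hCb hv hv') ⟨a, by simp [haCa], haA⟩
      ⟨b, by simp [hbCb], hbB⟩
    exact hQS z ((Finset.union_subset hCaQ hCbQ) hz) hzS
  have leave : ∀ C : Finset V, C ⊆ Q → C.Nonempty → C ≠ Q →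
      (∀ c ∈ C, ∀ d ∈ Q, G'.Adj c d → d ∈ C) → ∃ x ∈ C, ∃ y ∈ Q, y ∉ C ∧ G.Adj x y ∧ s(x, y) = e := by
    intro C hCQ hne hneq hcl
    by_contra hcon
    push Not at hcon
    apply hneq
    apply hQ.2 C hCQ hne
    intro c hc d hd hcd
    by_contra hdC
    refine hdC (hcl c hc d hd ?_)
    rw [hG', SimpleGraph.deleteEdges_adj]
    exact ⟨hcd, hcon c hc d hd hdC hcd⟩
  obtain ⟨x, hxa, y, hyQ, hya, hxy, rfl⟩ := leave Ca hCaQ ⟨a, haCa⟩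
    (fun h' => hdis b (h' ▸ hbQ) hbCb) hcla
  obtain ⟨y', hyb, x', hx'Q, hx'b, hxy', he'⟩ := leave Cb hCbQ ⟨b, hbCb⟩
    (fun h' => hdis a haCa (h' ▸ haQ)) hclb
  have hyCb : y ∈ Cb := by
    rw [Sym2.eq_iff] at he'
    rcases he' with h' | h'
    · exact absurd (h'.1 ▸ hyb) (hdis x hxa)
    · exact h'.1 ▸ hyb
  have hGG : ∀ a b, G.Adj a b → G'.Adj a b ∨ (a = x ∧ b = y) ∨ (a = y ∧ b = x) := by
    intro a b hab
    by_cases h' : s(a, b) = s(x, y)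
    · right; exact Sym2.eq_iff.1 h'
    · left; rw [hG', SimpleGraph.deleteEdges_adj]; exact ⟨hab, h'⟩
  have hxS : x ∉ S := hQS x (hCaQ hxa)
  have hyS : y ∉ S := hQS y hyQ
  have hsx : ∀ z, (z = x ∨ z = y) → Sep G A B (insert z S) := by
    intro z hz Q' hQ' hA' hB'
    by_contra hcon
    push Not at hcon
    obtain ⟨w, hw, hwS⟩ := hS Q' (hQ'.mono fun u hu v hv huv => by
      rcases hGG u v huv with h' | ⟨h1, h2⟩ | ⟨h1, h2⟩
      · exact h'
      · subst h1 h2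
        rcases hz with rfl | rfl
        · exact absurd (by simp) (hcon _ hu)
        · exact absurd (by simp) (hcon _ hv)
      · subst h1 h2
        rcases hz with rfl | rfl
        · exact absurd (by simp) (hcon _ hv)
        · exact absurd (by simp) (hcon _ hu)) hA' hB'
    exact hcon w hw (by simp [hwS])
  have hSx : (insert x S).card = k := by
    have := h _ (hsx x (Or.inl rfl))
    rw [Finset.card_insert_of_notMem hxS] at this ⊢
    omega
  have hSy : (insert y S).card = k := by
    rw [Finset.card_insert_of_notMem hyS] at *
    rw [Finset.card_insert_of_notMem hxS] at hSx
    exact hSx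
  obtain ⟨P, hP, hPA, hPS, hPd⟩ := ih _ hlt G' A (insert x S) (fun X hX => h X
    (menger_aux hGG hS hCb hyCb ⟨b, hbCb, hbB⟩ (fun v hv => hQS v (hCbQ hv)) (hsx x (Or.inl rfl)) hX)) rfl
  obtain ⟨R, hR, hRB, hRS, hRd⟩ := ih _ hlt G' B (insert y S) (fun X hX => h X
    (menger_aux (fun a b hab => by rcases hGG a b hab with h | h | h <;> tauto) hS.symm hCa hxa
      ⟨a, haCa, haA⟩ (fun v hv => hQS v (hCaQ hv)) (hsx y (Or.inr rfl)).symm hX).symm) rfl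
  choose P' hP'P s hsP hP' hsT hP'A hP's hP'q using fun i => FHt (hP i) (hPA i) (hPS i)
  choose R' hR'R r hrR hR' hrT hR'B hR'r hR'q using fun i => FHt (hR i) (hRB i) (hRS i)
  have hP'd : ∀ i j, i ≠ j → Disjoint (P' i) (P' j) := fun i j hij =>
    (hPd i j hij).mono (hP'P i) (hP'P j)
  have hR'd : ∀ i j, i ≠ j → Disjoint (R' i) (R' j) := fun i j hij =>
    (hRd i j hij).mono (hR'R i) (hR'R j)
  have hsinj : Function.Injective s := by
    intro i j hij
    by_contra hne
    exact Finset.disjoint_left.1 (hP'd i j hne) (hsP i) (hij ▸ hsP j)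
  have hrinj : Function.Injective r := by
    intro i j hij
    by_contra hne
    exact Finset.disjoint_left.1 (hR'd i j hne) (hrR i) (hij ▸ hrR j)
  have hrsurj : ∀ v ∈ insert y S, ∃ j, r j = v := by
    have : Finset.univ.image r = insert y S := by
      apply Finset.eq_of_subset_of_card_le
      · intro v hv
        obtain ⟨j, _, rfl⟩ := Finset.mem_image.1 hv
        exact hrT j
      · rw [Finset.card_image_of_injective _ hrinj, hSy]; simp
    intro v hv
    rw [← this] at hv
    obtain ⟨j, _, h⟩ := Finset.mem_image.1 hv
    exact ⟨j, h⟩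
  -- sets with a vertex outside S
  have toA : ∀ i, ∀ v ∈ P' i, v ∉ S → ∃ Q, Cn G' Q ∧ v ∈ Q ∧ (∃ a ∈ Q, a ∈ A) ∧ Disjoint Q S := by
    intro i v hv hvS
    by_cases hvs : v = s i
    · refine ⟨P' i, hP' i, hv, hP'A i, ?_⟩
      rw [Finset.disjoint_left]
      intro w hw hwS
      have := hP's i w hw (by simp [hwS])
      rw [← hvs] at this
      exact hvS (this ▸ hwS)
    · obtain ⟨Q, _, h1, h2, h3, h4⟩ := hP'q i v hv hvs
      exact ⟨Q, h1, h2, h3, h4.mono_right (Finset.subset_insert _ _)⟩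
  have toB : ∀ i, ∀ v ∈ R' i, v ∉ S → ∃ Q, Cn G' Q ∧ v ∈ Q ∧ (∃ a ∈ Q, a ∈ B) ∧ Disjoint Q S := by
    intro i v hv hvS
    by_cases hvs : v = r i
    · refine ⟨R' i, hR' i, hv, hR'B i, ?_⟩
      rw [Finset.disjoint_left]
      intro w hw hwS
      have := hR'r i w hw (by simp [hwS])
      rw [← hvs] at this
      exact hvS (this ▸ hwS)
    · obtain ⟨Q, _, h1, h2, h3, h4⟩ := hR'q i v hv hvs
      exact ⟨Q, h1, h2, h3, h4.mono_right (Finset.subset_insert _ _)⟩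
  have hcommon : ∀ i j, ∀ v ∈ P' i, v ∈ R' j → v ∈ S := by
    intro i j v hv hv'
    by_contra hvS
    obtain ⟨Q1, a1, a2, ⟨a', ha', ha''⟩, a4⟩ := toA i v hv hvS
    obtain ⟨Q2, b1, b2, ⟨b', hb', hb''⟩, b4⟩ := toB j v hv' hvS
    obtain ⟨z, hz, hzS⟩ := hS (Q1 ∪ Q2) (a1.union_inter b1 a2 b2) ⟨a', by simp [ha'], ha''⟩
      ⟨b', by simp [hb'], hb''⟩
    rcases Finset.mem_union.1 hz with hz | hz
    · exact Finset.disjoint_left.1 a4 hz hzS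
    · exact Finset.disjoint_left.1 b4 hz hzS
  let φ : V → V := fun v => if v = x then y else v
  have hφ : ∀ i, φ (s i) ∈ insert y S := by
    intro i
    have := hsT i
    simp only [φ]
    split_ifs with h'
    · simp
    · rw [Finset.mem_insert] at this ⊢
      exact Or.inr (this.resolve_left h')
  choose τ hτ using fun i => hrsurj _ (hφ i)
  have hkey : ∀ i, s i = x ∧ r (τ i) = y ∨ s i ≠ x ∧ r (τ i) = s i ∧ s i ∈ S := by
    intro i
    by_cases h' : s i = x
    · left; refine ⟨h', ?_⟩; rw [hτ]; simp [φ, h']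
    · right; refine ⟨h', ?_, ?_⟩
      · rw [hτ]; simp [φ, h']
      · exact (Finset.mem_insert.1 (hsT i)).resolve_left h'
  have hτinj : Function.Injective τ := by
    intro i j hij
    apply hsinj
    rcases hkey i with h1 | h1 <;> rcases hkey j with h2 | h2
    · rw [h1.1, h2.1]
    · exfalso; apply hyS; rw [← h1.2, hij, h2.2.1]; exact h2.2.2
    · exfalso; apply hyS; rw [← h2.2, ← hij, h1.2.1]; exact h1.2.2
    · rw [← h1.2.1, hij, h2.2.1]
  refine ⟨fun i => P' i ∪ R' (τ i), fun i => ?_, fun i => ?_, fun i => ?_, fun i j hij => ?_⟩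
  · have h1 : Cn G (P' i) := (hP' i).mono fun _ _ _ _ h => hle h
    have h2 : Cn G (R' (τ i)) := (hR' (τ i)).mono fun _ _ _ _ h => hle h
    refine h1.union h2 (hsP i) (hrR (τ i)) ?_
    rcases hkey i with h' | h'
    · right; rw [h'.1, h'.2]; exact hxy
    · left; exact h'.2.1.symm
  · obtain ⟨a, h1, h2⟩ := hP'A i
    exact ⟨a, by simp [h1], h2⟩
  · obtain ⟨a, h1, h2⟩ := hR'B (τ i)
    exact ⟨a, by simp [h1], h2⟩
  · have cross : ∀ i j, i ≠ j → ∀ v ∈ P' i, v ∉ R' (τ j) := by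
      intro i j hij v hv hv'
      have hvS := hcommon i _ v hv hv'
      have e1 := hP's i v hv (by simp [hvS])
      have e2 := hR'r _ v hv' (by simp [hvS])
      rcases hkey j with h' | h'
      · rw [e2, h'.2] at hvS; exact hyS hvS
      · apply hij; apply hsinj; rw [← e1, e2, h'.2.1]
    rw [Finset.disjoint_left]
    intro v hv hv'
    rcases Finset.mem_union.1 hv with h1 | h1 <;> rcases Finset.mem_union.1 hv' with h2 | h2
    · exact Finset.disjoint_left.1 (hP'd i j hij) h1 h2
    · exact cross i j hij v h1 h2
    · exact cross j i hij.symm v h2 h1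
    · exact Finset.disjoint_left.1 (hR'd _ _ (fun h => hij (hτinj h))) h1 h2

end basics
end CD

namespace CD

section basics2
variable {V : Type*} [DecidableEq V] {G : SimpleGraph V}

lemma Cn.of_connected {X : Set V} {S : Finset V} (hS : ∀ v, v ∈ S ↔ v ∈ X)
    (h : (G.induce X).Connected) : Cn G S := by
  obtain ⟨a0⟩ := h.nonempty
  refine ⟨⟨a0, (hS _).2 a0.2⟩, fun A hA ⟨a, ha⟩ hcl => Finset.Subset.antisymm hA fun b hb => ?_⟩
  have hr := h.preconnected ⟨a, (hS a).1 (hA ha)⟩ ⟨b, (hS b).1 hb⟩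
  rw [SimpleGraph.reachable_iff_reflTransGen] at hr
  have : ∀ c : X, Relation.ReflTransGen (G.induce X).Adj ⟨a, (hS a).1 (hA ha)⟩ c → (c : V) ∈ A := by
    intro c hc
    induction hc with
    | refl => exact ha
    | tail _ h2 ih => exact hcl _ ih _ ((hS _).2 (Subtype.property _)) h2
  exact this _ hr

lemma Cn.connected {S : Finset V} (h : Cn G S) : (G.induce (S : Set V)).Connected := by
  classical
  obtain ⟨a, ha⟩ := h.1
  haveI : Nonempty (S : Set V) := ⟨⟨a, ha⟩⟩
  have key : ∀ b (hb : b ∈ (S : Set V)), (G.induce (S : Set V)).Reachable ⟨a, ha⟩ ⟨b, hb⟩ := by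
    have := h.2 (S.filter fun b => ∃ hb : b ∈ (S : Set V), (G.induce (S : Set V)).Reachable ⟨a, ha⟩ ⟨b, hb⟩)
      (Finset.filter_subset _ _) ⟨a, by
        rw [Finset.mem_filter]; exact ⟨ha, ha, SimpleGraph.Reachable.refl _⟩⟩ (by
        intro c hc b hb hcb
        rw [Finset.mem_filter] at hc ⊢
        obtain ⟨_, hc', hr⟩ := hc
        refine ⟨hb, hb, hr.trans (SimpleGraph.Adj.reachable ?_)⟩
        exact hcb)
    intro b hb
    have hb' : b ∈ S := hb
    rw [← this, Finset.mem_filter] at hb'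
    exact hb'.2.2
  exact ⟨fun u v => (key u u.2).symm.trans (key v v.2)⟩

lemma Cn.biUnion {W : Type*} [DecidableEq W] {H : SimpleGraph W} {Y : Finset W} {X : W → Finset V}
    (hY : Cn H Y) (hX : ∀ w ∈ Y, Cn G (X w))
    (hadj : ∀ w ∈ Y, ∀ w' ∈ Y, H.Adj w w' → Adjs G (X w) (X w')) : Cn G (Y.biUnion X) := by
  classical
  obtain ⟨w0, hw0⟩ := hY.1
  obtain ⟨v0, hv0⟩ := (hX w0 hw0).1
  refine ⟨⟨v0, Finset.mem_biUnion.2 ⟨w0, hw0, hv0⟩⟩, fun A hA ⟨a, ha⟩ hcl => ?_⟩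
  have full : ∀ w ∈ Y, ∀ v ∈ X w, v ∈ A → X w ⊆ A := by
    intro w hw v hv hvA
    have := (hX w hw).2 (A ∩ X w) Finset.inter_subset_right ⟨v, by simp [hv, hvA]⟩ (by
      intro c hc b hb hcb
      rw [Finset.mem_inter] at hc ⊢
      exact ⟨hcl c hc.1 b (Finset.mem_biUnion.2 ⟨w, hw, hb⟩) hcb, hb⟩)
    rw [← this]; exact Finset.inter_subset_left
  have := hY.2 (Y.filter fun w => X w ⊆ A) (Finset.filter_subset _ _) (by
    obtain ⟨w, hw, haw⟩ := Finset.mem_biUnion.1 (hA ha)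
    exact ⟨w, Finset.mem_filter.2 ⟨hw, full w hw a haw ha⟩⟩) (by
    intro w hw w' hw' hww
    rw [Finset.mem_filter] at hw ⊢
    obtain ⟨u, hu, v, hv, huv⟩ := hadj w hw.1 w' hw' hww
    exact ⟨hw', full w' hw' v hv (hcl u (hw.2 hu) v (Finset.mem_biUnion.2 ⟨w', hw', hv⟩) huv)⟩)
  apply Finset.Subset.antisymm hA
  intro v hv
  obtain ⟨w, hw, hvw⟩ := Finset.mem_biUnion.1 hv
  rw [← this, Finset.mem_filter] at hw
  exact hw.2 hvw

/-- Finset version of minors, inside `S`. -/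
def Mn {W : Type*} (G : SimpleGraph V) (S : Finset V) (H : SimpleGraph W) (X : W → Finset V) : Prop :=
  (∀ w, X w ⊆ S) ∧ (∀ w, Cn G (X w)) ∧ (∀ w w', w ≠ w' → Disjoint (X w) (X w')) ∧
  ∀ w w', H.Adj w w' → Adjs G (X w) (X w')

def KM (G : SimpleGraph V) (S : Finset V) (t : ℕ) : Prop :=
  ∃ X : Fin t → Finset V, Mn G S (⊤ : SimpleGraph (Fin t)) X

lemma Mn.hasMinor {W : Type*} {S : Finset V} {H : SimpleGraph W} {X : W → Finset V}
    (h : Mn G S H X) : G.HasMinor H := by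
  refine ⟨fun w => (X w : Set V), fun i j hij => ?_, fun i => (h.2.1 i).connected, fun i j hij => ?_⟩
  · exact Finset.disjoint_coe.2 (h.2.2.1 i j hij)
  · obtain ⟨u, hu, v, hv, huv⟩ := h.2.2.2 i j hij
    exact ⟨u, hu, v, hv, huv⟩

lemma Mn.of_hasMinor [Fintype V] {W : Type*} {H : SimpleGraph W} (h : G.HasMinor H) :
    ∃ X : W → Finset V, Mn G Finset.univ H X := by
  classical
  obtain ⟨X, h1, h2, h3⟩ := h
  refine ⟨fun w => (X w).toFinset, fun w => Finset.subset_univ _, fun w =>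
    Cn.of_connected (fun v => by simp) (h2 w), fun w w' hw => ?_, fun w w' hw => ?_⟩
  · rw [Set.disjoint_toFinset]; exact h1 hw
  · obtain ⟨u, hu, v, hv, huv⟩ := h3 w w' hw
    exact ⟨u, by simpa using hu, v, by simpa using hv, huv⟩

lemma Mn.trans {W U : Type*} [DecidableEq W] {H : SimpleGraph W} {K : SimpleGraph U} {S : Finset V}
    {T : Finset W} {X : W → Finset V} {Y : U → Finset W} (h1 : Mn G S H X) (h2 : Mn H T K Y) :
    Mn G S K (fun u => (Y u).biUnion X) := by
  refine ⟨fun u => Finset.biUnion_subset.2 fun w _ => h1.1 w, fun u => (h2.2.1 u).biUnion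
    (fun w _ => h1.2.1 w) (fun w _ w' _ h => h1.2.2.2 w w' h), fun u u' hu => ?_, fun u u' hu => ?_⟩
  · rw [Finset.disjoint_biUnion_left]
    intro w hw
    rw [Finset.disjoint_biUnion_right]
    intro w' hw'
    apply h1.2.2.1
    rintro rfl
    exact Finset.disjoint_left.1 (h2.2.2.1 u u' hu) hw hw'
  · obtain ⟨w, hw, w', hw', hww⟩ := h2.2.2.2 u u' hu
    exact (h1.2.2.2 w w' hww).mono (Finset.subset_biUnion_of_mem X hw) (Finset.subset_biUnion_of_mem X hw')

lemma HasMinor.trans [Fintype V] {W U : Type*} [Finite W] {H : SimpleGraph W} {K : SimpleGraph U}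
    (h1 : G.HasMinor H) (h2 : H.HasMinor K) : G.HasMinor K := by
  classical
  haveI := Fintype.ofFinite W
  obtain ⟨X, hX⟩ := Mn.of_hasMinor h1
  obtain ⟨Y, hY⟩ := Mn.of_hasMinor h2
  exact (hX.trans hY).hasMinor

lemma KM.mono {S T : Finset V} {t s : ℕ} (h : KM G S t) (hST : S ⊆ T) (hst : s ≤ t) : KM G T s := by
  obtain ⟨X, h1, h2, h3, h4⟩ := h
  have inj : ∀ i j : Fin s, i ≠ j → Fin.castLE hst i ≠ Fin.castLE hst j := fun i j hij h =>
    hij (by simpa using h)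
  exact ⟨fun i => X (Fin.castLE hst i), fun w => (h1 _).trans hST, fun w => h2 _,
    fun w w' hw => h3 _ _ (inj _ _ hw), fun w w' hw => h4 _ _ (inj _ _ hw)⟩

/-- subtype graph -/
abbrev sub (G : SimpleGraph V) (S : Finset V) : SimpleGraph S := G.comap (Subtype.val)

lemma Cn.map {S : Finset V} {T : Finset S} (h : Cn (sub G S) T) :
    Cn G (T.map (Function.Embedding.subtype _)) := by
  have := h.biUnion (G := G) (X := fun w : S => {(w : V)}) (fun w _ => Cn.singleton _)
    (fun w _ w' _ h => ⟨w, by simp, w', by simp, h⟩)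
  rw [Finset.biUnion_singleton] at this
  rwa [Finset.map_eq_image]

lemma Mn.ofSub {S : Finset V} : Mn G S (sub G S) (fun w => {(w : V)}) :=
  ⟨fun w => by simp, fun w => Cn.singleton _, fun w w' h => by
    rw [Finset.disjoint_singleton]; exact fun h' => h (Subtype.ext h'),
    fun w w' h => ⟨w, by simp, w', by simp, h⟩⟩

/-- `k`-connectivity -/
def kc (G : SimpleGraph V) (k : ℕ) (S : Finset V) : Prop :=
  k < S.card ∧ ∀ Y : Finset V, Y.card < k → Cn G (S \ Y)

lemma kc.mono {k l : ℕ} {S : Finset V} (h : kc G k S) (hl : l ≤ k) : kc G l S :=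
  ⟨hl.trans_lt h.1, fun Y hY => h.2 Y (hY.trans_le hl)⟩

lemma Col.mono {S T : Finset V} {m n : ℕ} (h : Col G S m) (hT : T ⊆ S) (hn : m ≤ n) : Col G T n := by
  obtain ⟨f, h1, h2⟩ := h
  exact ⟨f, fun v hv => (h1 v (hT hv)).trans_le hn, fun u hu v hv => h2 u (hT hu) v (hT hv)⟩

lemma Col.union {S T : Finset V} {m n : ℕ} (h : Col G S m) (h' : Col G T n) :
    Col G (S ∪ T) (m + n) := by
  obtain ⟨f, h1, h2⟩ := h
  obtain ⟨g, h3, h4⟩ := h'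
  refine ⟨fun v => if v ∈ S then f v else m + g v, fun v hv => ?_, fun u hu v hv huv => ?_⟩
  · rw [Finset.mem_union] at hv
    dsimp only
    split_ifs with h
    · have := h1 v h; omega
    · have := h3 v (hv.resolve_left h); omega
  · rw [Finset.mem_union] at hu hv
    dsimp only
    split_ifs with a b b
    · exact h2 u a v b huv
    · have := h1 u a; omega
    · have := h1 v b; omega
    · have := h4 u (hu.resolve_left a) v (hv.resolve_left b) huv; omega

lemma Col.empty {n : ℕ} : Col G ∅ n := ⟨fun _ => 0, by simp, by simp⟩

lemma Col.single {v : V} : Col G {v} 1 := ⟨fun _ => 0, by simp, by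
  intro u hu w hw h; simp only [Finset.mem_singleton] at hu hw; subst hu hw; exact absurd h (G.irrefl)⟩

lemma Col.card (S : Finset V) : Col G S S.card := by
  induction S using Finset.induction_on with
  | empty => exact Col.empty
  | insert a s ha ih =>
    have := (Col.single (G := G) (v := a)).union ih
    rw [Finset.card_insert_of_notMem ha]
    exact this.mono (by intro x hx; simpa using hx) (by omega)

lemma Col.indep {I : Finset V} (h : ∀ u ∈ I, ∀ v ∈ I, ¬ G.Adj u v) : Col G I 1 :=
  ⟨fun _ => 0, by simp, fun u hu v hv huv => absurd huv (h u hu v hv)⟩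

/-- restricted graph -/
def rs (G : SimpleGraph V) (Ω : Finset V) : SimpleGraph V where
  Adj u v := G.Adj u v ∧ u ∈ Ω ∧ v ∈ Ω
  symm := ⟨fun _ _ h => ⟨h.1.symm, h.2.2, h.2.1⟩⟩
  loopless := ⟨fun _ h => G.irrefl h.1⟩

lemma Cn.rs_sub {Ω Q : Finset V} (h : Cn (rs G Ω) Q) {a : V} (ha : a ∈ Q) (haΩ : a ∈ Ω) :
    Q ⊆ Ω := by
  have := h.2 (Q ∩ Ω) Finset.inter_subset_left ⟨a, by simp [ha, haΩ]⟩ (by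
    intro c hc b hb hcb
    exact Finset.mem_inter.2 ⟨hb, hcb.2.2⟩)
  rw [← this]; exact Finset.inter_subset_right

theorem mengerIn [Fintype V] (G : SimpleGraph V) (Ω A B : Finset V) (hA : A ⊆ Ω) (k : ℕ)
    (h : ∀ X : Finset V, (∀ Q ⊆ Ω, Cn G Q → (∃ a ∈ Q, a ∈ A) → (∃ b ∈ Q, b ∈ B) → ∃ x ∈ Q, x ∈ X) →
      k ≤ X.card) :
    ∃ P : Fin k → Finset V, (∀ i, P i ⊆ Ω) ∧ (∀ i, Cn G (P i)) ∧ (∀ i, ∃ a ∈ P i, a ∈ A) ∧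
      (∀ i, ∃ b ∈ P i, b ∈ B) ∧ ∀ i j, i ≠ j → Disjoint (P i) (P j) := by
  obtain ⟨P, h1, h2, h3, h4⟩ := menger (rs G Ω) A B k (fun X hX => h X fun Q hQ hC ha hb =>
    hX Q (hC.mono fun a ha b hb hab => ⟨hab, hQ ha, hQ hb⟩) ha hb)
  exact ⟨P, fun i => by obtain ⟨a, ha, haA⟩ := h2 i; exact (h1 i).rs_sub ha (hA haA),
    fun i => (h1 i).mono fun _ _ _ _ h => h.1, h2, h3, h4⟩

lemma exists_notMem_of_card_lt {S T : Finset V} (h : S.card < T.card) : ∃ a ∈ T, a ∉ S := by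
  by_contra hcon
  push Not at hcon
  exact absurd (Finset.card_le_card hcon) (by omega)

theorem kc.menger [Fintype V] {k m : ℕ} {J A B : Finset V} (hJ : kc G k J) (hA : A ⊆ J) (hB : B ⊆ J)
    (hm : m ≤ k) (hAm : m ≤ A.card) (hBm : m ≤ B.card) :
    ∃ P : Fin m → Finset V, (∀ i, P i ⊆ J) ∧ (∀ i, Cn G (P i)) ∧ (∀ i, ∃ a ∈ P i, a ∈ A) ∧
      (∀ i, ∃ b ∈ P i, b ∈ B) ∧ ∀ i j, i ≠ j → Disjoint (P i) (P j) := by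
  apply mengerIn G J A B hA m
  intro X hX
  by_contra hlt
  push Not at hlt
  obtain ⟨a, ha, haX⟩ := exists_notMem_of_card_lt (hlt.trans_le hAm)
  obtain ⟨b, hb, hbX⟩ := exists_notMem_of_card_lt (hlt.trans_le hBm)
  obtain ⟨x, hx, hxX⟩ := hX (J \ X) Finset.sdiff_subset (hJ.2 X (by omega))
    ⟨a, by simp [hA ha, haX], ha⟩ ⟨b, by simp [hB hb, hbX], hb⟩
  exact (Finset.mem_sdiff.1 hx).2 hxX

/-- list lemma -/
lemma list_lemma {ι : Type*} [DecidableEq ι] [Nonempty V] (s : Finset ι) (L : ι → Finset V)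
    (h : ∀ i ∈ s, s.card ≤ (L i).card) :
    ∃ f : ι → V, (∀ i ∈ s, f i ∈ L i) ∧ ∀ i ∈ s, ∀ j ∈ s, f i = f j → i = j := by
  induction s using Finset.induction_on with
  | empty => exact ⟨fun _ => Classical.arbitrary V, by simp, by simp⟩
  | insert a s ha ih =>
    rw [Finset.card_insert_of_notMem ha] at h
    obtain ⟨f, h1, h2⟩ := ih fun i hi => by have := h i (by simp [hi]); omega
    obtain ⟨b, hb, hbs⟩ := exists_notMem_of_card_lt (S := s.image f) (T := L a) (by
      have := h a (by simp)
      have := Finset.card_image_le (s := s) (f := f)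
      omega)
    have hne : ∀ i ∈ s, i ≠ a := fun i hi h => ha (h ▸ hi)
    have hb' : ∀ i ∈ s, b ≠ f i := fun i hi h => hbs (h ▸ Finset.mem_image_of_mem f hi)
    refine ⟨Function.update f a b, fun i hi => ?_, fun i hi j hj hij => ?_⟩
    · rcases Finset.mem_insert.1 hi with rfl | hi
      · simpa using hb
      · rw [Function.update_of_ne (hne i hi)]; exact h1 i hi
    · rcases Finset.mem_insert.1 hi with rfl | hi' <;> rcases Finset.mem_insert.1 hj with rfl | hj'
      · rfl
      · rw [Function.update_self, Function.update_of_ne (hne j hj')] at hij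
        exact absurd hij (hb' j hj')
      · rw [Function.update_self, Function.update_of_ne (hne i hi')] at hij
        exact absurd hij.symm (hb' i hi')
      · rw [Function.update_of_ne (hne i hi'), Function.update_of_ne (hne j hj')] at hij
        exact h2 i hi' j hj' hij

lemma list_lemma' {ι : Type*} [Fintype ι] (L : ι → Finset V)
    (h : ∀ i, Fintype.card ι ≤ (L i).card) :
    ∃ f : ι → V, (∀ i, f i ∈ L i) ∧ Function.Injective f := by
  classical
  rcases isEmpty_or_nonempty ι with h0 | h0
  · exact ⟨fun i => h0.elim i, fun i => h0.elim i, fun i => h0.elim i⟩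
  · have hV : Nonempty V := by
      have := h h0.some
      have h3 : 0 < Fintype.card ι := Fintype.card_pos
      obtain ⟨v, _⟩ := Finset.card_pos.1 (h3.trans_le this)
      exact ⟨v⟩
    obtain ⟨f, h1, h2⟩ := list_lemma Finset.univ L (by simpa using h)
    exact ⟨f, by simpa using h1, fun i j hij => h2 i (by simp) j (by simp) hij⟩

def Compat {ι : Type*} (x y : ι → V) : Prop := ∀ k l, k ≠ l → x k ≠ x l ∧ y k ≠ y l ∧ x k ≠ y l

def Rlz {ι : Type*} (G : SimpleGraph V) (P : Finset V) (x y : ι → V) (A : ι → Prop) : Prop :=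
  ∃ B : ι → Finset V, (∀ k, B k ⊆ P) ∧ (∀ k, Cn G (B k)) ∧ (∀ k l, k ≠ l → Disjoint (B k) (B l)) ∧
    (∀ k, x k ∈ B k) ∧ (∀ k, y k ∈ B k) ∧ ∀ k l, k ≠ l → A k → A l → Adjs G (B k) (B l)

def Wov (G : SimpleGraph V) (J : Finset V) (a n : ℕ) : Prop :=
  ∀ (ι : Type) [Fintype ι] (x y : ι → V) (A : Finset ι), Fintype.card ι ≤ n → A.card ≤ a →
    (∀ k, x k ∈ J) → (∀ k, y k ∈ J) → Compat x y → Rlz G J x y (· ∈ A)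

lemma Wov.mono {J : Finset V} {a n a' n' : ℕ} (h : Wov G J a n) (ha : a' ≤ a) (hn : n' ≤ n) :
    Wov G J a' n' := fun ι _ x y A h1 h2 => h ι x y A (h1.trans hn) (h2.trans ha)

end basics2
end CD

namespace CD

section mader
variable {V : Type*} [DecidableEq V] {G : SimpleGraph V}

open Classical in
noncomputable def nb (G : SimpleGraph V) (S : Finset V) (v : V) : Finset V := S.filter (G.Adj v)

lemma mem_nb {S : Finset V} {u v : V} : u ∈ nb G S v ↔ u ∈ S ∧ G.Adj v u := by
  simp [nb]

open Classical in
noncomputable def prs (G : SimpleGraph V) (S : Finset V) : Finset (V × V) :=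
  (S ×ˢ S).filter fun p => G.Adj p.1 p.2

lemma mem_prs {S : Finset V} {p : V × V} : p ∈ prs G S ↔ (p.1 ∈ S ∧ p.2 ∈ S) ∧ G.Adj p.1 p.2 := by
  simp [prs]

lemma prs_le (G : SimpleGraph V) {S : Finset V} {v : V} (hv : v ∈ S) :
    (prs G S).card ≤ (prs G (S.erase v)).card + 2 * (nb G S v).card := by
  have : prs G S ⊆ prs G (S.erase v) ∪ ((nb G S v).image (fun u => (v, u)) ∪
      (nb G S v).image (fun u => (u, v))) := by
    rintro ⟨a, b⟩ h
    rw [mem_prs] at h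
    simp only [Finset.mem_union, mem_prs, Finset.mem_erase, Finset.mem_image, mem_nb, Prod.mk.injEq]
    dsimp only at h
    by_cases ha : a = v
    · subst ha; right; left; exact ⟨b, ⟨h.1.2, h.2⟩, rfl, rfl⟩
    · by_cases hb : b = v
      · subst hb; right; right; exact ⟨a, ⟨h.1.1, h.2.symm⟩, rfl, rfl⟩
      · left; exact ⟨⟨⟨ha, h.1.1⟩, hb, h.1.2⟩, h.2⟩
  have h1 := Finset.card_le_card this
  have h2 := Finset.card_union_le (prs G (S.erase v)) ((nb G S v).image (fun u => (v, u)) ∪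
      (nb G S v).image (fun u => (u, v)))
  have h3 := Finset.card_union_le ((nb G S v).image (fun u => (v, u)))
      ((nb G S v).image (fun u => (u, v)))
  have h4 := Finset.card_image_le (s := nb G S v) (f := (fun u => (v, u)))
  have h5 := Finset.card_image_le (s := nb G S v) (f := (fun u => (u, v)))
  omega

lemma prs_sq (G : SimpleGraph V) {S : Finset V} (hS : S.Nonempty) :
    (prs G S).card < S.card * S.card := by
  classical
  rw [← Finset.card_product]
  apply Finset.card_lt_card
  refine ⟨Finset.filter_subset _ _, fun h => ?_⟩
  obtain ⟨v, hv⟩ := hS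
  have := h (Finset.mk_mem_product hv hv)
  rw [mem_prs] at this
  exact G.irrefl this.2

theorem mader {k : ℕ} (S : Finset V) (hS : 2 * k ≤ S.card) (hk : 1 ≤ k)
    (h : 4 * k * S.card < (prs G S).card + 4 * k * k) : ∃ S' ⊆ S, kc G k S' := by
  induction hn : S.card using Nat.strong_induction_on generalizing S with
  | _ n ih =>
  have hSne : S.Nonempty := Finset.card_pos.1 (by omega)
  have hsq := prs_sq G hSne
  by_cases h2k : S.card = 2 * k
  · exfalso
    rw [h2k] at h hsq
    nlinarith
  by_cases hdeg : ∃ v ∈ S, (nb G S v).card ≤ 2 * k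
  · obtain ⟨v, hv, hd⟩ := hdeg
    have h1 := prs_le G hv
    have h2 : (S.erase v).card + 1 = S.card := Finset.card_erase_add_one hv
    obtain ⟨S', hS', hk'⟩ := ih (S.erase v).card (by omega) (S.erase v) (by omega) (by nlinarith) rfl
    exact ⟨S', hS'.trans (Finset.erase_subset _ _), hk'⟩
  push Not at hdeg
  by_cases hkc : kc G k S
  · exact ⟨S, subset_rfl, hkc⟩
  unfold kc at hkc
  push Not at hkc
  obtain ⟨Y, hY, hYC⟩ := hkc (by omega)
  have hne : (S \ Y).Nonempty := by
    rw [Finset.sdiff_nonempty]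
    intro hh
    have := Finset.card_le_card hh
    omega
  obtain ⟨A, hA, hA0, hB0, hAB⟩ := not_Cn_split hne hYC
  set B := (S \ Y) \ A with hB
  set A' := A ∪ (Y ∩ S) with hA'
  set B' := B ∪ (Y ∩ S) with hB'
  have hA'S : A' ⊆ S := Finset.union_subset (hA.trans Finset.sdiff_subset) Finset.inter_subset_right
  have hB'S : B' ⊆ S := Finset.union_subset (Finset.sdiff_subset.trans Finset.sdiff_subset)
    Finset.inter_subset_right
  have hmem : ∀ v ∈ S, v ∈ A ∨ v ∈ B ∨ v ∈ Y ∩ S := by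
    intro v hv
    simp only [hB, Finset.mem_sdiff, Finset.mem_inter]
    tauto
  have cA : 2 * k < A'.card := by
    obtain ⟨v, hv⟩ := hA0
    refine (hdeg v (Finset.mem_sdiff.1 (hA hv)).1).trans_le (Finset.card_le_card fun u hu => ?_)
    rw [mem_nb] at hu
    rcases hmem u hu.1 with h' | h' | h'
    · simp [hA', h']
    · exact absurd hu.2 (hAB v hv u h')
    · exact Finset.mem_union_right _ h'
  have cB : 2 * k < B'.card := by
    obtain ⟨v, hv⟩ := hB0
    refine (hdeg v (Finset.mem_sdiff.1 (Finset.mem_sdiff.1 hv).1).1).trans_le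
      (Finset.card_le_card fun u hu => ?_)
    rw [mem_nb] at hu
    rcases hmem u hu.1 with h' | h' | h'
    · exact absurd hu.2.symm (hAB u h' v hv)
    · exact Finset.mem_union_left _ h'
    · exact Finset.mem_union_right _ h'
  have hpr : (prs G S).card ≤ (prs G A').card + (prs G B').card := by
    refine (Finset.card_le_card (fun p hp => ?_)).trans (Finset.card_union_le _ _)
    rw [mem_prs] at hp
    have mA : ∀ v, v ∈ A ∨ v ∈ Y ∩ S → v ∈ A' := fun v hv => Finset.mem_union.2 hv
    have mB : ∀ v, v ∈ B ∨ v ∈ Y ∩ S → v ∈ B' := fun v hv => Finset.mem_union.2 hv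
    rw [Finset.mem_union, mem_prs, mem_prs]
    rcases hmem _ hp.1.1 with h' | h' | h' <;> rcases hmem _ hp.1.2 with h'' | h'' | h''
    · exact Or.inl ⟨⟨mA _ (Or.inl h'), mA _ (Or.inl h'')⟩, hp.2⟩
    · exact absurd hp.2 (hAB _ h' _ h'')
    · exact Or.inl ⟨⟨mA _ (Or.inl h'), mA _ (Or.inr h'')⟩, hp.2⟩
    · exact absurd hp.2.symm (hAB _ h'' _ h')
    · exact Or.inr ⟨⟨mB _ (Or.inl h'), mB _ (Or.inl h'')⟩, hp.2⟩
    · exact Or.inr ⟨⟨mB _ (Or.inl h'), mB _ (Or.inr h'')⟩, hp.2⟩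
    · exact Or.inl ⟨⟨mA _ (Or.inr h'), mA _ (Or.inl h'')⟩, hp.2⟩
    · exact Or.inr ⟨⟨mB _ (Or.inr h'), mB _ (Or.inl h'')⟩, hp.2⟩
    · exact Or.inl ⟨⟨mA _ (Or.inr h'), mA _ (Or.inr h'')⟩, hp.2⟩
  have hcard : A'.card + B'.card + 1 ≤ S.card + k := by
    have e1 : A'.card ≤ A.card + (Y ∩ S).card := Finset.card_union_le _ _
    have e2 : B'.card ≤ B.card + (Y ∩ S).card := Finset.card_union_le _ _
    have e3 : B.card + A.card = (S \ Y).card := Finset.card_sdiff_add_card_eq_card hA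
    have e4 : (S \ Y).card + (Y ∩ S).card = S.card := by
      rw [Finset.inter_comm]; exact Finset.card_sdiff_add_card_inter S Y
    have e5 : (Y ∩ S).card ≤ Y.card := Finset.card_le_card Finset.inter_subset_left
    omega
  by_cases hAg : 4 * k * A'.card < (prs G A').card + 4 * k * k
  · obtain ⟨S', hS', hk'⟩ := ih A'.card (by omega) A' (by omega) hAg rfl
    exact ⟨S', hS'.trans hA'S, hk'⟩
  · by_cases hBg : 4 * k * B'.card < (prs G B').card + 4 * k * k
    · obtain ⟨S', hS', hk'⟩ := ih B'.card (by omega) B' (by omega) hBg rfl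
      exact ⟨S', hS'.trans hB'S, hk'⟩
    · exfalso
      push Not at hAg hBg
      have := Nat.mul_le_mul_left (4 * k) hcard
      nlinarith

lemma mader' {k : ℕ} (S : Finset V) (hk : 1 ≤ k) (hne : S.Nonempty)
    (h : 4 * k * S.card ≤ (prs G S).card) : ∃ S' ⊆ S, kc G k S' := by
  have h1 := prs_sq G hne
  have h2 : 0 < S.card := Finset.card_pos.2 hne
  have h3 : 4 * k < S.card := by
    by_contra h'
    push Not at h'
    have := Nat.mul_le_mul_right S.card h'
    omega
  exact mader S (by omega) hk (by nlinarith)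

lemma prs_univ [Fintype V] (G : SimpleGraph V) :
    (prs G Finset.univ).card = 2 * Nat.card G.edgeSet := by
  classical
  rw [Nat.card_eq_fintype_card, ← SimpleGraph.edgeFinset_card,
    ← SimpleGraph.sum_degrees_eq_twice_card_edges]
  rw [prs, Finset.card_filter, Finset.univ_product_univ, ← Finset.univ_product_univ,
    Finset.sum_product]
  refine Finset.sum_congr rfl fun v _ => ?_
  rw [← Finset.card_filter]
  rw [← SimpleGraph.card_neighborFinset_eq_degree]
  congr 1
  ext u
  simp

lemma prs_subgraph [Fintype V] (G : SimpleGraph V) (H : G.Subgraph) (S : Finset V)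
    (hS : ∀ v, v ∈ S ↔ v ∈ H.verts) : 2 * Nat.card H.edgeSet ≤ (prs G S).card := by
  rw [← SimpleGraph.Subgraph.edgeSet_spanningCoe, ← prs_univ]
  apply Finset.card_le_card
  intro p hp
  rw [mem_prs] at hp ⊢
  have h : H.Adj p.1 p.2 := hp.2
  exact ⟨⟨(hS _).2 h.fst_mem, (hS _).2 h.snd_mem⟩, h.adj_sub⟩

lemma prs_sub (G : SimpleGraph V) (S : Finset V) :
    (prs (sub G S) Finset.univ).card = (prs G S).card := by
  rw [← Finset.card_map ((Function.Embedding.subtype (· ∈ S)).prodMap (Function.Embedding.subtype (· ∈ S)))]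
  congr 1
  ext ⟨a, b⟩
  simp only [Finset.mem_map, mem_prs, Prod.exists]
  constructor
  · rintro ⟨x, y, ⟨-, h⟩, h'⟩
    simp only [Function.Embedding.prodMap, Function.Embedding.coeFn_mk, Prod.map, Prod.mk.injEq] at h'
    obtain ⟨rfl, rfl⟩ := h'
    exact ⟨⟨x.2, y.2⟩, h⟩
  · rintro ⟨⟨ha, hb⟩, h⟩
    exact ⟨⟨a, ha⟩, ⟨b, hb⟩, ⟨by simp, h⟩, rfl⟩

lemma density_sub (G : SimpleGraph V) (S : Finset V) :
    2 * (sub G S).density = ((prs G S).card : ℝ) / S.card := by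
  rw [SimpleGraph.density, ← prs_sub, prs_univ]
  simp
  ring

lemma Cn.unmap {S : Finset V} {T : Finset S}
    (h : Cn G (T.map (Function.Embedding.subtype _))) : Cn (sub G S) T := by
  refine ⟨Finset.map_nonempty.1 h.1, fun A hA hne hcl => ?_⟩
  have := h.2 (A.map (Function.Embedding.subtype _)) (Finset.map_subset_map.2 hA)
    (Finset.map_nonempty.2 hne) (by
      intro a ha b hb hab
      rw [Finset.mem_map] at ha hb ⊢
      obtain ⟨a', ha', rfl⟩ := ha
      obtain ⟨b', hb', rfl⟩ := hb
      exact ⟨b', hcl a' ha' b' hb' hab, rfl⟩)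
  exact Finset.map_injective _ this

lemma kc.toSub {k : ℕ} {S : Finset V} (h : kc G k S) : kc (sub G S) k Finset.univ := by
  refine ⟨by simpa using h.1, fun Y hY => Cn.unmap ?_⟩
  have := h.2 (Y.map (Function.Embedding.subtype _)) (by simpa using hY)
  convert this using 1
  ext v
  simp
  exact ⟨fun ⟨h1, h2⟩ => ⟨h1, fun _ => h2⟩, fun ⟨h1, h2⟩ => ⟨h1, h2 h1⟩⟩

lemma kc.unsub {k : ℕ} {S : Finset V} {T : Finset S} (h : kc (sub G S) k T) :
    kc G k (T.map (Function.Embedding.subtype _)) := by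
  classical
  refine ⟨by simpa using h.1, fun Y hY => ?_⟩
  have := (h.2 (Finset.univ.filter fun v : S => (v : V) ∈ Y) ?_).map
  · convert this using 1
    ext v
    simp
  · refine lt_of_le_of_lt ?_ hY
    rw [← Finset.card_map (Function.Embedding.subtype _)]
    apply Finset.card_le_card
    intro v
    simp
    tauto

lemma density_le [Fintype V] (G : SimpleGraph V) : G.density ≤ Fintype.card V := by
  rcases isEmpty_or_nonempty V with h | h
  · simp [SimpleGraph.density]
  · have := prs_sq G (S := Finset.univ) Finset.univ_nonempty
    rw [prs_univ] at this
    have hpos : (0 : ℝ) < Fintype.card V := by exact_mod_cast Fintype.card_pos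
    rw [SimpleGraph.density, Nat.card_eq_fintype_card (α := V), div_le_iff₀ hpos]
    have h2 : Nat.card G.edgeSet ≤ Fintype.card V * Fintype.card V := by
      simp only [Finset.card_univ] at this; omega
    exact_mod_cast h2

lemma minor_card_le [Fintype V] {W : Type*} [Fintype W] {J : SimpleGraph W} (h : G.HasMinor J) :
    Fintype.card W ≤ Fintype.card V := by
  obtain ⟨X, h1, h2, h3, _⟩ := Mn.of_hasMinor h
  choose f hf using fun w => (h2 w).1
  refine Fintype.card_le_of_injective f fun i j hij => ?_
  by_contra hne
  exact Finset.disjoint_left.1 (h3 i j hne) (hf i) (hij ▸ hf j)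

end mader

def Hyp (C : ℝ) : Prop := ∀ (V : Type) [Fintype V] (G : SimpleGraph V) (D : ℝ), 0 < D → C ≤ G.density →
      (∃ (W : Type) (_ : Finite W) (J : SimpleGraph W), G.HasMinor J ∧ D ≤ J.density) ∨
      (∃ H : G.Subgraph,
        (Nat.card H.verts : ℝ) ≤ C * (1 + Real.log (D / G.density)) ^ 5 * D ^ 2 / G.density ∧
        G.density / (C * (1 + Real.log (D / G.density)) ^ 5) ≤ H.density)

/-- small highly connected subsets, from the second alternative -/
lemma hyp_use {C : ℝ} (hC : 0 < C) (hyp : Hyp C) {V : Type} [Fintype V] [DecidableEq V]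
    (G : SimpleGraph V) (D g : ℝ) (hD : 0 < D) (hd : C ≤ G.density) (hDd : G.density ≤ D)
    (hg : C * (1 + Real.log (D / G.density)) ^ 5 ≤ g) (k : ℕ) (hk : 1 ≤ k)
    (hkd : 2 * k * g ≤ G.density)
    (hno : ∀ (W : Type) (_ : Finite W) (J : SimpleGraph W), G.HasMinor J → J.density < D) :
    ∃ S : Finset V, kc G k S ∧ (S.card : ℝ) ≤ g * D ^ 2 / G.density := by
  classical
  have hdpos : 0 < G.density := hC.trans_le hd
  have hlog : 0 ≤ Real.log (D / G.density) := Real.log_nonneg (by rw [le_div_iff₀ hdpos]; linarith)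
  have hgpos : 0 < C * (1 + Real.log (D / G.density)) ^ 5 := by positivity
  have hgpos' : 0 < g := hgpos.trans_le hg
  rcases hyp V G D hD hd with ⟨W, hW, J, h1, h2⟩ | ⟨H, h1, h2⟩
  · exact absurd (hno W hW J h1) (by linarith)
  · let S : Finset V := H.verts.toFinset
    have hS : ∀ v, v ∈ S ↔ v ∈ H.verts := by simp [S]
    have hSc : Nat.card H.verts = S.card := by
      rw [Nat.card_eq_fintype_card, Set.toFinset_card]
    have h3 := prs_subgraph G H S hS
    rw [SimpleGraph.Subgraph.density, hSc] at h2
    rw [hSc] at h1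
    have h4 : 2 * (k : ℝ) ≤ (Nat.card H.edgeSet : ℝ) / S.card := by
      refine le_trans ?_ h2
      rw [le_div_iff₀ hgpos]
      exact le_trans (mul_le_mul_of_nonneg_left hg (by positivity)) hkd
    have hk' : (1 : ℝ) ≤ k := by exact_mod_cast hk
    have hSne : S.Nonempty := by
      rw [Finset.nonempty_iff_ne_empty]
      intro h0
      rw [h0] at h4
      simp at h4
      linarith
    have hSpos : (0 : ℝ) < S.card := by exact_mod_cast Finset.card_pos.2 hSne
    rw [le_div_iff₀ hSpos] at h4
    obtain ⟨S', hS', hkc⟩ := mader' (G := G) S hk hSne (by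
      have h4' : 2 * k * S.card ≤ Nat.card H.edgeSet := by exact_mod_cast h4
      nlinarith)
    refine ⟨S', hkc, ?_⟩
    have : (S'.card : ℝ) ≤ S.card := by exact_mod_cast Finset.card_le_card hS'
    refine this.trans (h1.trans ?_)
    gcongr

theorem dense_minor {C : ℝ} (hC : 0 < C) (hyp : Hyp C) :
    ∃ c1 : ℕ, 1 ≤ c1 ∧ ∀ (V : Type) [Fintype V] (G : SimpleGraph V) (k : ℕ), c1 ≤ k →
      (k : ℝ) ≤ G.density → ∃ (W : Type) (_ : Fintype W) (_ : DecidableEq W) (R : SimpleGraph W) (q : ℕ),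
        G.HasMinor R ∧ 1 ≤ q ∧ kc R q Finset.univ ∧ Fintype.card W ≤ c1 * q ∧ k ≤ c1 * q := by
  classical
  obtain ⟨c1, hc1⟩ := exists_nat_ge (max (C + 1) (max (256 * C) (64 * C * (256 * C))))
  have hcC : C + 1 ≤ c1 := (le_max_left _ _).trans hc1
  have hc2 : 256 * C ≤ c1 := ((le_max_left _ _).trans (le_max_right _ _)).trans hc1
  have hc3 : 64 * C * (256 * C) ≤ c1 := ((le_max_right _ _).trans (le_max_right _ _)).trans hc1
  have hc1pos : 1 ≤ c1 := by
    have : (1 : ℝ) ≤ c1 := by linarith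
    exact_mod_cast this
  refine ⟨c1, hc1pos, ?_⟩
  intro V _ G k hk hkG
  have hkr : (c1 : ℝ) ≤ k := by exact_mod_cast hk
  have hk1 : (1 : ℝ) ≤ k := by linarith
  let P : ℕ → Prop := fun n => ∃ (W : Type) (_ : Finite W) (J : SimpleGraph W), G.HasMinor J ∧
    (k : ℝ) * 2 ^ n ≤ J.density
  have hP0 : P 0 := ⟨V, inferInstance, G, by
    refine ⟨fun v => {v}, fun i j hij => by simpa using hij, fun i => ?_, fun i j hij => ?_⟩
    · have := (Cn.singleton (G := G) i).connected
      rwa [Finset.coe_singleton] at this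
    · exact ⟨i, rfl, j, rfl, hij⟩, by simpa using hkG⟩
  have hPb : ∀ n, P n → (2 : ℝ) ^ n ≤ Fintype.card V := by
    rintro n ⟨W, hW, J, h1, h2⟩
    have := Fintype.ofFinite W
    have h3 := density_le J
    have h4 : (Fintype.card W : ℝ) ≤ Fintype.card V := by exact_mod_cast minor_card_le h1
    have : (2 : ℝ) ^ n ≤ k * 2 ^ n := le_mul_of_one_le_left (by positivity) hk1
    linarith
  have : ∃ n, P n ∧ ¬ P (n + 1) := by
    by_contra hcon
    push Not at hcon
    have hall : ∀ n, P n := fun n => by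
      induction n with
      | zero => exact hP0
      | succ n ih => exact hcon n ih
    have h1 := hPb (Fintype.card V) (hall _)
    have h2 : Fintype.card V < 2 ^ Fintype.card V := Nat.lt_two_pow_self
    have h3 : (Fintype.card V : ℝ) < 2 ^ Fintype.card V := by exact_mod_cast h2
    linarith
  obtain ⟨n, ⟨W, hW, J, hGJ, hJ⟩, hn⟩ := this
  have := Fintype.ofFinite W
  set D : ℝ := k * 2 ^ (n + 1) with hDdef
  have h2n : (1 : ℝ) ≤ 2 ^ n := one_le_pow₀ (by norm_num)
  have hkJ : (k : ℝ) ≤ J.density := le_trans (le_mul_of_one_le_right (by linarith) h2n) hJ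
  have hD2 : D = 2 * (k * 2 ^ n) := by rw [hDdef, pow_succ]; ring
  have hJD : J.density < D := by
    by_contra h'
    push Not at h'
    exact hn ⟨W, hW, J, hGJ, h'⟩
  have hno : ∀ (W' : Type) (_ : Finite W') (J' : SimpleGraph W'), J.HasMinor J' → J'.density < D := by
    intro W' hW' J' h'
    by_contra h''
    push Not at h''
    exact hn ⟨W', hW', J', HasMinor.trans hGJ h', h''⟩
  have hJpos : 0 < J.density := by linarith
  have hDpos : 0 < D := by linarith
  have hs2 : D / J.density ≤ 2 := by rw [div_le_iff₀ hJpos]; linarith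
  have hs1 : 1 ≤ D / J.density := by rw [le_div_iff₀ hJpos]; linarith
  have hl0 : 0 ≤ Real.log (D / J.density) := Real.log_nonneg hs1
  have hl1 : Real.log (D / J.density) ≤ 1 := by
    have := Real.log_le_sub_one_of_pos (x := D / J.density) (by positivity)
    linarith
  have hg : C * (1 + Real.log (D / J.density)) ^ 5 ≤ 32 * C := by
    have : (1 + Real.log (D / J.density)) ^ 5 ≤ (2 : ℝ) ^ 5 := by
      apply pow_le_pow_left₀ <;> linarith
    nlinarith
  set q := ⌊D / (128 * C)⌋₊ with hq
  have hDq : (q : ℝ) ≤ D / (128 * C) := Nat.floor_le (by positivity)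
  have hDq' : D / (128 * C) < q + 1 := Nat.lt_floor_add_one _
  have hq1 : 1 ≤ q := by
    rw [hq, Nat.one_le_floor_iff, le_div_iff₀ (by positivity)]
    linarith
  have hq1r : (1 : ℝ) ≤ q := by exact_mod_cast hq1
  rw [le_div_iff₀ (by positivity)] at hDq
  rw [div_lt_iff₀ (by positivity)] at hDq'
  have hD256 : D ≤ 256 * C * q := by nlinarith
  obtain ⟨S, hSk, hSc⟩ := hyp_use hC hyp J D (32 * C) hDpos (by linarith) hJD.le hg q hq1
    (by nlinarith) hno
  refine ⟨S, inferInstance, inferInstance, sub J S, q, ?_, hq1, hSk.toSub, ?_, ?_⟩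
  · exact HasMinor.trans hGJ (Mn.ofSub (G := J) (S := S)).hasMinor
  · have h1 : 32 * C * D ^ 2 / J.density ≤ 64 * C * D := by
      rw [div_le_iff₀ hJpos]
      have : D ≤ 2 * J.density := by linarith
      have hCD : 0 < C * D := by positivity
      nlinarith
    have h2 : (S.card : ℝ) ≤ c1 * q := by
      refine (hSc.trans h1).trans ?_
      calc 64 * C * D ≤ 64 * C * (256 * C * q) := by gcongr
        _ = 64 * C * (256 * C) * q := by ring
        _ ≤ c1 * q := by gcongr
    rw [Fintype.card_coe]
    exact_mod_cast h2
  · have h2 : (k : ℝ) ≤ c1 * q := by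
      have : (k : ℝ) ≤ D := by linarith
      calc (k : ℝ) ≤ 256 * C * q := by linarith
        _ ≤ c1 * q := by gcongr
    exact_mod_cast h2

end CD

namespace CD

section robust
variable {W : Type*} [DecidableEq W] {R : SimpleGraph W}

lemma kc.deg {q : ℕ} {J : Finset W} (h : kc R q J) {u : W} (hu : u ∈ J) :
    q ≤ (nb R J u).card := by
  by_contra hlt
  push Not at hlt
  have h1 := h.2 _ hlt
  have hu' : u ∈ J \ nb R J u := by simp [hu, mem_nb]
  have h2 := h1.2 {u} (by simpa using hu') (by simp) (by
    intro a ha b hb hab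
    rw [Finset.mem_singleton] at ha
    subst ha
    simp only [Finset.mem_sdiff, mem_nb] at hb
    tauto)
  have h3 := Finset.card_le_card (Finset.subset_union_left (s₁ := J) (s₂ := nb R J u))
  rw [← Finset.sdiff_union_self_eq_union, ← h2] at h3
  have h4 := Finset.card_union_le {u} (nb R J u)
  have h5 := h.1
  simp only [Finset.card_singleton] at h4
  omega

lemma F1 {S : Finset W} {δ c : ℕ} (hS : Cn R S) (x : W) (hdeg : ∀ u, (u = x ∨ u ∈ S) → δ ≤ (nb R S u).card)
    (hδ : 1 ≤ δ) (hc : S.card ≤ c * δ) :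
    ∀ v ∈ S, ∃ Q ⊆ S, Q.card ≤ 3 * c + 1 ∧ Cn R (insert x Q) ∧ v ∈ Q := by
  classical
  let re : ℕ → W → Prop := fun j v => ∃ Q ⊆ S, Q.card ≤ j ∧ Cn R (insert x Q) ∧ v ∈ Q
  let X : ℕ → Finset W := fun j => S.filter (re j)
  have hmono : ∀ j, X j ⊆ X (j + 1) := by
    intro j v hv
    simp only [X, Finset.mem_filter] at hv ⊢
    obtain ⟨h1, Q, h2, h3, h4⟩ := hv
    exact ⟨h1, Q, h2, by omega, h4⟩
  have hstep : ∀ j, ∀ v ∈ X j, ∀ w ∈ S, R.Adj v w → w ∈ X (j + 1) := by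
    intro j v hv w hw hvw
    simp only [X, Finset.mem_filter] at hv ⊢
    obtain ⟨h1, Q, h2, h3, h4, h5⟩ := hv
    refine ⟨hw, insert w Q, Finset.insert_subset hw h2, (Finset.card_insert_le _ _).trans (by omega),
      ?_, by simp⟩
    rw [Finset.insert_comm]
    exact h4.insert (by simp [h5]) hvw
  have hX1 : nb R S x ⊆ X 1 := by
    intro v hv
    rw [mem_nb] at hv
    simp only [X, Finset.mem_filter]
    refine ⟨hv.1, {v}, by simpa using hv.1, by simp, ?_, by simp⟩
    rw [Finset.pair_comm]
    exact (Cn.singleton x).insert (by simp) hv.2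
  have hmain : ∀ i, X (3 * i + 1) = S ∨ (i + 1) * δ ≤ (X (3 * i + 1)).card := by
    intro i
    induction i with
    | zero =>
      right
      have := Finset.card_le_card hX1
      have := hdeg x (Or.inl rfl)
      simp only [mul_zero, zero_add, one_mul]
      omega
    | succ i ih =>
      have e : 3 * (i + 1) + 1 = 3 * i + 1 + 1 + 1 + 1 := by ring
      rw [e]
      have hss : ∀ j, X j ⊆ S := fun j => Finset.filter_subset _ _
      have hup : ∀ j, X j = S → X (j + 1) = S := fun j hj =>
        Finset.Subset.antisymm (hss _) (by rw [← hj]; exact hj ▸ hmono j)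
      by_cases h2 : X (3 * i + 1 + 1) = S
      · left; exact hup _ (hup _ h2)
      have h1 : X (3 * i + 1) ≠ S := fun h => h2 (hup _ h)
      have ih' := ih.resolve_left h1
      right
      have hne : (X (3 * i + 1 + 1)).Nonempty := by
        have : 0 < (X (3 * i + 1)).card := lt_of_lt_of_le (by positivity) ih'
        exact (Finset.card_pos.1 this).mono (hmono _)
      have : ¬ ∀ a ∈ X (3 * i + 1 + 1), ∀ b ∈ S, R.Adj a b → b ∈ X (3 * i + 1 + 1) :=
        fun h => h2 (hS.2 _ (hss _) hne h)
      push Not at this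
      obtain ⟨a, ha, d, hd, had, hd2⟩ := this
      have hd3 := hstep _ a ha d hd had
      have hsub : X (3 * i + 1) ∪ nb R S d ⊆ X (3 * i + 1 + 1 + 1 + 1) := by
        apply Finset.union_subset
        · exact (hmono _).trans ((hmono _).trans (hmono _))
        · intro w hw
          rw [mem_nb] at hw
          exact hstep _ d hd3 w hw.1 hw.2
      have hdisj : Disjoint (X (3 * i + 1)) (nb R S d) := by
        rw [Finset.disjoint_left]
        intro w hw hw'
        rw [mem_nb] at hw'
        exact hd2 (hstep _ w hw d hd hw'.2.symm)
      have := Finset.card_le_card hsub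
      rw [Finset.card_union_of_disjoint hdisj] at this
      have h5 := hdeg d (Or.inr hd)
      have h6 : (i + 1 + 1) * δ = (i + 1) * δ + δ := by ring
      omega
  intro v hv
  have : X (3 * c + 1) = S := by
    rcases hmain c with h | h
    · exact h
    · exfalso
      have := Finset.card_le_card (Finset.filter_subset (re (3 * c + 1)) S)
      rw [add_mul, one_mul] at h
      change _ ≤ (S.filter _).card at h
      omega
  rw [← this] at hv
  exact (Finset.mem_filter.1 hv).2

/-- dominated set -/
noncomputable def und (R : SimpleGraph W) (U D : Finset W) : Finset W := by
  classical exact U.filter fun u => ∀ d ∈ D, ¬ R.Adj u d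

lemma mem_und {U D : Finset W} {u : W} : u ∈ und R U D ↔ u ∈ U ∧ ∀ d ∈ D, ¬ R.Adj u d := by
  simp [und]

lemma F2a {S : Finset W} {δ c : ℕ} (hdeg : ∀ u, δ ≤ (nb R S u).card)
    (hδ : 1 ≤ δ) (hc : S.card ≤ c * δ) (U : Finset W) (hU : U.Nonempty) :
    ∃ s ∈ S, U.card ≤ c * (nb R U s).card := by
  classical
  by_contra hcon
  push Not at hcon
  have h1 : ∑ u ∈ U, (nb R S u).card = ∑ s ∈ S, (nb R U s).card := by
    have := Finset.sum_card_bipartiteAbove_eq_sum_card_bipartiteBelow (s := U) (t := S) R.Adj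
    simp only [Finset.bipartiteAbove, Finset.bipartiteBelow] at this
    unfold nb
    simp only [R.adj_comm] at this ⊢
    convert this using 6
    all_goals exact R.adj_comm _ _
  have h2 : U.card * δ ≤ ∑ u ∈ U, (nb R S u).card := by
    rw [← smul_eq_mul]; exact Finset.card_nsmul_le_sum _ _ _ fun u _ => hdeg u
  have hSne : S.Nonempty := by
    obtain ⟨u, hu⟩ := hU
    have : 0 < (nb R S u).card := lt_of_lt_of_le (by omega) (hdeg u)
    obtain ⟨v, hv⟩ := Finset.card_pos.1 this
    exact ⟨v, (mem_nb.1 hv).1⟩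
  have h3 : ∑ s ∈ S, c * (nb R U s).card < ∑ s ∈ S, U.card := Finset.sum_lt_sum_of_nonempty hSne hcon
  rw [← Finset.mul_sum, ← h1, Finset.sum_const, smul_eq_mul] at h3
  have h4 : c * (U.card * δ) ≤ c * ∑ u ∈ U, (nb R S u).card := Nat.mul_le_mul_left c h2
  have h5 : S.card * U.card ≤ c * δ * U.card := Nat.mul_le_mul_right _ hc
  nlinarith

lemma F2b {S : Finset W} {δ c : ℕ} (hdeg : ∀ u, δ ≤ (nb R S u).card)
    (hδ : 1 ≤ δ) (hc : S.card ≤ c * δ) (U : Finset W) (i : ℕ) :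
    ∃ D ⊆ S, D.card ≤ i ∧ (2 * (und R U D).card ≤ U.card ∨
      2 * c * (und R U D).card + i * U.card ≤ 2 * c * U.card) := by
  induction i with
  | zero =>
    refine ⟨∅, by simp, by simp, Or.inr ?_⟩
    have : und R U ∅ ⊆ U := fun u hu => (mem_und.1 hu).1
    have := Finset.card_le_card this
    nlinarith
  | succ i ih =>
    obtain ⟨D, hD, hDi, h⟩ := ih
    by_cases h2 : 2 * (und R U D).card ≤ U.card
    · exact ⟨D, hD, by omega, Or.inl h2⟩
    have h3 := h.resolve_left h2
    obtain ⟨s, hs, hsc⟩ := F2a hdeg hδ hc (und R U D) (by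
      rw [Finset.nonempty_iff_ne_empty]; rintro h0; rw [h0] at h2; simp at h2)
    refine ⟨insert s D, Finset.insert_subset hs hD, (Finset.card_insert_le _ _).trans (by omega), Or.inr ?_⟩
    have h4 : (und R U (insert s D)).card + (nb R (und R U D) s).card ≤ (und R U D).card := by
      rw [← Finset.card_union_of_disjoint]
      · apply Finset.card_le_card
        intro u hu
        rw [Finset.mem_union] at hu
        rcases hu with hu | hu
        · rw [mem_und] at hu ⊢
          exact ⟨hu.1, fun d hd => hu.2 d (by simp [hd])⟩
        · exact (mem_nb.1 hu).1
      · rw [Finset.disjoint_left]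
        intro u hu hu'
        exact (mem_und.1 hu).2 s (by simp) (mem_nb.1 hu').2.symm
    have h5 := Nat.mul_le_mul_left (2 * c) h4
    nlinarith

lemma F2c {S : Finset W} {δ c : ℕ} (hdeg : ∀ u, δ ≤ (nb R S u).card)
    (hδ : 1 ≤ δ) (hc1 : 1 ≤ c) (hc : S.card ≤ c * δ) (U : Finset W) (L : ℕ) :
    ∃ D ⊆ S, D.card ≤ c * L ∧ 2 ^ L * (und R U D).card ≤ U.card := by
  induction L with
  | zero =>
    refine ⟨∅, by simp, by simp, ?_⟩
    have : und R U ∅ ⊆ U := fun u hu => (mem_und.1 hu).1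
    simpa using Finset.card_le_card this
  | succ L ih =>
    obtain ⟨D, hD, hDc, h⟩ := ih
    obtain ⟨D', hD', hDc', h'⟩ := F2b hdeg hδ hc (und R U D) c
    refine ⟨D ∪ D', Finset.union_subset hD hD', (Finset.card_union_le _ _).trans (by rw [mul_add]; omega), ?_⟩
    have e : und R U (D ∪ D') ⊆ und R (und R U D) D' := by
      intro u hu
      rw [mem_und] at hu
      rw [mem_und, mem_und]
      exact ⟨⟨hu.1, fun d hd => hu.2 d (by simp [hd])⟩, fun d hd => hu.2 d (by simp [hd])⟩
    have e2 := Finset.card_le_card e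
    have e3 : 2 * (und R (und R U D) D').card ≤ (und R U D).card := by
      rcases h' with h' | h'
      · exact h'
      · have : c * (2 * (und R (und R U D) D').card) ≤ c * (und R U D).card := by nlinarith
        exact Nat.le_of_mul_le_mul_left this (by omega)
    calc 2 ^ (L + 1) * (und R U (D ∪ D')).card ≤ 2 ^ (L + 1) * (und R (und R U D) D').card :=
          Nat.mul_le_mul_left _ e2
      _ = 2 ^ L * (2 * (und R (und R U D) D').card) := by ring
      _ ≤ 2 ^ L * (und R U D).card := Nat.mul_le_mul_left _ e3
      _ ≤ U.card := h

lemma F2 [Fintype W] {S : Finset W} {δ c L : ℕ} (hS : Cn R S) (hdeg : ∀ u, δ ≤ (nb R S u).card)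
    (hδ : 1 ≤ δ) (hc1 : 1 ≤ c) (hc : S.card ≤ c * δ) (hL : Fintype.card W < 2 ^ L) :
    ∃ D ⊆ S, D.card ≤ c * L * (3 * c + 1) + 1 ∧ Cn R D ∧ ∀ w, ∃ d ∈ D, R.Adj w d := by
  obtain ⟨D, hD, hDc, h⟩ := F2c hdeg hδ hc1 hc Finset.univ L
  have hund : (und R Finset.univ D).card = 0 := by
    rw [Finset.card_univ] at h
    by_contra h0
    have : 2 ^ L * 1 ≤ 2 ^ L * (und R Finset.univ D).card := Nat.mul_le_mul_left _ (by omega)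
    omega
  have hdom : ∀ w, ∃ d ∈ D, R.Adj w d := by
    intro w
    by_contra hcon
    push Not at hcon
    rw [Finset.card_eq_zero] at hund
    have : w ∈ und R Finset.univ D := mem_und.2 ⟨by simp, hcon⟩
    rw [hund] at this
    simp at this
  obtain ⟨s0, hs0⟩ := hS.1
  have hconn : ∀ E ⊆ D, ∃ D' ⊆ S, E ⊆ D' ∧ s0 ∈ D' ∧ Cn R D' ∧ D'.card ≤ E.card * (3 * c + 1) + 1 := by
    intro E
    induction E using Finset.induction_on with
    | empty => intro _; exact ⟨{s0}, by simpa using hs0, by simp, by simp, Cn.singleton _, by simp⟩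
    | insert d E hd ih =>
      intro hE
      obtain ⟨D', h1, h2, h3, h4, h5⟩ := ih ((Finset.subset_insert _ _).trans hE)
      obtain ⟨Q, hQ, hQc, hQC, hdQ⟩ := F1 hS s0 (fun u _ => hdeg u) hδ hc d (hD (hE (by simp)))
      refine ⟨D' ∪ insert s0 Q, Finset.union_subset h1 (Finset.insert_subset hs0 hQ), ?_, by simp,
        h4.union_inter hQC h3 (by simp), ?_⟩
      · intro e he
        rcases Finset.mem_insert.1 he with rfl | he
        · simp [hdQ]
        · simp [h2 he]
      · rw [Finset.card_insert_of_notMem hd]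
        have : D' ∪ insert s0 Q = D' ∪ Q := by
          ext v; simp only [Finset.mem_union, Finset.mem_insert]
          constructor
          · rintro (h | rfl | h) <;> simp [*]
          · rintro (h | h) <;> simp [*]
        rw [this]
        have := Finset.card_union_le D' Q
        rw [add_mul, one_mul]
        omega
  obtain ⟨D', h1, h2, h3, h4, h5⟩ := hconn D subset_rfl
  refine ⟨D', h1, h5.trans ?_, h4, fun w => ?_⟩
  · have := Nat.mul_le_mul_right (3 * c + 1) hDc
    omega
  · obtain ⟨d, hd, h⟩ := hdom w
    exact ⟨d, h2 hd, h⟩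

theorem robust [Fintype W] {q c1 c L n a : ℕ} (hkc : kc R q Finset.univ) (hq : 1 ≤ q)
    (hc1 : 1 ≤ c1) (hcc : c = 2 * c1) (hN : Fintype.card W ≤ c1 * q) (hL : Fintype.card W < 2 ^ L)
    (hb : 2 * (4 * n + n * (3 * c + 3) + a * (c * L * (3 * c + 1) + 1)) ≤ q)
    (Z : Finset W) (hZ : Z.card ≤ 2 * n) (ι : Type) [Fintype ι] (x y : ι → W) (A : Finset ι)
    (hι : Fintype.card ι ≤ n) (hA : A.card ≤ a) (hx : ∀ k, x k ∉ Z) (hy : ∀ k, y k ∉ Z)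
    (hxy : Compat x y) : Rlz R (Finset.univ \ Z) x y (· ∈ A) := by
  classical
  set T : Finset W := Finset.univ.image x ∪ Finset.univ.image y with hT
  have hxT : ∀ k, x k ∈ T := fun k => by simp [hT]
  have hyT : ∀ k, y k ∈ T := fun k => by simp [hT]
  have hTc : T.card ≤ 2 * n := by
    have h1 := Finset.card_union_le (Finset.univ.image x) (Finset.univ.image y)
    have h2 := Finset.card_image_le (s := Finset.univ) (f := x)
    have h3 := Finset.card_image_le (s := Finset.univ) (f := y)
    rw [Finset.card_univ] at h2 h3
    rw [← hT] at h1
    omega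
  set M1 := 3 * c + 3 with hM1
  set M2 := c * L * (3 * c + 1) + 1 with hM2
  have main : ∀ s : Finset ι, ∃ B : ι → Finset W, (∀ k ∈ s, Cn R (B k) ∧ x k ∈ B k ∧ y k ∈ B k ∧
      B k ⊆ Finset.univ \ Z ∧ (∀ v ∈ B k, v ∈ T → v = x k ∨ v = y k) ∧
      (k ∈ A → ∀ w, ∃ d ∈ B k, R.Adj w d)) ∧
      (∀ k ∈ s, ∀ l ∈ s, k ≠ l → Disjoint (B k) (B l)) ∧
      (s.biUnion B).card ≤ s.card * M1 + (A ∩ s).card * M2 := by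
    intro s
    induction s using Finset.induction_on with
    | empty => exact ⟨fun _ => ∅, by simp, by simp, by simp⟩
    | insert k s hk ih =>
      obtain ⟨B, hB, hd, hcard⟩ := ih
      set F := Z ∪ T ∪ s.biUnion B with hF
      have hFc : F.card ≤ q / 2 := by
        have h1 := Finset.card_union_le (Z ∪ T) (s.biUnion B)
        have h2 := Finset.card_union_le Z T
        rw [← hF] at h1
        have h3 : s.card * M1 ≤ n * M1 := Nat.mul_le_mul_right _
          ((Finset.card_le_univ s).trans hι)
        have h4 : (A ∩ s).card * M2 ≤ a * M2 := Nat.mul_le_mul_right _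
          ((Finset.card_le_card Finset.inter_subset_left).trans hA)
        omega
      set S := Finset.univ \ F with hSdef
      have hS : Cn R S := hkc.2 F (by omega)
      have hdeg : ∀ u, q - q / 2 ≤ (nb R S u).card := by
        intro u
        have h1 := hkc.deg (Finset.mem_univ u)
        have h2 : nb R Finset.univ u ⊆ nb R S u ∪ F := by
          intro w hw
          rw [mem_nb] at hw
          rw [Finset.mem_union, mem_nb, hSdef, Finset.mem_sdiff]
          by_cases h : w ∈ F
          · exact Or.inr h
          · exact Or.inl ⟨⟨hw.1, h⟩, hw.2⟩
        have h3 := Finset.card_le_card h2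
        have h4 := Finset.card_union_le (nb R S u) F
        omega
      have hScard : S.card ≤ c * (q - q / 2) := by
        have h1 : S.card ≤ Fintype.card W := Finset.card_le_univ S
        have h2 : c1 * q ≤ c1 * (2 * (q - q / 2)) := Nat.mul_le_mul_left _ (by omega)
        rw [hcc]
        nlinarith
      have hδ : 1 ≤ q - q / 2 := by omega
      -- find new set
      have hnew : ∃ Q ⊆ S, Cn R (insert (y k) (insert (x k) Q)) ∧ (k ∈ A → ∀ w, ∃ d ∈ Q, R.Adj w d) ∧
          Q.card + 2 ≤ M1 + (if k ∈ A then M2 else 0) := by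
        by_cases hkA : k ∈ A
        · obtain ⟨D, h1, h2, h3, h4⟩ := F2 hS hdeg hδ (by omega) hScard hL
          refine ⟨D, h1, ?_, fun _ => h4, ?_⟩
          · obtain ⟨d, hd, hxd⟩ := h4 (x k)
            obtain ⟨d', hd', hyd⟩ := h4 (y k)
            exact (h3.insert hd hxd.symm).insert (by simp [hd']) hyd.symm
          · rw [if_pos hkA]; omega
        · have : 0 < (nb R S (y k)).card := lt_of_lt_of_le (by omega) (hdeg (y k))
          obtain ⟨v, hv⟩ := Finset.card_pos.1 this
          rw [mem_nb] at hv
          obtain ⟨Q, h1, h2, h3, h4⟩ := F1 hS (x k) (fun u _ => hdeg u) hδ hScard v hv.1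
          refine ⟨Q, h1, h3.insert (by simp [h4]) hv.2.symm, fun h => absurd h hkA, ?_⟩
          rw [if_neg hkA]; omega
      obtain ⟨Q, hQS, hQC, hQA, hQc⟩ := hnew
      have hQF : ∀ v ∈ Q, v ∉ F := fun v hv => (Finset.mem_sdiff.1 (hQS hv)).2
      set Bk := insert (y k) (insert (x k) Q) with hBk
      have hBkT : ∀ v ∈ Bk, v ∈ T → v = x k ∨ v = y k := by
        intro v hv hvT
        simp only [hBk, Finset.mem_insert] at hv
        rcases hv with h | h | h
        · exact Or.inr h
        · exact Or.inl h
        · exact absurd (by simp [hF, hvT]) (hQF v h)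
      have hdk : ∀ l ∈ s, Disjoint Bk (B l) := by
        intro l hl
        have hkl : k ≠ l := fun h => hk (h ▸ hl)
        rw [Finset.disjoint_left]
        intro v hv hvl
        by_cases hvT : v ∈ T
        · have h1 := hBkT v hv hvT
          have h2 := (hB l hl).2.2.2.2.1 v hvl hvT
          have h3 := hxy k l hkl
          have h4 := hxy l k hkl.symm
          rcases h1 with h1 | h1 <;> rcases h2 with h2 | h2
          · exact h3.1 (h1.symm.trans h2)
          · exact h3.2.2 (h1.symm.trans h2)
          · exact h4.2.2 (h2.symm.trans h1)
          · exact h3.2.1 (h1.symm.trans h2)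
        · simp only [hBk, Finset.mem_insert] at hv
          rcases hv with h | h | h
          · exact hvT (h ▸ hyT k)
          · exact hvT (h ▸ hxT k)
          · refine hQF v h ?_
            rw [hF, Finset.mem_union]
            exact Or.inr (Finset.mem_biUnion.2 ⟨l, hl, hvl⟩)
      have hne : ∀ l ∈ s, l ≠ k := fun l hl h => hk (h ▸ hl)
      refine ⟨Function.update B k Bk, fun l hl => ?_, fun l hl m hm hlm => ?_, ?_⟩
      · rcases Finset.mem_insert.1 hl with rfl | hl'
        · rw [Function.update_self]
          refine ⟨hQC, by simp [hBk], by simp [hBk], ?_, hBkT, fun h w => ?_⟩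
          · intro v hv
            simp only [hBk, Finset.mem_insert] at hv
            rw [Finset.mem_sdiff]
            refine ⟨by simp, ?_⟩
            rcases hv with h | h | h
            · rw [h]; exact hy l
            · rw [h]; exact hx l
            · intro hvZ; exact hQF v h (by simp [hF, hvZ])
          · obtain ⟨d, hd, hwd⟩ := hQA h w
            exact ⟨d, by simp [hBk, hd], hwd⟩
        · rw [Function.update_of_ne (hne l hl')]; exact hB l hl'
      · rcases Finset.mem_insert.1 hl with rfl | hl' <;> rcases Finset.mem_insert.1 hm with rfl | hm'
        · exact absurd rfl hlm
        · rw [Function.update_self, Function.update_of_ne (hne m hm')]; exact hdk m hm'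
        · rw [Function.update_self, Function.update_of_ne (hne l hl')]; exact (hdk l hl').symm
        · rw [Function.update_of_ne (hne m hm'), Function.update_of_ne (hne l hl')]
          exact hd l hl' m hm' hlm
      · have e1 : s.biUnion (Function.update B k Bk) = s.biUnion B :=
          Finset.biUnion_congr rfl fun l hl => by rw [Function.update_of_ne (hne l hl)]
        rw [Finset.biUnion_insert, Function.update_self, e1]
        have h1 := Finset.card_union_le Bk (s.biUnion B)
        have h2 : Bk.card ≤ Q.card + 2 := (Finset.card_insert_le _ _).trans
          (by have := Finset.card_insert_le (x k) Q; omega)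
        rw [Finset.card_insert_of_notMem hk, add_mul, one_mul]
        by_cases hkA : k ∈ A
        · rw [Finset.inter_insert_of_mem hkA, Finset.card_insert_of_notMem (by simp [hk]), add_mul, one_mul]
          rw [if_pos hkA] at hQc
          omega
        · rw [Finset.inter_insert_of_notMem hkA]
          rw [if_neg hkA] at hQc
          omega
  obtain ⟨B, hB, hd, -⟩ := main Finset.univ
  refine ⟨B, fun k => (hB k (by simp)).2.2.2.1, fun k => (hB k (by simp)).1, fun k l h => hd k (by simp) l (by simp) h,
    fun k => (hB k (by simp)).2.1, fun k => (hB k (by simp)).2.2.1, fun k l hkl hk hl => ?_⟩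
  obtain ⟨d, hd', h⟩ := (hB l (by simp)).2.2.2.2.2 hl (x k)
  exact ⟨x k, (hB k (by simp)).2.1, d, hd', h⟩

end robust
end CD

namespace CD

section link
variable {V : Type*} [DecidableEq V] {G : SimpleGraph V}

/-- bijective linkage from a family of disjoint connected sets -/
lemma linkage {m : ℕ} {T U Ω : Finset V} (hT : T.card = m) (hU : U.card = m)
    (P : Fin m → Finset V) (h0 : ∀ i, P i ⊆ Ω) (h1 : ∀ i, Cn G (P i)) (h2 : ∀ i, ∃ a ∈ P i, a ∈ T)
    (h3 : ∀ i, ∃ b ∈ P i, b ∈ U) (h4 : ∀ i j, i ≠ j → Disjoint (P i) (P j)) :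
    ∃ (σ : V → V) (Q : V → Finset V), ∀ t ∈ T, t ∈ Q t ∧ σ t ∈ Q t ∧ σ t ∈ U ∧ Q t ⊆ Ω ∧ Cn G (Q t) ∧
      (∀ v ∈ Q t, v ∈ U → v = σ t) ∧ (∀ v ∈ Q t, v ∈ T → v = t) ∧
      (∀ t' ∈ T, t ≠ t' → Disjoint (Q t) (Q t')) ∧ (∀ u ∈ U, ∃ t ∈ T, σ t = u) := by
  classical
  have surj : ∀ (S : Finset V) (_ : S.card = m) (f : Fin m → V) (_ : ∀ i, f i ∈ P i) (_ : ∀ i, f i ∈ S),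
      (∀ s ∈ S, ∃ i, f i = s) ∧ ∀ i, ∀ v ∈ P i, v ∈ S → v = f i := by
    intro S hS f hf hfS
    have inj : Function.Injective f := by
      intro i j hij
      by_contra hne
      exact Finset.disjoint_left.1 (h4 i j hne) (hf i) (hij ▸ hf j)
    have himg : Finset.univ.image f = S := by
      apply Finset.eq_of_subset_of_card_le
      · intro v hv
        obtain ⟨j, _, rfl⟩ := Finset.mem_image.1 hv
        exact hfS j
      · rw [Finset.card_image_of_injective _ inj, hS]; simp
    have hs : ∀ s ∈ S, ∃ i, f i = s := by
      intro s hs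
      rw [← himg] at hs
      obtain ⟨j, _, h⟩ := Finset.mem_image.1 hs
      exact ⟨j, h⟩
    refine ⟨hs, fun i v hv hvS => ?_⟩
    obtain ⟨j, rfl⟩ := hs v hvS
    by_contra hne
    have hij : i ≠ j := fun h => hne (by rw [h])
    exact Finset.disjoint_left.1 (h4 i j hij) hv (hf j)
  choose a ha haT using h2
  choose b hb hbU using h3
  obtain ⟨sT, uT⟩ := surj T hT a ha haT
  obtain ⟨sU, uU⟩ := surj U hU b hb hbU
  let ix : V → Option (Fin m) := fun v => if h : ∃ i, a i = v then some h.choose else none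
  have hix : ∀ t ∈ T, ∃ i, ix t = some i ∧ a i = t := by
    intro t ht
    have h := sT t ht
    exact ⟨h.choose, by simp [ix, h], h.choose_spec⟩
  refine ⟨fun v => ((ix v).map b).getD v, fun v => ((ix v).map P).getD ∅, fun t ht => ?_⟩
  obtain ⟨i, hi, rfl⟩ := hix t ht
  simp only [hi, Option.map_some, Option.getD_some]
  refine ⟨ha i, hb i, hbU i, h0 i, h1 i, uU i, uT i, ?_, ?_⟩
  · intro t' ht' hne
    obtain ⟨j, hj, rfl⟩ := hix t' ht'
    simp only [hj, Option.map_some, Option.getD_some]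
    exact h4 i j fun h => hne (by rw [h])
  · intro u hu
    obtain ⟨j, rfl⟩ := sU u hu
    refine ⟨a j, haT j, ?_⟩
    obtain ⟨l, hl, hal⟩ := hix (a j) (haT j)
    simp only [hl, Option.map_some, Option.getD_some]
    have : l = j := by
      by_contra hne
      exact Finset.disjoint_left.1 (h4 l j hne) (ha l) (hal ▸ ha j)
    rw [this]
end link

section RS
variable {V : Type*} [DecidableEq V] [Fintype V] {W : Type*} [DecidableEq W] [Fintype W]
  {ι : Type*} {R : SimpleGraph W}

structure RSH (R : SimpleGraph W) (m : ℕ) (G : SimpleGraph V) (P T : Finset V) (x y : ι → V)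
    (X : W → Finset V) : Prop where
  hT : ∀ v, v ∈ T ↔ ∃ k, v = x k ∨ v = y k
  hTP : T ⊆ P
  hTm : T.card = m
  cmp : Compat x y
  hXP : ∀ w, X w ⊆ P
  hXne : ∀ w, (X w).Nonempty
  hXd : ∀ w w', w ≠ w' → Disjoint (X w) (X w')
  conn : ∀ w, ∀ A ⊆ X w, A.Nonempty → (∀ a ∈ A, ∀ b ∈ X w, G.Adj a b → b ∈ A) →
    A = X w ∨ ∃ v ∈ A, v ∈ T
  adj : ∀ w w', R.Adj w w' → Adjs G (X w) (X w') ∨ ((∃ v ∈ X w, v ∈ T) ∧ ∃ v ∈ X w', v ∈ T)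
  sep : ∀ A B : Finset V, A ∪ B = P → (∀ a ∈ A, a ∉ B → ∀ b ∈ B, b ∉ A → ¬ G.Adj a b) → T ⊆ A →
    (A ∩ B).card < m → ∀ w, ¬ X w ⊆ B \ A

lemma hits_card {m : ℕ} {X : W → Finset V} (hXd : ∀ w w', w ≠ w' → Disjoint (X w) (X w'))
    {U : Finset V} (hU : U.card ≤ m) {Z : Finset W} (hZ : ∀ w ∈ Z, ∃ v ∈ X w, v ∈ U) : Z.card ≤ m := by
  classical
  choose f hf hfU using hZ
  rw [← Finset.card_attach]
  refine le_trans (Finset.card_le_card_of_injOn (fun w : Z => f w.1 w.2) (fun w _ => hfU w.1 w.2) ?_) hU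
  intro w hw w' hw' hww
  by_contra hne
  refine Finset.disjoint_left.1 (hXd w w' fun h => hne (Subtype.ext h)) (hf w.1 w.2) ?_
  have h2 := hf w'.1 w'.2
  simp only at hww
  rw [← hww] at h2
  exact h2

lemma RS_case1 {m : ℕ} {G : SimpleGraph V} {P T : Finset V} {x y : ι → V} {X : W → Finset V}
    (h : RSH R m G P T x y X) (R1 : ∀ Z : Finset W, Z.card ≤ m → Cn R (Finset.univ \ Z))
    {A B : Finset V} (hAB : A ∪ B = P) (hE : ∀ a ∈ A, a ∉ B → ∀ b ∈ B, b ∉ A → ¬ G.Adj a b)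
    (hTA : T ⊆ A) (hm : (A ∩ B).card = m) {w0 : W} (hw0 : X w0 ⊆ B \ A) (D : ι → Prop) :
    ∃ T' x' y' X', RSH R m G B T' x' y' X' ∧ (Rlz (ι := ι) G B x' y' D → Rlz G P x y D) := by
  classical
  have hAP : A ⊆ P := hAB ▸ Finset.subset_union_left
  have hBP : B ⊆ P := hAB ▸ Finset.subset_union_right
  have hPm : ∀ v ∈ P, v ∉ A → v ∈ B := fun v hv hA => by
    rw [← hAB] at hv; exact (Finset.mem_union.1 hv).resolve_left hA
  have hPm' : ∀ v ∈ P, v ∉ B → v ∈ A := fun v hv hA => by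
    rw [← hAB] at hv; exact (Finset.mem_union.1 hv).resolve_right hA
  -- neighbours of B \ A
  have hnb : ∀ b ∈ P, b ∉ A → ∀ c ∈ P, G.Adj b c → c ∈ B := by
    intro b hb hbA c hc hbc
    by_contra hcB
    exact hE c (hPm' c hc hcB) hcB b (hPm b hb hbA) hbA hbc.symm
  have claim : ∀ w, X w ⊆ B \ A ∨ ∃ v ∈ X w, v ∈ A ∩ B := by
    set Z := Finset.univ.filter fun w => ∃ v ∈ X w, v ∈ A ∩ B with hZ
    have hZc : Z.card ≤ m := hits_card h.hXd hm.le (by simp [hZ])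
    have hC := R1 Z hZc
    have hw0Z : w0 ∉ Z := by
      simp only [hZ, Finset.mem_filter, not_and, not_exists]
      intro _ v hv hv'
      exact (Finset.mem_sdiff.1 (hw0 hv)).2 (Finset.mem_inter.1 hv').1
    have hfil := hC.2 ((Finset.univ \ Z).filter fun w => X w ⊆ B \ A) (Finset.filter_subset _ _)
      ⟨w0, by simp [hw0Z, hw0]⟩ (by
        intro w hw w' hw' hww
        rw [Finset.mem_filter] at hw ⊢
        refine ⟨hw', ?_⟩
        have hnoT : ¬ ∃ v ∈ X w, v ∈ T := by
          rintro ⟨v, hv, hvT⟩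
          exact (Finset.mem_sdiff.1 (hw.2 hv)).2 (hTA hvT)
        obtain ⟨u, hu, v, hv, huv⟩ := (h.adj w w' hww).resolve_right fun h' => hnoT h'.1
        have hu' := Finset.mem_sdiff.1 (hw.2 hu)
        have hvB := hnb u (hBP hu'.1) hu'.2 v (h.hXP _ hv) huv
        have hnoAB : ∀ z ∈ X w', z ∈ B → z ∉ A := by
          intro z hz hzB hzA
          rw [Finset.mem_sdiff] at hw'
          apply hw'.2
          rw [hZ, Finset.mem_filter]
          exact ⟨by simp, z, hz, by simp [hzA, hzB]⟩
        rcases h.conn w' (X w' ∩ B) Finset.inter_subset_left ⟨v, by simp [hv, hvB]⟩ (by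
          intro a ha b hb hab
          rw [Finset.mem_inter] at ha ⊢
          exact ⟨hb, hnb a (hBP ha.2) (hnoAB a ha.1 ha.2) b (h.hXP _ hb) hab⟩) with h' | ⟨z, hz, hzT⟩
        · intro z hz
          have hz' := hz
          rw [← h', Finset.mem_inter] at hz'
          rw [Finset.mem_sdiff]
          exact ⟨hz'.2, hnoAB z hz hz'.2⟩
        · rw [Finset.mem_inter] at hz
          exact absurd (hTA hzT) (hnoAB z hz.1 hz.2))
    intro w
    by_cases hw : w ∈ Z
    · right; rw [hZ, Finset.mem_filter] at hw; exact hw.2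
    · left
      have : w ∈ Finset.univ \ Z := by simp [hw]
      rw [← hfil, Finset.mem_filter] at this
      exact this.2
  have claim' : ∀ w, ∀ v ∈ X w, v ∈ A → ∃ v ∈ X w, v ∈ A ∩ B := fun w v hv hvA =>
    (claim w).resolve_left fun h' => (Finset.mem_sdiff.1 (h' hv)).2 hvA
  -- Menger
  obtain ⟨Pm, p0, p1, p2, p3, p4⟩ := mengerIn G A T (A ∩ B) hTA m (by
    intro X0 hX0
    by_contra hlt
    push Not at hlt
    set Cc := A.filter fun v => ∃ Q ⊆ A \ X0, Cn G Q ∧ v ∈ Q ∧ ∃ t ∈ Q, t ∈ T with hCc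
    have hmemC : ∀ v, v ∈ Cc ↔ v ∈ A ∧ ∃ Q ⊆ A \ X0, Cn G Q ∧ v ∈ Q ∧ ∃ t ∈ Q, t ∈ T := by simp [hCc]
    have hCX : ∀ v ∈ Cc, v ∈ A ∧ v ∉ X0 := by
      intro v hv
      obtain ⟨h1, Q, h2, _, h3, _⟩ := (hmemC v).1 hv
      exact Finset.mem_sdiff.1 (h2 h3)
    refine h.sep (Cc ∪ (X0 ∩ A)) (P \ Cc) ?_ ?_ ?_ ?_ w0 ?_
    · ext v
      simp only [Finset.mem_union, Finset.mem_inter, Finset.mem_sdiff]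
      constructor
      · rintro ((h' | h') | h')
        · exact hAP (hCX v h').1
        · exact hAP h'.2
        · exact h'.1
      · intro hv
        by_cases hc : v ∈ Cc
        · exact Or.inl (Or.inl hc)
        · exact Or.inr ⟨hv, hc⟩
    · intro a ha haB b hb hbA hab
      rw [Finset.mem_sdiff] at haB hb
      push Not at haB
      have haP : a ∈ P := by
        rcases Finset.mem_union.1 ha with h' | h'
        · exact hAP (hCX a h').1
        · exact hAP (Finset.mem_inter.1 h').2
      have haC := haB haP
      obtain ⟨haA, Q, hQ, hQC, haQ, t, htQ, htT⟩ := (hmemC a).1 haC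
      simp only [Finset.mem_union, Finset.mem_inter, not_or, not_and] at hbA
      by_cases hbA' : b ∈ A
      · apply hb.2
        rw [hmemC]
        refine ⟨hbA', insert b Q, Finset.insert_subset ?_ hQ, hQC.insert haQ hab, by simp, t, by simp [htQ], htT⟩
        rw [Finset.mem_sdiff]
        exact ⟨hbA', fun hbX => hbA.2 hbX hbA'⟩
      · have haB' := hnb b hb.1 hbA' a haP hab.symm
        obtain ⟨z, hz, hzX⟩ := hX0 Q (hQ.trans Finset.sdiff_subset) hQC ⟨t, htQ, htT⟩ ⟨a, haQ, by simp [haA, haB']⟩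
        exact (Finset.mem_sdiff.1 (hQ hz)).2 hzX
    · intro t ht
      rw [Finset.mem_union]
      by_cases htX : t ∈ X0
      · right; simp [htX, hTA ht]
      · left
        rw [hmemC]
        exact ⟨hTA ht, {t}, by simp [htX, hTA ht], Cn.singleton t, by simp, t, by simp, ht⟩
    · refine lt_of_le_of_lt (Finset.card_le_card ?_) hlt
      intro v hv
      simp only [Finset.mem_inter, Finset.mem_union, Finset.mem_sdiff] at hv
      rcases hv.1 with h' | h'
      · exact absurd h' hv.2.2
      · exact h'.1
    · intro v hv
      have hv' := Finset.mem_sdiff.1 (hw0 hv)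
      simp only [Finset.mem_sdiff, Finset.mem_union, Finset.mem_inter, not_or, not_and]
      have hc : v ∉ Cc := fun h' => hv'.2 (hCX v h').1
      exact ⟨⟨hBP hv'.1, hc⟩, hc, fun _ => hv'.2⟩)
  obtain ⟨σ, Q, hσ⟩ := linkage h.hTm hm Pm p0 p1 p2 p3 p4
  have hxT : ∀ k, x k ∈ T := fun k => (h.hT _).2 ⟨k, Or.inl rfl⟩
  have hyT : ∀ k, y k ∈ T := fun k => (h.hT _).2 ⟨k, Or.inr rfl⟩
  have σinj : ∀ t ∈ T, ∀ t' ∈ T, t ≠ t' → σ t ≠ σ t' := by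
    intro t ht t' ht' hne heq
    obtain ⟨_, a1, _, _, _, _, _, a2, _⟩ := hσ t ht
    obtain ⟨_, b1, _⟩ := hσ t' ht'
    exact Finset.disjoint_left.1 (a2 t' ht' hne) a1 (heq ▸ b1)
  refine ⟨A ∩ B, fun k => σ (x k), fun k => σ (y k), fun w => X w ∩ B, ?_, ?_⟩
  · refine ⟨?_, Finset.inter_subset_right, hm, ?_, fun w => Finset.inter_subset_right, ?_, ?_, ?_, ?_, ?_⟩
    · intro v
      constructor
      · intro hv
        obtain ⟨t, ht⟩ := Finset.card_pos.1 (lt_of_lt_of_eq (Finset.card_pos.2 ⟨v, hv⟩) (hm.trans h.hTm.symm))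
        obtain ⟨t', ht', rfl⟩ := (hσ t ht).2.2.2.2.2.2.2.2 v hv
        obtain ⟨k, hk | hk⟩ := (h.hT t').1 ht'
        · exact ⟨k, Or.inl (by rw [hk])⟩
        · exact ⟨k, Or.inr (by rw [hk])⟩
      · rintro ⟨k, rfl | rfl⟩
        · exact (hσ _ (hxT k)).2.2.1
        · exact (hσ _ (hyT k)).2.2.1
    · intro k l hkl
      obtain ⟨c1, c2, c3⟩ := h.cmp k l hkl
      exact ⟨σinj _ (hxT k) _ (hxT l) c1, σinj _ (hyT k) _ (hyT l) c2, σinj _ (hxT k) _ (hyT l) c3⟩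
    · intro w
      rcases claim w with h' | ⟨v, hv, hv'⟩
      · obtain ⟨v, hv⟩ := h.hXne w
        exact ⟨v, Finset.mem_inter.2 ⟨hv, (Finset.mem_sdiff.1 (h' hv)).1⟩⟩
      · exact ⟨v, Finset.mem_inter.2 ⟨hv, (Finset.mem_inter.1 hv').2⟩⟩
    · intro w w' hw
      exact (h.hXd w w' hw).mono Finset.inter_subset_left Finset.inter_subset_left
    · intro w A1 hA1 hne hcl
      by_cases hmt : ∃ v ∈ A1, v ∈ A ∩ B
      · exact Or.inr hmt
      left
      push Not at hmt
      have hA1B : ∀ v ∈ A1, v ∈ X w ∧ v ∈ B ∧ v ∉ A := fun v hv => by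
        have h1 := Finset.mem_inter.1 (hA1 hv)
        exact ⟨h1.1, h1.2, fun hA => hmt v hv (by simp [hA, h1.2])⟩
      rcases h.conn w A1 (hA1.trans Finset.inter_subset_left) hne (by
        intro a ha b hb hab
        have h1 := hA1B a ha
        exact hcl a ha b (Finset.mem_inter.2 ⟨hb, hnb a (hBP h1.2.1) h1.2.2 b (h.hXP _ hb) hab⟩) hab) with h' | ⟨v, hv, hvT⟩
      · apply Finset.Subset.antisymm hA1
        rw [h']; exact Finset.inter_subset_left
      · exact absurd (hTA hvT) (hA1B v hv).2.2
    · intro w w' hww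
      have hh : ∀ w, (∃ v ∈ X w, v ∈ A) → ∃ v ∈ X w ∩ B, v ∈ A ∩ B := by
        rintro w ⟨v, hv, hvA⟩
        obtain ⟨z, hz, hz'⟩ := claim' w v hv hvA
        exact ⟨z, Finset.mem_inter.2 ⟨hz, (Finset.mem_inter.1 hz').2⟩, hz'⟩
      rcases h.adj w w' hww with ⟨u, hu, v, hv, huv⟩ | ⟨⟨u, hu, huT⟩, v, hv, hvT⟩
      · by_cases hu' : u ∈ B
        · by_cases hv' : v ∈ B
          · exact Or.inl ⟨u, by simp [hu, hu'], v, by simp [hv, hv'], huv⟩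
          · right
            have huA : u ∈ A := by
              by_contra hh
              exact hv' (hnb u (h.hXP _ hu) hh v (h.hXP _ hv) huv)
            exact ⟨hh w ⟨u, hu, huA⟩, hh w' ⟨v, hv, hPm' v (h.hXP _ hv) hv'⟩⟩
        · right
          have hvA : v ∈ A := by
            by_contra hh
            exact hu' (hnb v (h.hXP _ hv) hh u (h.hXP _ hu) huv.symm)
          exact ⟨hh w ⟨u, hu, hPm' u (h.hXP _ hu) hu'⟩, hh w' ⟨v, hv, hvA⟩⟩
      · exact Or.inr ⟨hh w ⟨u, hu, hTA huT⟩, hh w' ⟨v, hv, hTA hvT⟩⟩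
    · intro A2 B2 h2 hE2 hT2 hc2 w hw
      have hXB : X w ⊆ B \ A := by
        rcases claim w with h' | ⟨v, hv, hv'⟩
        · exact h'
        · exfalso
          have := hw (Finset.mem_inter.2 ⟨hv, (Finset.mem_inter.1 hv').2⟩)
          exact (Finset.mem_sdiff.1 this).2 (hT2 hv')
      have hB2 : B2 ⊆ B := h2 ▸ Finset.subset_union_right
      refine h.sep (A ∪ A2) B2 ?_ ?_ (hTA.trans Finset.subset_union_left) ?_ w ?_
      · rw [Finset.union_assoc, h2, hAB]
      · intro a ha haB b hb hbA hab
        simp only [Finset.mem_union, not_or] at ha hbA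
        by_cases ha2 : a ∈ A2
        · exact hE2 a ha2 haB b hb hbA.2 hab
        · have haA := ha.resolve_right ha2
          refine hE a haA (fun haB' => ha2 (hT2 (by simp [haA, haB']))) b (hB2 hb) hbA.1 hab
      · refine lt_of_le_of_lt (Finset.card_le_card ?_) hc2
        intro v hv
        simp only [Finset.mem_inter, Finset.mem_union] at hv ⊢
        rcases hv.1 with h' | h'
        · exact ⟨hT2 (by simp [h', hB2 hv.2]), hv.2⟩
        · exact ⟨h', hv.2⟩
      · intro v hv
        have h1 := Finset.mem_sdiff.1 (hXB hv)
        have h3 := Finset.mem_sdiff.1 (hw (Finset.mem_inter.2 ⟨hv, h1.1⟩))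
        simp [h3.1, h3.2, h1.2]
  · rintro ⟨B', b0, b1, b2, b3, b4, b5⟩
    have hQB : ∀ t ∈ T, ∀ k, ∀ v ∈ Q t, v ∈ B' k → v = σ t := by
      intro t ht k v hv hvk
      obtain ⟨_, _, _, a4, _, a6, _⟩ := hσ t ht
      exact a6 v hv (Finset.mem_inter.2 ⟨a4 hv, b0 k hvk⟩)
    have hdd : ∀ k l, k ≠ l → ∀ t ∈ T, (t = x l ∨ t = y l) → ∀ v ∈ B' k, v ∉ Q t := by
      intro k l hkl t ht htl v hv hvQ
      have e := hQB t ht k v hvQ hv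
      have : v ∈ B' l := by
        rcases htl with rfl | rfl
        · rw [e]; exact b3 l
        · rw [e]; exact b4 l
      exact Finset.disjoint_left.1 (b2 k l hkl) hv this
    refine ⟨fun k => B' k ∪ (Q (x k) ∪ Q (y k)), fun k => ?_, fun k => ?_, fun k l hkl => ?_, fun k => ?_, fun k => ?_,
      fun k l hkl hk hl => ?_⟩
    · exact Finset.union_subset ((b0 k).trans hBP) (Finset.union_subset
        ((hσ _ (hxT k)).2.2.2.1.trans hAP) ((hσ _ (hyT k)).2.2.2.1.trans hAP))
    · show Cn G (B' k ∪ (Q (x k) ∪ Q (y k)))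
      rw [← Finset.union_assoc]
      obtain ⟨_, a2, _, _, a5, _⟩ := hσ _ (hxT k)
      obtain ⟨_, c2, _, _, c5, _⟩ := hσ _ (hyT k)
      exact ((b1 k).union_inter a5 (b3 k) a2).union_inter c5 (Finset.mem_union_left _ (b4 k)) c2
    · have hQd : ∀ t ∈ T, ∀ t' ∈ T, t ≠ t' → Disjoint (Q t) (Q t') := fun t ht t' ht' hne =>
        (hσ t ht).2.2.2.2.2.2.2.1 t' ht' hne
      obtain ⟨c1, c2, c3⟩ := h.cmp k l hkl
      have c4 := (h.cmp l k hkl.symm).2.2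
      simp only [Finset.disjoint_union_left, Finset.disjoint_union_right]
      have dl : ∀ k l, k ≠ l → ∀ t ∈ T, (t = x l ∨ t = y l) → Disjoint (B' k) (Q t) := fun k l hkl t ht htl =>
        Finset.disjoint_left.2 (hdd k l hkl t ht htl)
      exact ⟨⟨b2 k l hkl, (dl l k hkl.symm _ (hxT k) (Or.inl rfl)).symm, (dl l k hkl.symm _ (hyT k) (Or.inr rfl)).symm⟩,
        ⟨dl k l hkl _ (hxT l) (Or.inl rfl), hQd _ (hxT k) _ (hxT l) c1, hQd _ (hyT k) _ (hxT l) c4.symm⟩,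
        dl k l hkl _ (hyT l) (Or.inr rfl), hQd _ (hxT k) _ (hyT l) c3, hQd _ (hyT k) _ (hyT l) c2⟩
    · simp [(hσ _ (hxT k)).1]
    · simp [(hσ _ (hyT k)).1]
    · exact (b5 k l hkl hk hl).mono Finset.subset_union_left Finset.subset_union_left

end RS
end CD

namespace CD

section RS2
variable {V : Type*} [DecidableEq V] [Fintype V] {W : Type*} [DecidableEq W] [Fintype W]
  {ι : Type*} {R : SimpleGraph W} {m : ℕ} {G : SimpleGraph V} {P T : Finset V} {x y : ι → V} {X : W → Finset V}

lemma RS_lift (h : RSH R m G P T x y X)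
    (N1 : ∀ A B : Finset V, A ∪ B = P → (∀ a ∈ A, a ∉ B → ∀ b ∈ B, b ∉ A → ¬ G.Adj a b) → T ⊆ A →
      (A \ B).Nonempty → (A ∩ B).card = m → ∀ w, ¬ X w ⊆ B \ A)
    {u : V} (hu : u ∈ P) (huT : u ∉ T) {A B : Finset V} (hAB : A ∪ B = P.erase u)
    (hE : ∀ a ∈ A, a ∉ B → ∀ b ∈ B, b ∉ A → ¬ G.Adj a b) (hTA : T ⊆ A) (hc : (A ∩ B).card < m)
    (w : W) (huw : u ∉ X w) : ¬ X w ⊆ B \ A := by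
  intro hX
  have hAu : u ∉ A := fun h' => by
    have : u ∈ P.erase u := hAB ▸ Finset.mem_union_left _ h'
    simp at this
  have hBu : u ∉ B := fun h' => by
    have : u ∈ P.erase u := hAB ▸ Finset.mem_union_right _ h'
    simp at this
  have e1 : insert u A ∪ insert u B = P := by
    rw [Finset.insert_union, Finset.union_insert, Finset.insert_idem, hAB, Finset.insert_erase hu]
  have e2 : ∀ a ∈ insert u A, a ∉ insert u B → ∀ b ∈ insert u B, b ∉ insert u A → ¬ G.Adj a b := by
    intro a ha haB b hb hbA
    simp only [Finset.mem_insert, not_or] at ha haB hb hbA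
    exact hE a (ha.resolve_left haB.1) haB.2 b (hb.resolve_left hbA.1) hbA.2
  have e3 : insert u A ∩ insert u B = insert u (A ∩ B) := by
    rw [Finset.insert_inter_distrib]
  have e4 : (insert u A ∩ insert u B).card = (A ∩ B).card + 1 := by
    rw [e3, Finset.card_insert_of_notMem (by simp [hAu])]
  have e5 : X w ⊆ insert u B \ insert u A := by
    intro v hv
    have := Finset.mem_sdiff.1 (hX hv)
    have hne : v ≠ u := fun h' => huw (h' ▸ hv)
    simp [this.1, this.2, hne]
  have hTA' : T ⊆ insert u A := hTA.trans (Finset.subset_insert _ _)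
  rcases Nat.lt_or_ge ((A ∩ B).card + 1) m with hlt | hge
  · exact h.sep _ _ e1 e2 hTA' (by omega) w e5
  · refine N1 _ _ e1 e2 hTA' ?_ (by omega) w e5
    obtain ⟨t, ht, htn⟩ := exists_notMem_of_card_lt (S := A ∩ B) (T := T) (by rw [h.hTm]; exact hc)
    refine ⟨t, ?_⟩
    have hne : t ≠ u := fun h' => huT (h' ▸ ht)
    have : t ∉ B := fun h' => htn (by simp [h', hTA ht])
    simp [hTA ht, this, hne]

lemma Rlz.mono {P' : Finset V} {D : ι → Prop} (h : Rlz G P x y D) (hP : P ⊆ P') : Rlz G P' x y D := by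
  obtain ⟨B, h0, h1⟩ := h
  exact ⟨B, fun k => (h0 k).trans hP, h1⟩

lemma RS_2a (h : RSH R m G P T x y X)
    (N1 : ∀ A B : Finset V, A ∪ B = P → (∀ a ∈ A, a ∉ B → ∀ b ∈ B, b ∉ A → ¬ G.Adj a b) → T ⊆ A →
      (A \ B).Nonempty → (A ∩ B).card = m → ∀ w, ¬ X w ⊆ B \ A)
    {u : V} (hu : u ∈ P) (huT : u ∉ T) (huX : ∀ w, u ∉ X w) : RSH R m G (P.erase u) T x y X := by
  refine ⟨h.hT, ?_, h.hTm, h.cmp, ?_, h.hXne, h.hXd, h.conn, h.adj, ?_⟩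
  · intro v hv
    exact Finset.mem_erase.2 ⟨fun h' => huT (h' ▸ hv), h.hTP hv⟩
  · intro w v hv
    exact Finset.mem_erase.2 ⟨fun h' => huX w (h' ▸ hv), h.hXP w hv⟩
  · intro A B hAB hE hTA hc w
    exact RS_lift h N1 hu huT hAB hE hTA hc w (huX w)

def ctr (G : SimpleGraph V) (u v : V) : SimpleGraph V where
  Adj a b := a ≠ u ∧ b ≠ u ∧ a ≠ b ∧ (G.Adj a b ∨ (a = v ∧ G.Adj u b) ∨ (b = v ∧ G.Adj u a))
  symm := ⟨fun a b h => ⟨h.2.1, h.1, h.2.2.1.symm, by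
    rcases h.2.2.2 with h' | h' | h'
    · exact Or.inl h'.symm
    · exact Or.inr (Or.inr h')
    · exact Or.inr (Or.inl h')⟩⟩
  loopless := ⟨fun a h => h.2.2.1 rfl⟩

lemma RS_2b (h : RSH R m G P T x y X)
    (N1 : ∀ A B : Finset V, A ∪ B = P → (∀ a ∈ A, a ∉ B → ∀ b ∈ B, b ∉ A → ¬ G.Adj a b) → T ⊆ A →
      (A \ B).Nonempty → (A ∩ B).card = m → ∀ w, ¬ X w ⊆ B \ A)
    {u v : V} {w : W} (hu : u ∈ X w) (huT : u ∉ T) (hv : v ∈ X w) (huv : G.Adj u v) :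
    RSH R m (ctr G u v) (P.erase u) T x y (fun w => (X w).erase u) := by
  have huP := h.hXP w hu
  have hne : v ≠ u := huv.ne'
  have hother : ∀ w', w' ≠ w → u ∉ X w' := fun w' hw hu' => Finset.disjoint_left.1 (h.hXd w' w hw) hu' hu
  have hG : ∀ a b, a ≠ u → b ≠ u → G.Adj a b → (ctr G u v).Adj a b := fun a b ha hb hab =>
    ⟨ha, hb, hab.ne, Or.inl hab⟩
  refine ⟨h.hT, ?_, h.hTm, h.cmp, ?_, ?_, ?_, ?_, ?_, ?_⟩
  · intro v hv
    exact Finset.mem_erase.2 ⟨fun h' => huT (h' ▸ hv), h.hTP hv⟩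
  · intro w
    exact Finset.erase_subset_erase _ (h.hXP w)
  · intro w'
    by_cases hw : w' = w
    · subst hw; exact ⟨v, by simp [hv, hne]⟩
    · obtain ⟨z, hz⟩ := h.hXne w'
      exact ⟨z, Finset.mem_erase.2 ⟨fun h' => hother w' hw (h' ▸ hz), hz⟩⟩
  · intro w1 w2 h12
    exact (h.hXd w1 w2 h12).mono (Finset.erase_subset _ _) (Finset.erase_subset _ _)
  · intro w' A hA hAne hcl
    have hAX : A ⊆ X w' := hA.trans (Finset.erase_subset _ _)
    have hAu : u ∉ A := fun h' => by have := hA h'; simp at this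
    have hneu : ∀ a ∈ A, a ≠ u := fun a ha h' => hAu (h' ▸ ha)
    by_cases hvA : v ∈ A
    · have hw : w' = w := by
        by_contra hw
        exact Finset.disjoint_left.1 (h.hXd w' w hw) (hAX hvA) hv
      subst hw
      rcases h.conn w' (insert u A) (Finset.insert_subset hu hAX) ⟨u, by simp⟩ (by
        intro a ha b hb hab
        rw [Finset.mem_insert] at ha ⊢
        by_cases hbu : b = u
        · exact Or.inl hbu
        right
        rcases ha with rfl | ha
        · by_cases hbv : b = v
          · rwa [hbv]
          · exact hcl v hvA b (by simp [hb, hbu]) ⟨hne, hbu, Ne.symm hbv, Or.inr (Or.inl ⟨rfl, hab⟩)⟩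
        · exact hcl a ha b (by simp [hb, hbu]) (hG a b (hneu a ha) hbu hab)) with h' | ⟨z, hz, hzT⟩
      · left; rw [← h', Finset.erase_insert hAu]
      · right
        refine ⟨z, (Finset.mem_insert.1 hz).resolve_left fun h' => huT (h' ▸ hzT), hzT⟩
    · rcases h.conn w' A hAX hAne (by
        intro a ha b hb hab
        by_cases hbu : b = u
        · exfalso
          subst hbu
          have hw : w' = w := by
            by_contra hw
            exact hother w' hw hb
          subst hw
          exact hvA (hcl a ha v (by simp [hv, hne]) ⟨hneu a ha, hne, fun h' => hvA (h' ▸ ha), Or.inr (Or.inr ⟨rfl, hab.symm⟩)⟩)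
        · exact hcl a ha b (by simp [hb, hbu]) (hG a b (hneu a ha) hbu hab)) with h' | h'
      · left
        apply Finset.Subset.antisymm hA
        rw [h']; exact Finset.erase_subset _ _
      · exact Or.inr h'
  · intro w1 w2 h12
    rcases h.adj w1 w2 h12 with ⟨p, hp, q, hq, hpq⟩ | ⟨⟨p, hp, hpT⟩, q, hq, hqT⟩
    · left
      have hw12 : w1 ≠ w2 := h12.ne
      by_cases hpu : p = u
      · subst hpu
        have hw : w1 = w := by
          by_contra hw
          exact hother w1 hw hp
        subst hw
        have hqv : q ≠ v := fun h' => Finset.disjoint_left.1 (h.hXd w1 w2 hw12) hv (h' ▸ hq)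
        exact ⟨v, by simp [hv, hne], q, by simp [hq, hpq.ne'], ⟨hne, hpq.ne', hqv.symm, Or.inr (Or.inl ⟨rfl, hpq⟩)⟩⟩
      · by_cases hqu : q = u
        · subst hqu
          have hw : w2 = w := by
            by_contra hw
            exact hother w2 hw hq
          subst hw
          have hqv : p ≠ v := fun h' => Finset.disjoint_left.1 (h.hXd w1 w2 hw12) hp (h' ▸ hv)
          exact ⟨p, by simp [hp, hpu], v, by simp [hv, hne], ⟨hpu, hne, hqv, Or.inr (Or.inr ⟨rfl, hpq.symm⟩)⟩⟩
        · exact ⟨p, by simp [hp, hpu], q, by simp [hq, hqu], hG p q hpu hqu hpq⟩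
    · right
      exact ⟨⟨p, by simp [hp]; exact fun h' => huT (h' ▸ hpT), hpT⟩, q, by simp [hq]; exact fun h' => huT (h' ▸ hqT), hqT⟩
  · intro A B hAB hE hTA hc w1 hw1
    have hAu : u ∉ A := fun h' => by
      have : u ∈ P.erase u := hAB ▸ Finset.mem_union_left _ h'
      simp at this
    have hBu : u ∉ B := fun h' => by
      have : u ∈ P.erase u := hAB ▸ Finset.mem_union_right _ h'
      simp at this
    have hE' : ∀ a ∈ A, a ∉ B → ∀ b ∈ B, b ∉ A → ¬ G.Adj a b := fun a ha haB b hb hbA hab =>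
      hE a ha haB b hb hbA (hG a b (fun h' => hAu (h' ▸ ha)) (fun h' => hBu (h' ▸ hb)) hab)
    by_cases hvA : v ∈ A
    · have hw : w1 ≠ w := by
        rintro rfl
        have := hw1 (Finset.mem_erase.2 ⟨hne, hv⟩)
        exact (Finset.mem_sdiff.1 this).2 hvA
      refine RS_lift h N1 huP huT hAB hE' hTA hc w1 (hother w1 hw) ?_
      simp only [Finset.erase_eq_of_notMem (hother w1 hw)] at hw1
      exact hw1
    · have hvB : v ∈ B := by
        have : v ∈ A ∪ B := by rw [hAB]; simp [hne, h.hXP w hv]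
        exact (Finset.mem_union.1 this).resolve_left hvA
      refine h.sep A (insert u B) ?_ ?_ hTA ?_ w1 ?_
      · rw [Finset.union_insert, hAB, Finset.insert_erase huP]
      · intro a ha haB b hb hbA hab
        simp only [Finset.mem_insert, not_or] at haB hb
        rcases hb with rfl | hb
        · exact hE a ha haB.2 v hvB hvA ⟨haB.1, hne, fun h' => hvA (h' ▸ ha), Or.inr (Or.inr ⟨rfl, hab.symm⟩)⟩
        · exact hE' a ha haB.2 b hb hbA hab
      · rwa [Finset.inter_insert_of_notMem hAu]
      · intro z hz
        by_cases hzu : z = u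
        · subst hzu; simp [hAu]
        · have := Finset.mem_sdiff.1 (hw1 (Finset.mem_erase.2 ⟨hzu, hz⟩))
          simp [this.1, this.2]

lemma RS_2b' {u v : V} (huv : G.Adj u v) (hu : u ∈ P) (hv : v ∈ P) {D : ι → Prop}
    (h : Rlz (ctr G u v) (P.erase u) x y D) : Rlz G P x y D := by
  obtain ⟨B, b0, b1, b2, b3, b4, b5⟩ := h
  set Y : V → Finset V := fun z => if z = v then {u, v} else {z} with hY
  have hYz : ∀ z, z ∈ Y z := by intro z; simp only [hY]; split_ifs with h <;> simp [h]
  have hYc : ∀ z, Cn G (Y z) := by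
    intro z; simp only [hY]; split_ifs
    · exact (Cn.singleton v).insert (by simp) huv.symm
    · exact Cn.singleton z
  have hadj : ∀ a b, (ctr G u v).Adj a b → Adjs G (Y a) (Y b) := by
    rintro a b ⟨h1, h2, h3, h4 | ⟨rfl, h4⟩ | ⟨rfl, h4⟩⟩
    · exact ⟨a, hYz a, b, hYz b, h4⟩
    · exact ⟨u, by simp [hY], b, hYz b, h4⟩
    · exact ⟨a, hYz a, u, by simp [hY], h4.symm⟩
  have hmem : ∀ z ∈ P.erase u, ∀ z' ∈ P.erase u, z ≠ z' → Disjoint (Y z) (Y z') := by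
    intro z hz z' hz' hne
    have h1 := (Finset.mem_erase.1 hz).1
    have h2 := (Finset.mem_erase.1 hz').1
    simp only [hY]
    split_ifs with h3 h4 h4
    · exact absurd (h3.trans h4.symm) hne
    · simp; exact ⟨h2, h4⟩
    · simp [h1, h3]
    · simpa using hne
  refine ⟨fun k => (B k).biUnion Y, fun k => ?_, fun k => ?_, fun k l hkl => ?_, fun k => ?_, fun k => ?_, fun k l hkl hk hl => ?_⟩
  · intro z hz
    obtain ⟨z', hz', hzz⟩ := Finset.mem_biUnion.1 hz
    simp only [hY] at hzz
    split_ifs at hzz with h3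
    · rcases Finset.mem_insert.1 hzz with rfl | h5
      · exact hu
      · rw [Finset.mem_singleton.1 h5]; exact hv
    · rw [Finset.mem_singleton.1 hzz]; exact (Finset.mem_erase.1 (b0 k hz')).2
  · exact (b1 k).biUnion (fun z _ => hYc z) (fun a _ b _ h => hadj a b h)
  · rw [Finset.disjoint_biUnion_left]
    intro z hz
    rw [Finset.disjoint_biUnion_right]
    intro z' hz'
    exact hmem z (b0 k hz) z' (b0 l hz') fun h' => Finset.disjoint_left.1 (b2 k l hkl) hz (h' ▸ hz')
  · exact Finset.mem_biUnion.2 ⟨_, b3 k, hYz _⟩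
  · exact Finset.mem_biUnion.2 ⟨_, b4 k, hYz _⟩
  · obtain ⟨p, hp, q, hq, hpq⟩ := b5 k l hkl hk hl
    exact (hadj p q hpq).mono (Finset.subset_biUnion_of_mem Y hp) (Finset.subset_biUnion_of_mem Y hq)

lemma RS_3 (h : RSH R m G P T x y X) (hW : 2 * m ≤ Fintype.card W)
    (hcov : ∀ u ∈ P, u ∉ T → ∃ w, X w = {u}) {D : ι → Prop}
    (R2 : ∀ Z : Finset W, Z.card ≤ m → ∀ x' y' : ι → W, (∀ k, x' k ∉ Z) → (∀ k, y' k ∉ Z) → Compat x' y' →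
      Rlz R (Finset.univ \ Z) x' y' D) : Rlz G P x y D := by
  classical
  set Z := Finset.univ.filter fun w => ∃ v ∈ X w, v ∈ T with hZ
  have hZc : Z.card ≤ m := hits_card h.hXd h.hTm.le (by simp [hZ])
  have hZ' : ∀ w, w ∉ Z → ∀ v ∈ X w, v ∉ T := by
    intro w hw v hv hvT
    exact hw (by rw [hZ, Finset.mem_filter]; exact ⟨by simp, v, hv, hvT⟩)
  have hall : ∃ f : T → V, Function.Injective f ∧ ∀ t : T, f t ∈ nb G (P \ T) t := by
    rw [← Finset.all_card_le_biUnion_card_iff_exists_injective]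
    intro S
    by_contra hlt
    push Not at hlt
    set N := S.biUnion fun t => nb G (P \ T) (t : V) with hN
    set S' : Finset V := S.map (Function.Embedding.subtype _) with hS'
    have hS'c : S'.card = S.card := Finset.card_map _
    have hS'T : S' ⊆ T := by
      intro v hv
      obtain ⟨t, _, rfl⟩ := Finset.mem_map.1 hv
      exact t.2
    have hNP : N ⊆ P \ T := by
      intro v hv
      obtain ⟨t, _, ht⟩ := Finset.mem_biUnion.1 hv
      exact (mem_nb.1 ht).1
    have hsep := h.sep (T ∪ N) (P \ S') (by
        ext v
        simp only [Finset.mem_union, Finset.mem_sdiff]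
        constructor
        · rintro ((h' | h') | h')
          · exact h.hTP h'
          · exact (Finset.mem_sdiff.1 (hNP h')).1
          · exact h'.1
        · intro hv
          by_cases hvS : v ∈ S'
          · exact Or.inl (Or.inl (hS'T hvS))
          · exact Or.inr ⟨hv, hvS⟩) (by
        intro a ha haB b hb hbA hab
        simp only [Finset.mem_union, not_or] at ha hbA
        have haP : a ∈ P := by
          rcases ha with h' | h'
          · exact h.hTP h'
          · exact (Finset.mem_sdiff.1 (hNP h')).1
        have haS : a ∈ S' := by
          by_contra hh
          exact haB (by simp [haP, hh])
        obtain ⟨t, ht, rfl⟩ := Finset.mem_map.1 haS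
        apply hbA.2
        exact Finset.mem_biUnion.2 ⟨t, ht, mem_nb.2 ⟨by simp [(Finset.mem_sdiff.1 hb).1, hbA.1], hab⟩⟩)
      Finset.subset_union_left (by
        have : (T ∪ N) ∩ (P \ S') ⊆ (T \ S') ∪ N := by
          intro v hv
          simp only [Finset.mem_inter, Finset.mem_union, Finset.mem_sdiff] at hv ⊢
          tauto
        have h1 := Finset.card_le_card this
        have h2 := Finset.card_union_le (T \ S') N
        have h3 := Finset.card_sdiff_add_card_eq_card hS'T
        have h4 := h.hTm
        omega)
    have hPN : ∀ v ∈ P, v ∉ T → v ∈ N := by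
      intro v hv hvT
      obtain ⟨w, hw⟩ := hcov v hv hvT
      by_contra hvN
      apply hsep w
      rw [hw, Finset.singleton_subset_iff]
      have : v ∉ S' := fun h' => hvT (hS'T h')
      simp [hv, hvT, hvN, this]
    have hc2 : (Finset.univ \ Z).card ≤ N.card := by
      apply hits_card h.hXd le_rfl
      intro w hw
      obtain ⟨v, hv⟩ := h.hXne w
      exact ⟨v, hv, hPN v (h.hXP w hv) (hZ' w (Finset.mem_sdiff.1 hw).2 v hv)⟩
    have hc3 := Finset.card_sdiff_add_card_eq_card (Finset.subset_univ Z)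
    rw [Finset.card_univ] at hc3
    have hc4 := Finset.card_le_card hS'T
    have h4 := h.hTm
    omega
  obtain ⟨f, finj, hf⟩ := hall
  have hf' : ∀ t : T, f t ∈ P ∧ f t ∉ T ∧ G.Adj t (f t) := fun t => by
    have := mem_nb.1 (hf t)
    exact ⟨(Finset.mem_sdiff.1 this.1).1, (Finset.mem_sdiff.1 this.1).2, this.2⟩
  have : ∀ t : T, ∃ w, X w = {f t} := fun t => hcov _ (hf' t).1 (hf' t).2.1
  choose ω hω using this
  have hωinj : Function.Injective ω := by
    intro t t' htt
    apply finj
    have := hω t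
    rw [htt, hω t'] at this
    exact (Finset.singleton_injective this).symm
  have hωZ : ∀ t, ω t ∉ Z := by
    intro t ht
    rw [hZ, Finset.mem_filter] at ht
    obtain ⟨_, v, hv, hvT⟩ := ht
    rw [hω t, Finset.mem_singleton] at hv
    exact (hf' t).2.1 (hv ▸ hvT)
  have hxT : ∀ k, x k ∈ T := fun k => (h.hT _).2 ⟨k, Or.inl rfl⟩
  have hyT : ∀ k, y k ∈ T := fun k => (h.hT _).2 ⟨k, Or.inr rfl⟩
  have hωne : ∀ {a b : V} (ha : a ∈ T) (hb : b ∈ T), a ≠ b → ω ⟨a, ha⟩ ≠ ω ⟨b, hb⟩ := fun ha hb hab h' =>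
    hab (congrArg Subtype.val (hωinj h'))
  obtain ⟨B, b0, b1, b2, b3, b4, b5⟩ := R2 Z hZc (fun k => ω ⟨x k, hxT k⟩) (fun k => ω ⟨y k, hyT k⟩)
    (fun k => hωZ _) (fun k => hωZ _) (fun k l hkl => by
      obtain ⟨c1, c2, c3⟩ := h.cmp k l hkl
      exact ⟨hωne _ _ c1, hωne _ _ c2, hωne _ _ c3⟩)
  have hBZ : ∀ k, ∀ w ∈ B k, w ∉ Z := fun k w hw => (Finset.mem_sdiff.1 (b0 k hw)).2
  have hBT : ∀ k, ∀ v ∈ (B k).biUnion X, v ∈ P ∧ v ∉ T := by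
    intro k v hv
    obtain ⟨w, hw, hvw⟩ := Finset.mem_biUnion.1 hv
    exact ⟨h.hXP w hvw, hZ' w (hBZ k w hw) v hvw⟩
  have hadj : ∀ w w', w ∉ Z → R.Adj w w' → Adjs G (X w) (X w') := by
    intro w w' hw hww
    refine (h.adj w w' hww).resolve_right ?_
    rintro ⟨⟨v, hv, hvT⟩, _⟩
    exact hZ' w hw v hv hvT
  have hcc : ∀ w, w ∉ Z → Cn G (X w) := by
    intro w hw
    refine ⟨h.hXne w, fun A hA hne hcl => ?_⟩
    refine (h.conn w A hA hne hcl).resolve_right ?_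
    rintro ⟨v, hv, hvT⟩
    exact hZ' w hw v (hA hv) hvT
  have hfB : ∀ k (t : T), ω t ∈ B k → f t ∈ (B k).biUnion X := fun k t ht =>
    Finset.mem_biUnion.2 ⟨_, ht, by rw [hω]; simp⟩
  refine ⟨fun k => insert (x k) (insert (y k) ((B k).biUnion X)), fun k => ?_, fun k => ?_, fun k l hkl => ?_, fun k => ?_, fun k => ?_,
    fun k l hkl hk hl => ?_⟩
  · exact Finset.insert_subset (h.hTP (hxT k)) (Finset.insert_subset (h.hTP (hyT k)) fun v hv => (hBT k v hv).1)
  · have c0 : Cn G ((B k).biUnion X) := (b1 k).biUnion (fun w hw => hcc w (hBZ k w hw)) (fun a ha b _ h => hadj a b (hBZ k a ha) h)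
    have c1 := c0.insert (hfB k _ (b4 k)) (hf' ⟨y k, hyT k⟩).2.2.symm
    exact c1.insert (Finset.mem_insert_of_mem (hfB k _ (b3 k))) (hf' ⟨x k, hxT k⟩).2.2.symm
  · obtain ⟨c1, c2, c3⟩ := h.cmp k l hkl
    have c4 := (h.cmp l k hkl.symm).2.2
    have n1 : ∀ k l, x k ∉ (B l).biUnion X := fun k l h' => (hBT l _ h').2 (hxT k)
    have n2 : ∀ k l, y k ∉ (B l).biUnion X := fun k l h' => (hBT l _ h').2 (hyT k)
    have hd : Disjoint ((B k).biUnion X) ((B l).biUnion X) := by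
      rw [Finset.disjoint_biUnion_left]
      intro z hz
      rw [Finset.disjoint_biUnion_right]
      intro z' hz'
      exact h.hXd z z' fun h' => Finset.disjoint_left.1 (b2 k l hkl) hz (h' ▸ hz')
    rw [Finset.disjoint_left]
    intro v hv hv'
    simp only [Finset.mem_insert] at hv hv'
    rcases hv with rfl | rfl | hv <;> rcases hv' with h' | h' | h'
    · exact c1 h'
    · exact c3 h'
    · exact n1 _ _ h'
    · exact c4 h'.symm
    · exact c2 h'
    · exact n2 _ _ h'
    · exact n1 _ _ (h' ▸ hv)
    · exact n2 _ _ (h' ▸ hv)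
    · exact Finset.disjoint_left.1 hd hv h'
  · simp
  · simp
  · obtain ⟨p, hp, q, hq, hpq⟩ := b5 k l hkl hk hl
    exact (hadj p q (hBZ k p hp) hpq).mono
      ((Finset.subset_biUnion_of_mem X hp).trans ((Finset.subset_insert _ _).trans (Finset.subset_insert _ _)))
      ((Finset.subset_biUnion_of_mem X hq).trans ((Finset.subset_insert _ _).trans (Finset.subset_insert _ _)))

theorem RS {D : ι → Prop} (R1 : ∀ Z : Finset W, Z.card ≤ m → Cn R (Finset.univ \ Z)) (hW : 2 * m ≤ Fintype.card W)
    (R2 : ∀ Z : Finset W, Z.card ≤ m → ∀ x' y' : ι → W, (∀ k, x' k ∉ Z) → (∀ k, y' k ∉ Z) → Compat x' y' →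
      Rlz R (Finset.univ \ Z) x' y' D) :
    ∀ (n : ℕ) (G : SimpleGraph V) (P T : Finset V) (x y : ι → V) (X : W → Finset V), P.card = n →
      RSH R m G P T x y X → Rlz G P x y D := by
  intro n
  induction n using Nat.strong_induction_on with
  | _ n ih =>
  intro G P T x y X hP h
  by_cases N1 : ∀ A B : Finset V, A ∪ B = P → (∀ a ∈ A, a ∉ B → ∀ b ∈ B, b ∉ A → ¬ G.Adj a b) → T ⊆ A →
      (A \ B).Nonempty → (A ∩ B).card = m → ∀ w, ¬ X w ⊆ B \ A
  · by_cases c1 : ∃ u ∈ P, u ∉ T ∧ ∀ w, u ∉ X w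
    · obtain ⟨u, hu, huT, huX⟩ := c1
      exact (ih _ (by rw [← hP]; exact Finset.card_erase_lt_of_mem hu) G _ T x y X rfl
        (RS_2a h N1 hu huT huX)).mono (Finset.erase_subset _ _)
    · push Not at c1
      by_cases c2 : ∃ w, ∃ u ∈ X w, u ∉ T ∧ X w ≠ {u}
      · obtain ⟨w, u, hu, huT, hne⟩ := c2
        have hv : ∃ v ∈ X w, G.Adj u v := by
          by_contra hcon
          push Not at hcon
          rcases h.conn w {u} (by simpa using hu) (by simp) (by
            intro a ha b hb hab
            rw [Finset.mem_singleton] at ha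
            subst ha
            exact absurd hab (hcon b hb)) with h' | ⟨v, hv, hvT⟩
          · exact hne h'.symm
          · exact huT ((Finset.mem_singleton.1 hv) ▸ hvT)
        obtain ⟨v, hv, huv⟩ := hv
        have huP := h.hXP w hu
        exact RS_2b' huv huP (h.hXP w hv) (ih _ (by rw [← hP]; exact Finset.card_erase_lt_of_mem huP) _ _ T x y _ rfl
          (RS_2b h N1 hu huT hv huv))
      · push Not at c2
        refine RS_3 h hW ?_ R2
        intro u hu huT
        obtain ⟨w, hw⟩ := c1 u hu huT
        exact ⟨w, c2 w u hw huT⟩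
  · push Not at N1
    obtain ⟨A, B, hAB, hE, hTA, ⟨a, ha⟩, hm, w0, hw0⟩ := N1
    obtain ⟨T', x', y', X', h', hback⟩ := RS_case1 h R1 hAB hE hTA hm hw0 D
    apply hback
    refine ih B.card ?_ G B T' x' y' X' rfl h'
    rw [← hP]
    apply Finset.card_lt_card
    rw [Finset.mem_sdiff] at ha
    refine ⟨hAB ▸ Finset.subset_union_right, fun h' => ha.2 (h' ?_)⟩
    rw [← hAB]; exact Finset.mem_union_left _ ha.1
end RS2
end CD

namespace CD

section L
variable {V : Type*} [DecidableEq V] {G : SimpleGraph V}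

lemma prs_ge {S : Finset V} {d : ℕ} (h : ∀ v ∈ S, d ≤ (nb G S v).card) : S.card * d ≤ (prs G S).card := by
  classical
  have h1 := Finset.card_eq_sum_card_fiberwise (f := Prod.fst) (s := prs G S) (t := S) (fun p hp => (mem_prs.1 hp).1.1)
  rw [h1, ← smul_eq_mul]
  apply Finset.card_nsmul_le_sum
  intro v hv
  refine (h v hv).trans ?_
  apply Finset.card_le_card_of_injOn (fun u => (v, u))
  · intro u hu
    have := mem_nb.1 hu
    simp [mem_prs, hv, this.1, this.2]
  · intro a _ b _ hab
    exact (Prod.ext_iff.1 hab).2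

lemma density_ge {S : Finset V} {d : ℕ} (hne : S.Nonempty) (h : ∀ v ∈ S, d ≤ (nb G S v).card) :
    (d : ℝ) ≤ 2 * (sub G S).density := by
  rw [density_sub, le_div_iff₀ (by exact_mod_cast Finset.card_pos.2 hne)]
  have := prs_ge h
  rw [mul_comm] at this
  exact_mod_cast this

lemma thmL_sep {k m : ℕ} {J T A B : Finset V} (hk : kc G k J) (hmk : m ≤ k) (hT : T.card = m) (hAB : A ∪ B = J)
    (hE : ∀ a ∈ A, a ∉ B → ∀ b ∈ B, b ∉ A → ¬ G.Adj a b) (hTA : T ⊆ A) (hc : (A ∩ B).card < m)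
    {X : Finset V} (hX : X.Nonempty) : ¬ X ⊆ B \ A := by
  intro hXB
  obtain ⟨b, hb⟩ := hX
  have hb := Finset.mem_sdiff.1 (hXB hb)
  obtain ⟨t, ht, htn⟩ := exists_notMem_of_card_lt (S := A ∩ B) (T := T) (by rw [hT]; exact hc)
  have htB : t ∉ B := fun h' => htn (by simp [h', hTA ht])
  have hC := hk.2 (A ∩ B) (by omega)
  have hAJ : A ⊆ J := hAB ▸ Finset.subset_union_left
  have hBJ : B ⊆ J := hAB ▸ Finset.subset_union_right
  have e := hC.2 (A \ B) (by
    intro v hv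
    rw [Finset.mem_sdiff] at hv
    simp [hAJ hv.1, hv.2]) ⟨t, by simp [hTA ht, htB]⟩ (by
    intro a ha b hb hab
    rw [Finset.mem_sdiff] at ha hb ⊢
    have hbAB : b ∈ A ∪ B := by rw [hAB]; exact hb.1
    by_cases hbA : b ∈ A
    · exact ⟨hbA, fun h' => hb.2 (by simp [hbA, h'])⟩
    · exact absurd hab (hE a ha.1 ha.2 b ((Finset.mem_union.1 hbAB).resolve_left hbA) hbA))
  have : b ∈ A \ B := by rw [e]; simp [hBJ hb.1, hb.2]
  exact hb.2 (Finset.mem_sdiff.1 this).1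

end L

theorem thmL {C : ℝ} (hC : 0 < C) (hyp : Hyp C) : ∃ K : ℕ, 2 ≤ K ∧ ∀ (V : Type) [Fintype V] [DecidableEq V]
    (G : SimpleGraph V) (J : Finset V) (n a l : ℕ), 1 ≤ n → 1 ≤ l → n ≤ 2 ^ l → a * K * l ≤ n →
    kc G (K * n) J → Wov G J a n := by
  obtain ⟨c1, hc1, hdm⟩ := dense_minor hC hyp
  obtain ⟨c, hcc⟩ : ∃ c, c = 2 * c1 := ⟨_, rfl⟩
  obtain ⟨M, hM⟩ : ∃ M, M = c * (3 * c + 1) + 1 := ⟨_, rfl⟩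
  have hM3 : 3 * c + 2 ≤ M := by rw [hM]; nlinarith
  have hM0 : 0 < M := by omega
  refine ⟨2 * (c1 * (100 * M)), by nlinarith, ?_⟩
  intro V _ _ G J n a l hn hl hnl ha hkc ι _ x y A hι hA hx hy hxy
  classical
  have hJne : J.Nonempty := by
    rw [← Finset.card_pos]; have := hkc.1; omega
  have hden : (((c1 * (100 * M)) * n : ℕ) : ℝ) ≤ (sub G J).density := by
    have h1 := density_ge (G := G) hJne (d := 2 * (c1 * (100 * M)) * n) fun v hv => hkc.deg hv
    push_cast at h1 ⊢
    linarith
  obtain ⟨W, _, _, R, q, hmin, hq, hR, hWc, hkq⟩ := hdm _ (sub G J) _ (by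
    rw [mul_assoc]; exact Nat.le_mul_of_pos_right _ (by positivity)) hden
  have hq2 : 100 * M * n ≤ q := by
    refine le_of_mul_le_mul_left (a := c1) ?_ hc1
    calc c1 * (100 * M * n) = c1 * (100 * M) * n := by ring
      _ ≤ _ := hkq
  obtain ⟨X0, hX0⟩ := Mn.of_hasMinor hmin
  have hX := Mn.trans (Mn.ofSub (G := G) (S := J)) hX0
  set X := fun u => (X0 u).biUnion fun w => ({(w : V)} : Finset V) with hXdef
  set T : Finset V := Finset.univ.image x ∪ Finset.univ.image y with hT
  have hTc : T.card ≤ 2 * n := by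
    have h1 := Finset.card_union_le (Finset.univ.image x) (Finset.univ.image y)
    have h2 := Finset.card_image_le (s := Finset.univ) (f := x)
    have h3 := Finset.card_image_le (s := Finset.univ) (f := y)
    rw [Finset.card_univ] at h2 h3
    rw [hT]
    omega
  have h2nq : 200 * n ≤ q := by nlinarith
  have hqW : q < Fintype.card W := by have := hR.1; rwa [Finset.card_univ] at this
  have h1W : q / n + 1 ≤ 2 ^ (q / n) := Nat.lt_two_pow_self
  have hdiv : n * (q / n) ≤ q := Nat.mul_div_le q n
  have hdiv' : q < n * (q / n + 1) := by
    have := Nat.lt_mul_div_succ q hn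
    exact this
  have hLW : Fintype.card W < 2 ^ (c1 + l + q / n) := by
    have h3 : c1 < 2 ^ c1 := Nat.lt_two_pow_self
    have h4 : q < 2 ^ l * 2 ^ (q / n) := lt_of_lt_of_le hdiv' (Nat.mul_le_mul hnl h1W)
    calc Fintype.card W ≤ c1 * q := hWc
      _ < 2 ^ c1 * (2 ^ l * 2 ^ (q / n)) := Nat.mul_lt_mul'' h3 h4
      _ = _ := by rw [pow_add, pow_add]; ring
  have hb : 2 * (4 * n + n * (3 * c + 3) + a * (c * (c1 + l + q / n) * (3 * c + 1) + 1)) ≤ q := by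
    have e1 : a * (c * (c1 + l + q / n) * (3 * c + 1) + 1) ≤ a * M * (c1 + l + q / n) := by
      rw [mul_assoc a M]
      apply Nat.mul_le_mul_left
      rw [hM]
      nlinarith [Nat.zero_le (q / n)]
    have e2 : a * (200 * M) * l ≤ n := by
      refine le_trans ?_ ha
      apply Nat.mul_le_mul_right
      apply Nat.mul_le_mul_left
      nlinarith
    have e3 : a * (200 * M) * c1 ≤ n := by
      refine le_trans ?_ ha
      calc a * (200 * M) * c1 = a * (2 * (c1 * (100 * M))) * 1 := by ring
        _ ≤ _ := Nat.mul_le_mul_left _ hl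
    have e4 : a * (200 * M) * (q / n) ≤ q := by
      refine le_trans ?_ hdiv
      apply Nat.mul_le_mul_right
      refine le_trans ?_ e2
      exact Nat.le_mul_of_pos_right _ hl
    have e5 : 200 * (a * M * (c1 + l + q / n)) ≤ 2 * n + q := by
      calc 200 * (a * M * (c1 + l + q / n)) = a * (200 * M) * c1 + a * (200 * M) * l + a * (200 * M) * (q / n) := by ring
        _ ≤ _ := by omega
    have e6 : n * (3 * c + 3) ≤ n * (2 * M) := Nat.mul_le_mul_left _ (by omega)
    have e7 : n * 1 ≤ n * M := Nat.mul_le_mul_left _ (by omega)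
    have e8 : 100 * (n * M) ≤ q := by linarith
    have e9 : n * (2 * M) = 2 * (n * M) := by ring
    omega
  refine RS (R := R) (m := T.card) (D := (· ∈ A)) ?_ ?_ ?_ J.card G J T x y X rfl ?_
  · intro Z hZ
    exact hR.2 Z (by omega)
  · omega
  · intro Z hZ x' y' hx' hy' hc
    exact robust hR hq hc1 hcc hWc hLW hb Z (hZ.trans hTc) ι x' y' A hι hA hx' hy' hc
  · have hTJ : T ⊆ J := by
      intro v hv
      simp only [hT, Finset.mem_union, Finset.mem_image, Finset.mem_univ, true_and] at hv
      rcases hv with ⟨k, rfl⟩ | ⟨k, rfl⟩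
      · exact hx k
      · exact hy k
    refine ⟨?_, hTJ, rfl, hxy, hX.1, fun w => (hX.2.1 w).1, hX.2.2.1, ?_, ?_, ?_⟩
    · intro v
      simp only [hT, Finset.mem_union, Finset.mem_image, Finset.mem_univ, true_and]
      constructor
      · rintro (⟨k, rfl⟩ | ⟨k, rfl⟩)
        · exact ⟨k, Or.inl rfl⟩
        · exact ⟨k, Or.inr rfl⟩
      · rintro ⟨k, rfl | rfl⟩
        · exact Or.inl ⟨k, rfl⟩
        · exact Or.inr ⟨k, rfl⟩
    · intro w B hB hne hcl
      exact Or.inl ((hX.2.1 w).2 B hB hne hcl)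
    · intro w w' h
      exact Or.inl (hX.2.2.2 w w' h)
    · intro A' B' h1 h2 h3 h4 w
      exact thmL_sep hkc (hTc.trans (Nat.mul_le_mul_right _ (by nlinarith))) rfl h1 h2 h3 h4 (hX.2.1 w).1

end CD

namespace CD

section DM
variable {V : Type*} [DecidableEq V] {G : SimpleGraph V}

lemma cds {S : Finset V} (hS : Cn G S) : ∃ D ⊆ S, ∃ I ⊆ D, Cn G D ∧ (∀ u ∈ I, ∀ v ∈ I, ¬ G.Adj u v) ∧
    D.card ≤ 2 * I.card ∧ ∀ v ∈ S, v ∉ D → ∃ d ∈ D, G.Adj v d := by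
  classical
  set F := S.powerset.filter fun D => Cn G D ∧ ∃ I ⊆ D, (∀ u ∈ I, ∀ v ∈ I, ¬ G.Adj u v) ∧ D.card ≤ 2 * I.card with hF
  have hFne : F.Nonempty := by
    obtain ⟨s, hs⟩ := hS.1
    refine ⟨{s}, ?_⟩
    simp only [hF, Finset.mem_filter, Finset.mem_powerset]
    exact ⟨by simpa using hs, Cn.singleton s, {s}, subset_rfl, by simp, by simp⟩
  obtain ⟨D, hD, hmax⟩ := F.exists_max_image Finset.card hFne
  simp only [hF, Finset.mem_filter, Finset.mem_powerset] at hD hmax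
  obtain ⟨hDS, hDc, I, hID, hI, hcard⟩ := hD
  refine ⟨D, hDS, I, hID, hDc, hI, hcard, ?_⟩
  by_contra hcon
  push Not at hcon
  obtain ⟨v0, hv0, hv0D, hv0n⟩ := hcon
  set N := S.filter fun v => v ∈ D ∨ ∃ d ∈ D, G.Adj v d with hN
  have hND : ∀ v, v ∈ N ↔ v ∈ S ∧ (v ∈ D ∨ ∃ d ∈ D, G.Adj v d) := by simp [hN]
  have : ¬ ∀ a ∈ N, ∀ b ∈ S, G.Adj a b → b ∈ N := by
    intro hcl
    have e := hS.2 N (Finset.filter_subset _ _) (by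
      obtain ⟨d, hd⟩ := hDc.1
      exact ⟨d, (hND d).2 ⟨hDS hd, Or.inl hd⟩⟩) hcl
    have : v0 ∈ N := by rw [e]; exact hv0
    rcases ((hND v0).1 this).2 with h | ⟨d, hd, h⟩
    · exact hv0D h
    · exact hv0n d hd h
  push Not at this
  obtain ⟨u, hu, v, hv, huv, hvN⟩ := this
  have hvD : v ∉ D := fun h => hvN ((hND v).2 ⟨hv, Or.inl h⟩)
  have hvn : ∀ d ∈ D, ¬ G.Adj v d := fun d hd h => hvN ((hND v).2 ⟨hv, Or.inr ⟨d, hd, h⟩⟩)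
  obtain ⟨huS, hu⟩ := (hND u).1 hu
  have huD : u ∉ D := fun h => hvn u h huv.symm
  obtain ⟨d, hd, hud⟩ := hu.resolve_left huD
  have hle := hmax (insert v (insert u D)) ⟨Finset.insert_subset hv (Finset.insert_subset huS hDS),
    (hDc.insert hd hud.symm).insert (Finset.mem_insert_self _ _) huv, insert v I,
    Finset.insert_subset_insert _ (hID.trans (Finset.subset_insert _ _)), ?_, ?_⟩
  · rw [Finset.card_insert_of_notMem (by simp [huv.ne', hvD]), Finset.card_insert_of_notMem huD] at hle
    omega
  · intro a ha b hb
    rw [Finset.mem_insert] at ha hb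
    rcases ha with rfl | ha <;> rcases hb with rfl | hb
    · exact G.loopless.1 _
    · exact hvn b (hID hb)
    · exact fun h => hvn a (hID ha) h.symm
    · exact hI a ha b hb
  · rw [Finset.card_insert_of_notMem (by simp [huv.ne', hvD]), Finset.card_insert_of_notMem huD,
      Finset.card_insert_of_notMem fun h => hvD (hID h)]
    omega

lemma KM.extend {S D : Finset V} {t : ℕ} (hD : Cn G D) (hDS : D ⊆ S) (hdom : ∀ v ∈ S, v ∉ D → ∃ d ∈ D, G.Adj v d)
    (h : KM G (S \ D) t) : KM G S (t + 1) := by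
  obtain ⟨X, h1, h2, h3, h4⟩ := h
  have hA : ∀ i, Adjs G (X i) D := by
    intro i
    obtain ⟨v, hv⟩ := (h2 i).1
    have hv' := Finset.mem_sdiff.1 (h1 i hv)
    obtain ⟨d, hd, hvd⟩ := hdom v hv'.1 hv'.2
    exact ⟨v, hv, d, hd, hvd⟩
  have hdj : ∀ i, Disjoint (X i) D := fun i => Finset.disjoint_left.2 fun v hv hvD =>
    (Finset.mem_sdiff.1 (h1 i hv)).2 hvD
  refine ⟨Fin.cons D X, ?_, ?_, ?_, ?_⟩
  · intro w
    refine Fin.cases ?_ (fun i => ?_) w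
    · simpa using hDS
    · simpa using (h1 i).trans Finset.sdiff_subset
  · intro w
    refine Fin.cases ?_ (fun i => ?_) w
    · simpa using hD
    · simpa using h2 i
  · intro w w'
    refine Fin.cases ?_ (fun i => ?_) w <;> refine Fin.cases ?_ (fun j => ?_) w'
    · simp
    · intro _; simpa using (hdj j).symm
    · intro _; simpa using hdj i
    · intro hij; simpa using h3 i j fun h => hij (by rw [h])
  · intro w w'
    refine Fin.cases ?_ (fun i => ?_) w <;> refine Fin.cases ?_ (fun j => ?_) w'
    · simp
    · intro _; simpa using (hA j).symm
    · intro _; simpa using hA i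
    · intro hij
      have hne : i ≠ j := fun h => hij (by rw [h])
      simpa using h4 i j hne

theorem duchet (t : ℕ) : ∀ S : Finset V, ¬ KM G S (t + 1) →
    ∃ I ⊆ S, (∀ u ∈ I, ∀ v ∈ I, ¬ G.Adj u v) ∧ S.card ≤ 2 * t * I.card := by
  induction t with
  | zero =>
    intro S hS
    refine ⟨∅, by simp, by simp, ?_⟩
    by_contra hcon
    obtain ⟨s, hs⟩ := Finset.card_pos.1 (show 0 < S.card by omega)
    exact hS ⟨fun _ => {s}, fun _ => by simpa using hs, fun _ => Cn.singleton s,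
      fun i j hij => absurd (Subsingleton.elim (α := Fin 1) i j) hij,
      fun i j hij => absurd (Subsingleton.elim (α := Fin 1) i j) hij.ne⟩
  | succ t ih =>
    intro S
    induction S using Finset.strongInduction with
    | _ S ihS =>
    intro hS
    rcases S.eq_empty_or_nonempty with rfl | hne
    · exact ⟨∅, by simp, by simp, by simp⟩
    by_cases hC : Cn G S
    · obtain ⟨D, hDS, I, hID, hDc, hI, hcard, hdom⟩ := cds hC
      obtain ⟨I2, hI2, hI2i, hI2c⟩ := ih (S \ D) fun h => hS (h.extend hDc hDS hdom)
      have hsum := Finset.card_sdiff_add_card_eq_card hDS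
      rcases le_total I.card I2.card with hle | hle
      · exact ⟨I2, hI2.trans Finset.sdiff_subset, hI2i, by nlinarith⟩
      · exact ⟨I, hID.trans hDS, hI, by nlinarith⟩
    · obtain ⟨A, hA, hAne, hBne, hno⟩ := not_Cn_split hne hC
      have hAs : A ⊂ S := ⟨hA, fun h => by
        obtain ⟨b, hb⟩ := hBne
        rw [Finset.mem_sdiff] at hb
        exact hb.2 (h hb.1)⟩
      have hBs : S \ A ⊂ S := ⟨Finset.sdiff_subset, fun h => by
        obtain ⟨a, ha⟩ := hAne
        exact (Finset.mem_sdiff.1 (h (hA ha))).2 ha⟩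
      obtain ⟨I1, a1, a2, a3⟩ := ihS A hAs fun h => hS (h.mono hA le_rfl)
      obtain ⟨I2, b1, b2, b3⟩ := ihS (S \ A) hBs fun h => hS (h.mono Finset.sdiff_subset le_rfl)
      refine ⟨I1 ∪ I2, Finset.union_subset (a1.trans hA) (b1.trans Finset.sdiff_subset), ?_, ?_⟩
      · intro u hu v hv
        rw [Finset.mem_union] at hu hv
        rcases hu with hu | hu <;> rcases hv with hv | hv
        · exact a2 u hu v hv
        · exact hno u (a1 hu) v (b1 hv)
        · exact fun h => hno v (a1 hv) u (b1 hu) h.symm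
        · exact b2 u hu v hv
      · have hsum := Finset.card_sdiff_add_card_eq_card hA
        rw [Finset.card_union_of_disjoint (Finset.disjoint_left.2 fun v hv hv' =>
          (Finset.mem_sdiff.1 (b1 hv')).2 (a1 hv))]
        nlinarith

lemma halve {t : ℕ} (ht : 1 ≤ t) {S : Finset V} (hS : ¬ KM G S t) (i : ℕ) :
    ∃ S' ⊆ S, Col G (S \ S') i ∧ (2 * S'.card ≤ S.card ∨ 4 * t * S'.card + i * S.card ≤ 4 * t * S.card) := by
  induction i with
  | zero => exact ⟨S, subset_rfl, by simpa using Col.empty, Or.inr (by simp)⟩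
  | succ i ih =>
    obtain ⟨S', h1, h2, h3⟩ := ih
    by_cases hh : 2 * S'.card ≤ S.card
    · exact ⟨S', h1, h2.mono subset_rfl (by omega), Or.inl hh⟩
    have h3 := h3.resolve_left hh
    obtain ⟨I, hI, hIi, hIc⟩ := duchet (G := G) t S' fun h => hS (h.mono h1 (by omega))
    refine ⟨S' \ I, Finset.sdiff_subset.trans h1, ?_, Or.inr ?_⟩
    · refine (h2.union (Col.indep hIi)).mono ?_ le_rfl
      intro v hv
      simp only [Finset.mem_sdiff, Finset.mem_union] at hv ⊢
      tauto
    · have := Finset.card_sdiff_add_card_eq_card hI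
      push Not at hh
      nlinarith

theorem small_col {t : ℕ} (ht : 1 ≤ t) (j : ℕ) : ∀ {S : Finset V}, ¬ KM G S t → Col G S (2 * t * j + S.card / 2 ^ j) := by
  induction j with
  | zero => intro S _; simpa using Col.card S
  | succ j ih =>
    intro S hS
    obtain ⟨S', h1, h2, h3⟩ := halve ht hS (2 * t)
    have h4 : 2 * S'.card ≤ S.card := by
      rcases h3 with h3 | h3
      · exact h3
      · have : 2 * t * (2 * S'.card) ≤ 2 * t * S.card := by linarith
        exact le_of_mul_le_mul_left this (by omega)
    have h5 := ih (S := S') fun h => hS (h.mono h1 le_rfl)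
    refine (h2.union h5).mono (fun v hv => ?_) ?_
    · by_cases h : v ∈ S' <;> simp [h, hv]
    · have : S'.card / 2 ^ j ≤ S.card / 2 ^ (j + 1) := by
        rw [pow_succ', ← Nat.div_div_eq_div_mul]
        exact Nat.div_le_div_right (by omega)
      have e : 2 * t * (j + 1) = 2 * t + 2 * t * j := by ring
      omega

/-- a set with no coloring contains a subset of large min degree -/
lemma degen (d : ℕ) : ∀ S : Finset V, ¬ Col G S d → ∃ S' ⊆ S, S'.Nonempty ∧ ∀ v ∈ S', d ≤ (nb G S' v).card := by
  intro S
  induction S using Finset.strongInduction with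
  | _ S ih =>
  intro hS
  by_cases h : ∀ v ∈ S, d ≤ (nb G S v).card
  · refine ⟨S, subset_rfl, ?_, h⟩
    rw [Finset.nonempty_iff_ne_empty]
    rintro rfl
    exact hS Col.empty
  · push Not at h
    obtain ⟨v, hv, hlt⟩ := h
    by_cases hc : Col G (S.erase v) d
    · exfalso
      apply hS
      obtain ⟨f, hf, hf'⟩ := hc
      obtain ⟨c, hc, hcn⟩ := exists_notMem_of_card_lt (S := (nb G S v).image f) (T := Finset.range d) (by
        rw [Finset.card_range]; exact Finset.card_image_le.trans_lt hlt)
      have hcn' : ∀ u ∈ S, G.Adj v u → f u ≠ c := fun u hu hvu h' =>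
        hcn (Finset.mem_image.2 ⟨u, mem_nb.2 ⟨hu, hvu⟩, h'⟩)
      refine ⟨Function.update f v c, fun u hu => ?_, fun u hu w hw huw => ?_⟩
      · by_cases huv : u = v
        · subst huv; simpa using hc
        · rw [Function.update_of_ne huv]; exact hf u (by simp [huv, hu])
      · by_cases huv : u = v
        · subst huv
          rw [Function.update_self, Function.update_of_ne huw.ne']
          exact (hcn' w hw huw).symm
        · by_cases hwv : w = v
          · subst hwv
            rw [Function.update_self, Function.update_of_ne huv]
            exact hcn' u hu huw.symm
          · rw [Function.update_of_ne huv, Function.update_of_ne hwv]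
            exact hf' u (by simp [huv, hu]) w (by simp [hwv, hw]) huw
    · obtain ⟨S', h1, h2⟩ := ih _ (Finset.erase_ssubset hv) hc
      exact ⟨S', h1.trans (Finset.erase_subset _ _), h2⟩

end DM

theorem dens_minor {C : ℝ} (hC : 0 < C) (hyp : Hyp C) : ∃ K2 : ℕ, 1 ≤ K2 ∧ ∀ (V : Type) [Fintype V]
    (G : SimpleGraph V) (t l : ℕ), 1 ≤ t → 1 ≤ l → t ≤ 2 ^ l → ((K2 * t * l : ℕ) : ℝ) ≤ G.density →
    G.HasMinor (⊤ : SimpleGraph (Fin t)) := by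
  classical
  obtain ⟨K, hK, hL⟩ := thmL hC hyp
  refine ⟨4 * K ^ 2 * (K + 1), Nat.succ_le_of_lt (by positivity), ?_⟩
  intro V _ G t l ht hl htl hden
  have hl' : l + K < 2 ^ (l + K) := Nat.lt_two_pow_self
  obtain ⟨l', hl'e⟩ : ∃ l', l' = 2 * (l + K) := ⟨_, rfl⟩
  obtain ⟨n, hn⟩ : ∃ n, n = t * K * l' := ⟨_, rfl⟩
  have hn1 : 1 ≤ n := by rw [hn, hl'e]; exact Nat.succ_le_of_lt (by positivity)
  have hn2 : n ≤ 2 ^ l' := by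
    rw [hn, hl'e, two_mul, pow_add, pow_add]
    have hK' : 2 * K ≤ 2 ^ K := by
      clear * - hK
      induction K, hK using Nat.le_induction with
      | base => norm_num
      | succ k hk ih => rw [pow_succ]; omega
    calc t * K * (l + K + (l + K)) = t * (2 * K) * (l + K) := by ring
      _ ≤ 2 ^ l * 2 ^ K * (2 ^ l * 2 ^ K) := Nat.mul_le_mul (Nat.mul_le_mul htl hK') (by rw [← pow_add]; exact hl'.le)
  have hdpos : 0 < G.density := lt_of_lt_of_le (by exact_mod_cast (by positivity : 0 < 4 * K ^ 2 * (K + 1) * t * l)) hden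
  have hVne : (Finset.univ : Finset V).Nonempty := by
    by_contra hcon
    rw [Finset.not_nonempty_iff_eq_empty] at hcon
    have : Fintype.card V = 0 := by rw [← Finset.card_univ, hcon]; simp
    have h3 := density_le G
    rw [this] at h3
    simp at h3
    linarith
  have hVpos : (0 : ℝ) < (Finset.univ : Finset V).card := by exact_mod_cast Finset.card_pos.2 hVne
  obtain ⟨J, _, hJ⟩ := mader' (G := G) (k := K * n) Finset.univ (Nat.succ_le_of_lt (by positivity)) hVne (by
    have h1 : G.density = (Nat.card G.edgeSet : ℝ) / (Finset.univ : Finset V).card := by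
      rw [SimpleGraph.density, Nat.card_eq_fintype_card (α := V), Finset.card_univ]
    rw [prs_univ]
    rw [h1, le_div_iff₀ hVpos] at hden
    have h2 : 4 * K ^ 2 * (K + 1) * t * l * (Finset.univ : Finset V).card ≤ Nat.card G.edgeSet := by exact_mod_cast hden
    have h3 : 2 * (K * n) ≤ 4 * K ^ 2 * (K + 1) * t * l := by
      rw [hn, hl'e]
      have : l + K ≤ (K + 1) * l := by nlinarith
      calc 2 * (K * (t * K * (2 * (l + K)))) = 4 * K ^ 2 * t * (l + K) := by ring
        _ ≤ 4 * K ^ 2 * t * ((K + 1) * l) := Nat.mul_le_mul_left _ this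
        _ = _ := by ring
    have h4 := Nat.mul_le_mul_right (Finset.univ : Finset V).card h3
    nlinarith)
  have hW := hL V G J n t l' hn1 (by omega) hn2 hn.ge hJ
  have htn : t ≤ n := by
    rw [hn, mul_assoc]; exact Nat.le_mul_of_pos_right _ (by rw [hl'e]; positivity)
  have htJ : t ≤ J.card := htn.trans ((Nat.le_mul_of_pos_left n (by omega)).trans hJ.1.le)
  obtain ⟨f, hf, hfi⟩ := list_lemma' (ι := Fin t) (fun _ => J) (fun _ => by simpa using htJ)
  obtain ⟨B, b0, b1, b2, b3, b4, b5⟩ := hW (Fin t) f f Finset.univ (by simpa using htn) (by simp) hf hf (fun k l hkl =>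
    ⟨fun h => hkl (hfi h), fun h => hkl (hfi h), fun h => hkl (hfi h)⟩)
  have : Mn G J (⊤ : SimpleGraph (Fin t)) B := ⟨b0, b1, b2, fun w w' h => b5 w w' h.ne (by simp) (by simp)⟩
  exact this.hasMinor
end CD

namespace CD

section GN
variable {V : Type*} [DecidableEq V] {G : SimpleGraph V}

def GNok (G : SimpleGraph V) (N : ℕ) (U X : Finset V) (φ : V → ℕ) (F : V → Finset ℕ) : Prop :=
  ∃ f : V → ℕ, (∀ u ∈ U, f u < N ∧ f u ∉ F u) ∧ (∀ u ∈ U, ∀ v ∈ U, G.Adj u v → f u ≠ f v) ∧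
    ∀ u ∈ U, ∀ x ∈ X, G.Adj u x → f u ≠ φ x

structure GNst (S : Finset V) (k : ℕ) (U X : Finset V) (F : V → Finset ℕ) : Prop where
  hU : U ⊆ S
  hX : X ⊆ S
  hd : Disjoint U X
  hF : ∀ u ∈ U, (F u).card ≤ k
  hw : k * X.card + ∑ u ∈ U, (F u).card ≤ 2 * k ^ 2

lemma GNst.Xle {S U X : Finset V} {k : ℕ} {F : V → Finset ℕ} (hk : 1 ≤ k) (h : GNst S k U X F) : X.card ≤ 2 * k := by
  have := h.hw
  have e : k * (2 * k) = 2 * k ^ 2 := by ring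
  have h2 : k * X.card ≤ k * (2 * k) := by rw [e]; exact le_trans (Nat.le_add_right _ _) this
  exact le_of_mul_le_mul_left h2 hk

/-- list coloring part -/
lemma GN_list {N k : ℕ} {S U X : Finset V} {F : V → Finset ℕ} (hk : 1 ≤ k) (h : GNst S k U X F) (φ : V → ℕ)
    {U' : Finset V} (hU' : U' ⊆ U) (Bad : Finset ℕ) (hB : Bad.card + 3 * k + U'.card ≤ N) :
    ∃ f : V → ℕ, (∀ u ∈ U', f u < N ∧ f u ∉ F u ∧ f u ∉ Bad ∧ ∀ x ∈ X, f u ≠ φ x) ∧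
      ∀ u ∈ U', ∀ v ∈ U', f u = f v → u = v := by
  classical
  obtain ⟨f, h1, h2⟩ := list_lemma (V := ℕ) U' (fun u => Finset.range N \ (F u ∪ Bad ∪ X.image φ)) (by
    intro u hu
    have h3 := Finset.le_card_sdiff (F u ∪ Bad ∪ X.image φ) (Finset.range N)
    have h4 := Finset.card_union_le (F u ∪ Bad) (X.image φ)
    have h5 := Finset.card_union_le (F u) Bad
    have h6 := h.hF u (hU' hu)
    have h7 := Finset.card_image_le (s := X) (f := φ)
    have h8 := h.Xle hk
    rw [Finset.card_range] at h3
    omega)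
  refine ⟨f, fun u hu => ?_, h2⟩
  have := h1 u hu
  simp only [Finset.mem_sdiff, Finset.mem_range, Finset.mem_union, not_or, Finset.mem_image, not_exists, not_and] at this
  exact ⟨this.1, this.2.1.1, this.2.1.2, fun x hx hh => this.2.2 x hx hh.symm⟩

lemma GN_split {N k : ℕ} {S U X : Finset V} {F : V → Finset ℕ} {φ : V → ℕ} (hk : 1 ≤ k) (h : GNst S k U X F)
    (ih : ∀ (U' X' : Finset V) (φ' : V → ℕ), U'.card < U.card → GNst S k U' X' F → GNok G N U' X' φ' F)
    {A B Y : Finset V} (hY : Y.card < k) (hYP : Y ⊆ U ∪ X) (hABY : ∀ v ∈ U ∪ X, v ∈ A ∨ v ∈ B ∨ v ∈ Y)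
    (hBP : B ⊆ U ∪ X)
    (hBY : Disjoint B Y) (hAB : Disjoint A B)
    (hE : ∀ a ∈ A, ∀ b ∈ B, ¬ G.Adj a b) (hUA : ∃ u ∈ U, u ∈ A) (hUB : ∃ u ∈ U, u ∈ B)
    (hw : k * (X ∩ B).card + ∑ u ∈ U ∩ B, (F u).card ≤ k ^ 2) : GNok G N U X φ F := by
  classical
  obtain ⟨f1, a1, a2, a3⟩ := ih (U \ B) X φ (by
    apply Finset.card_lt_card
    refine ⟨Finset.sdiff_subset, fun hh => ?_⟩
    obtain ⟨u, hu, huB⟩ := hUB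
    exact (Finset.mem_sdiff.1 (hh hu)).2 huB) ⟨Finset.sdiff_subset.trans h.hU, h.hX, h.hd.mono_left Finset.sdiff_subset,
      fun u hu => h.hF u (Finset.mem_sdiff.1 hu).1, by
        refine le_trans ?_ h.hw
        apply Nat.add_le_add_left
        exact Finset.sum_le_sum_of_subset Finset.sdiff_subset⟩
  set φ2 : V → ℕ := fun v => if v ∈ X then φ v else f1 v with hφ2
  obtain ⟨f2, b1, b2, b3⟩ := ih (U ∩ B) ((X ∩ B) ∪ Y) φ2 (by
    apply Finset.card_lt_card
    refine ⟨Finset.inter_subset_left, fun hh => ?_⟩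
    obtain ⟨u, hu, huA⟩ := hUA
    exact Finset.disjoint_left.1 hAB huA (Finset.mem_inter.1 (hh hu)).2) ⟨Finset.inter_subset_left.trans h.hU,
      Finset.union_subset (Finset.inter_subset_left.trans h.hX) (hYP.trans (Finset.union_subset h.hU h.hX)), by
        rw [Finset.disjoint_left]
        intro v hv hv'
        rw [Finset.mem_inter] at hv
        rcases Finset.mem_union.1 hv' with h' | h'
        · exact Finset.disjoint_left.1 h.hd hv.1 (Finset.mem_inter.1 h').1
        · exact Finset.disjoint_left.1 hBY hv.2 h',
      fun u hu => h.hF u (Finset.mem_inter.1 hu).1, by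
        have := Finset.card_union_le (X ∩ B) Y
        nlinarith⟩
  have key : ∀ u ∈ U ∩ B, ∀ v ∈ U \ B, G.Adj u v → f2 u ≠ f1 v := by
    intro u hu v hv huv
    rw [Finset.mem_inter] at hu
    rw [Finset.mem_sdiff] at hv
    have hvY : v ∈ Y := by
      rcases hABY v (Finset.mem_union_left _ hv.1) with h' | h' | h'
      · exact absurd huv.symm (hE v h' u hu.2)
      · exact absurd h' hv.2
      · exact h'
    have := b3 u (by simp [hu.1, hu.2]) v (by simp [hvY]) huv
    have hvX : v ∉ X := fun h' => Finset.disjoint_left.1 h.hd hv.1 h'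
    simpa [hφ2, hvX] using this
  refine ⟨fun v => if v ∈ B then f2 v else f1 v, fun u hu => ?_, fun u hu v hv huv => ?_, fun u hu x hx hux => ?_⟩
  · by_cases huB : u ∈ B
    · simpa [huB] using b1 u (by simp [hu, huB])
    · simpa [huB] using a1 u (by simp [hu, huB])
  · by_cases huB : u ∈ B <;> by_cases hvB : v ∈ B
    · simpa [huB, hvB] using b2 u (by simp [hu, huB]) v (by simp [hv, hvB]) huv
    · simpa [huB, hvB] using key u (by simp [hu, huB]) v (by simp [hv, hvB]) huv
    · simpa [huB, hvB] using (key v (by simp [hv, hvB]) u (by simp [hu, huB]) huv.symm).symm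
    · simpa [huB, hvB] using a2 u (by simp [hu, huB]) v (by simp [hv, hvB]) huv
  · by_cases huB : u ∈ B
    · have hxBY : x ∈ (X ∩ B) ∪ Y := by
        rcases hABY x (Finset.mem_union_right _ hx) with h' | h' | h'
        · exact absurd hux.symm (hE x h' u huB)
        · simp [hx, h']
        · simp [h']
      have := b3 u (by simp [hu, huB]) x hxBY hux
      simpa [huB, hφ2, hx] using this
    · simpa [huB] using a3 u (by simp [hu, huB]) x hx hux

lemma GN_conn {N k q : ℕ} {S U X : Finset V} {F : V → Finset ℕ} {φ : V → ℕ} (hk : 1 ≤ k) (hq : k ≤ q) (hN : N = q + 5 * k)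
    (h : GNst S k U X F) (hcol : Col G (U ∪ X) q) : GNok G N U X φ F := by
  classical
  obtain ⟨f0, hf0, hf0'⟩ := hcol
  have hq0 : 0 < q := by omega
  obtain ⟨e, he, hei⟩ := list_lemma' (V := ℕ) (ι := Fin q) (fun _ => Finset.range N \ X.image φ) (by
    intro i
    have h3 := Finset.le_card_sdiff (X.image φ) (Finset.range N)
    have h7 := Finset.card_image_le (s := X) (f := φ)
    have h8 := h.Xle hk
    rw [Finset.card_range] at h3
    rw [Fintype.card_fin]
    omega)
  set g : ℕ → V → ℕ := fun s u => e ⟨(f0 u + s) % q, Nat.mod_lt _ hq0⟩ with hg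
  have hginj : ∀ u, ∀ s < q, ∀ s' < q, g s u = g s' u → s = s' := by
    intro u s hs s' hs' hh
    have h1 := congrArg Fin.val (hei hh)
    have h2 : s ≡ s' [MOD q] := Nat.ModEq.add_left_cancel' (f0 u) h1
    exact h2.eq_of_lt_of_lt hs hs'
  have hgp : ∀ s, ∀ u ∈ U, ∀ v ∈ U, G.Adj u v → g s u ≠ g s v := by
    intro s u hu v hv huv hh
    have h1 := congrArg Fin.val (hei hh)
    have h2 : f0 u ≡ f0 v [MOD q] := Nat.ModEq.add_right_cancel' s h1
    exact hf0' u (by simp [hu]) v (by simp [hv]) huv (h2.eq_of_lt_of_lt (hf0 u (by simp [hu])) (hf0 v (by simp [hv])))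
  have hsum : ∑ s ∈ Finset.range q, (U.filter fun u => g s u ∈ F u).card ≤ 2 * k ^ 2 := by
    calc ∑ s ∈ Finset.range q, (U.filter fun u => g s u ∈ F u).card
        = ∑ u ∈ U, ((Finset.range q).filter fun s => g s u ∈ F u).card := by
          simp only [Finset.card_filter]
          exact Finset.sum_comm
      _ ≤ ∑ u ∈ U, (F u).card := by
          apply Finset.sum_le_sum
          intro u _
          apply Finset.card_le_card_of_injOn (fun s => g s u)
          · intro s hs
            exact (Finset.mem_filter.1 hs).2
          · intro s hs s' hs' hh
            rw [Finset.mem_coe, Finset.mem_filter, Finset.mem_range] at hs hs'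
            exact hginj u s hs.1 s' hs'.1 hh
      _ ≤ 2 * k ^ 2 := le_trans (Nat.le_add_left _ _) h.hw
  obtain ⟨s, hs, hsc⟩ : ∃ s ∈ Finset.range q, (U.filter fun u => g s u ∈ F u).card ≤ 2 * k := by
    by_contra hcon
    push Not at hcon
    have h1 := Finset.card_nsmul_le_sum (Finset.range q) _ (2 * k + 1) hcon
    rw [Finset.card_range, smul_eq_mul] at h1
    nlinarith
  set Cf := U.filter fun u => g s u ∈ F u with hCf
  obtain ⟨f, c1, c2⟩ := GN_list (N := N) hk h φ (U' := Cf) (Finset.filter_subset _ _) (Finset.univ.image e) (by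
    have := Finset.card_image_le (s := Finset.univ) (f := e)
    rw [Finset.card_univ, Fintype.card_fin] at this
    omega)
  have hfg : ∀ u ∈ Cf, ∀ v, f u ≠ g s v := fun u hu v hh => by
    apply (c1 u hu).2.2.1
    rw [hh]; exact Finset.mem_image_of_mem _ (Finset.mem_univ _)
  refine ⟨fun u => if u ∈ Cf then f u else g s u, fun u hu => ?_, fun u hu v hv huv => ?_, fun u hu x hx hux => ?_⟩
  · by_cases hc : u ∈ Cf
    · simpa [hc] using ⟨(c1 u hc).1, (c1 u hc).2.1⟩
    · simp only [hc, if_false]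
      refine ⟨?_, fun hh => hc (by rw [hCf, Finset.mem_filter]; exact ⟨hu, hh⟩)⟩
      have := he ⟨(f0 u + s) % q, Nat.mod_lt _ hq0⟩
      rw [Finset.mem_sdiff, Finset.mem_range] at this
      exact this.1
  · by_cases hc : u ∈ Cf <;> by_cases hc' : v ∈ Cf
    · simp only [hc, hc', if_true]
      exact fun hh => huv.ne (c2 u hc v hc' hh)
    · simpa [hc, hc'] using hfg u hc v
    · simpa [hc, hc'] using (hfg v hc' u).symm
    · simpa [hc, hc'] using hgp s u hu v hv huv
  · by_cases hc : u ∈ Cf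
    · simpa [hc] using (c1 u hc).2.2.2 x hx
    · simp only [hc, if_false]
      intro hh
      have := he ⟨(f0 u + s) % q, Nat.mod_lt _ hq0⟩
      rw [Finset.mem_sdiff] at this
      apply this.2
      exact Finset.mem_image.2 ⟨x, hx, hh.symm⟩

theorem GN_main {N k q : ℕ} {S : Finset V} (hk : 1 ≤ k) (hq : k ≤ q) (hN : N = q + 5 * k)
    (hcol : ∀ J ⊆ S, kc G k J → Col G J q) : ∀ (n : ℕ) (U X : Finset V) (φ : V → ℕ) (F : V → Finset ℕ), U.card = n →
      GNst S k U X F → GNok G N U X φ F := by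
  classical
  intro n
  induction n using Nat.strong_induction_on with
  | _ n ih =>
  intro U X φ F hUn
  obtain ⟨r, hr⟩ : ∃ r, X.card = r := ⟨_, rfl⟩
  induction r using Nat.strong_induction_on generalizing X φ F with
  | _ r ihr =>
  intro h
  by_cases hsm : U.card ≤ k
  · obtain ⟨f, c1, c2⟩ := GN_list (N := N) hk h φ (U' := U) subset_rfl ∅ (by simp; omega)
    exact ⟨f, fun u hu => ⟨(c1 u hu).1, (c1 u hu).2.1⟩, fun u hu v hv huv hh => huv.ne (c2 u hu v hv hh),
      fun u hu x hx _ => (c1 u hu).2.2.2 x hx⟩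
  push Not at hsm
  by_cases ca : ∃ u ∈ U, (F u).card = k
  · obtain ⟨u, hu, hFu⟩ := ca
    obtain ⟨f, c1, -⟩ := GN_list (N := N) hk h φ (U' := {u}) (by simpa using hu) ∅ (by simp; omega)
    have c1 := c1 u (by simp)
    have huX : u ∉ X := fun h' => Finset.disjoint_left.1 h.hd hu h'
    obtain ⟨f2, b1, b2, b3⟩ := ih (U.erase u).card (by rw [← hUn]; exact Finset.card_erase_lt_of_mem hu) (U.erase u)
      (insert u X) (Function.update φ u (f u)) F rfl ⟨(Finset.erase_subset _ _).trans h.hU, Finset.insert_subset (h.hU hu) h.hX, by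
        rw [Finset.disjoint_insert_right]
        exact ⟨by simp, h.hd.mono_left (Finset.erase_subset _ _)⟩, fun v hv => h.hF v (Finset.mem_erase.1 hv).2, by
        rw [Finset.card_insert_of_notMem huX]
        have := Finset.add_sum_erase U (fun u => (F u).card) hu
        have := h.hw
        nlinarith⟩
    refine ⟨Function.update f2 u (f u), fun v hv => ?_, fun v hv w hw hvw => ?_, fun v hv x hx hvx => ?_⟩
    · by_cases hvu : v = u
      · subst hvu; simpa using ⟨c1.1, c1.2.1⟩
      · simpa [hvu] using b1 v (by simp [hvu, hv])
    · by_cases hvu : v = u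
      · subst hvu
        have hwv := hvw.ne'
        have := b3 w (by simp [hwv, hw]) v (by simp) hvw.symm
        simp only [Function.update_self] at this
        simpa [hwv] using this.symm
      · by_cases hwu : w = u
        · subst hwu
          have := b3 v (by simp [hvu, hv]) w (by simp) hvw
          simp only [Function.update_self] at this
          simpa [hvu] using this
        · simpa [hvu, hwu] using b2 v (by simp [hvu, hv]) w (by simp [hwu, hw]) hvw
    · by_cases hvu : v = u
      · subst hvu; simpa using c1.2.2.2 x hx
      · have hxu : x ≠ u := fun h' => huX (h' ▸ hx)
        simpa [hvu, hxu] using b3 v (by simp [hvu, hv]) x (by simp [hx]) hvx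
  push Not at ca
  by_cases cb : ∃ x ∈ X, (nb G U x).card < k
  · obtain ⟨x, hx, hxk⟩ := cb
    obtain ⟨f, b1, b2, b3⟩ := ihr (X.erase x).card (by rw [← hr]; exact Finset.card_erase_lt_of_mem hx) (X.erase x) φ
      (fun u => if G.Adj x u then insert (φ x) (F u) else F u) rfl ⟨h.hU, (Finset.erase_subset _ _).trans h.hX,
        h.hd.mono_right (Finset.erase_subset _ _), fun u hu => by
          have h1 := h.hF u hu
          have h2 := ca u hu
          by_cases ha : G.Adj x u
          · simp only [ha, if_true]
            have := Finset.card_insert_le (φ x) (F u)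
            omega
          · simpa [ha] using h1, by
          have h1 : ∑ u ∈ U, (if G.Adj x u then insert (φ x) (F u) else F u).card ≤ ∑ u ∈ U, ((F u).card + if G.Adj x u then 1 else 0) := by
            apply Finset.sum_le_sum
            intro u _
            split_ifs
            · exact Finset.card_insert_le _ _
            · simp
          rw [Finset.sum_add_distrib, ← Finset.card_filter] at h1
          have h2 : (U.filter fun u => G.Adj x u).card < k := by
            convert hxk using 2
            ext u; simp [mem_nb]
          have h3 := Finset.card_erase_add_one hx
          have h4 := h.hw
          rw [← h3] at h4
          nlinarith⟩
    refine ⟨f, fun u hu => ?_, b2, fun u hu y hy huy => ?_⟩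
    · refine ⟨(b1 u hu).1, fun hh => (b1 u hu).2 ?_⟩
      dsimp only
      split_ifs
      · exact Finset.mem_insert_of_mem hh
      · exact hh
    · by_cases hyx : y = x
      · subst hyx
        intro hh
        apply (b1 u hu).2
        simp only [huy.symm, if_true]
        rw [hh]; exact Finset.mem_insert_self _ _
      · exact b3 u hu y (by simp [hyx, hy]) huy
  push Not at cb
  by_cases hc : kc G k (U ∪ X)
  · exact GN_conn hk hq hN h (hcol _ (Finset.union_subset h.hU h.hX) hc)
  have hPc : k < (U ∪ X).card := lt_of_lt_of_le hsm (Finset.card_le_card Finset.subset_union_left)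
  simp only [kc, hPc, true_and, not_forall] at hc
  obtain ⟨Y, hY, hnc⟩ := hc
  obtain ⟨A, hA, hAne, hBne, hno⟩ := not_Cn_split (by
    obtain ⟨a, ha, hn⟩ := exists_notMem_of_card_lt (hY.trans hPc)
    exact ⟨a, by simp [hn]; simpa using ha⟩) hnc
  set B := ((U ∪ X) \ Y) \ A with hB
  have hBsub : B ⊆ (U ∪ X) \ Y := Finset.sdiff_subset
  have meet : ∀ A B : Finset V, A ⊆ (U ∪ X) \ Y → A.Nonempty → (∀ v ∈ (U ∪ X) \ Y, v ∈ A ∨ v ∈ B) →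
      (∀ a ∈ A, ∀ b ∈ B, ¬ G.Adj a b) → ∃ u ∈ U, u ∈ A := by
    intro A B hA hAne hcov hno
    by_contra hcon
    push Not at hcon
    obtain ⟨x, hx⟩ := hAne
    have hxP := Finset.mem_sdiff.1 (hA hx)
    have hxX : x ∈ X := (Finset.mem_union.1 hxP.1).resolve_left fun h' => hcon x h' hx
    have h1 : nb G U x ⊆ Y := by
      intro u hu
      obtain ⟨huU, hxu⟩ := mem_nb.1 hu
      by_contra huY
      rcases hcov u (by simp [huU, huY]) with h' | h'
      · exact hcon u huU h'
      · exact hno x hx u h' hxu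
    have := cb x hxX
    have := Finset.card_le_card h1
    omega
  have hcovAB : ∀ v ∈ (U ∪ X) \ Y, v ∈ A ∨ v ∈ B := by
    intro v hv
    by_cases hvA : v ∈ A
    · exact Or.inl hvA
    · right; rw [hB, Finset.mem_sdiff]; exact ⟨hv, hvA⟩
  have hUA := meet A B hA hAne hcovAB hno
  have hUB := meet B A hBsub hBne (fun v hv => (hcovAB v hv).symm) fun a ha b hb hab => hno b hb a ha hab.symm
  have hdAB : Disjoint A B := Finset.disjoint_sdiff
  have hYc : (Y ∩ (U ∪ X)).card < k := lt_of_le_of_lt (Finset.card_le_card Finset.inter_subset_left) hY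
  have hcov3 : ∀ v ∈ U ∪ X, v ∈ A ∨ v ∈ B ∨ v ∈ Y ∩ (U ∪ X) := by
    intro v hv
    by_cases hvY : v ∈ Y
    · right; right; rw [Finset.mem_inter]; exact ⟨hvY, hv⟩
    · rcases hcovAB v (by rw [Finset.mem_sdiff]; exact ⟨hv, hvY⟩) with h' | h'
      · exact Or.inl h'
      · exact Or.inr (Or.inl h')
  have hdY : ∀ D ⊆ (U ∪ X) \ Y, Disjoint D (Y ∩ (U ∪ X)) := fun D hD => Finset.disjoint_left.2 fun v hv hv' =>
    (Finset.mem_sdiff.1 (hD hv)).2 (Finset.mem_inter.1 hv').1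
  have ih' : ∀ (U' X' : Finset V) (φ' : V → ℕ), U'.card < U.card → GNst S k U' X' F → GNok G N U' X' φ' F :=
    fun U' X' φ' hlt hst => ih U'.card (by omega) U' X' φ' F rfl hst
  have hwsum : (k * (X ∩ A).card + ∑ u ∈ U ∩ A, (F u).card) + (k * (X ∩ B).card + ∑ u ∈ U ∩ B, (F u).card) ≤ 2 * k ^ 2 := by
    have h1 : (X ∩ A).card + (X ∩ B).card ≤ X.card := by
      rw [← Finset.card_union_of_disjoint (hdAB.mono Finset.inter_subset_right Finset.inter_subset_right)]
      exact Finset.card_le_card (Finset.union_subset Finset.inter_subset_left Finset.inter_subset_left)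
    have h2 : ∑ u ∈ U ∩ A, (F u).card + ∑ u ∈ U ∩ B, (F u).card ≤ ∑ u ∈ U, (F u).card := by
      rw [← Finset.sum_union (hdAB.mono Finset.inter_subset_right Finset.inter_subset_right)]
      exact Finset.sum_le_sum_of_subset (Finset.union_subset Finset.inter_subset_left Finset.inter_subset_left)
    have h3 := h.hw
    nlinarith
  rcases Nat.lt_or_ge (k ^ 2) (k * (X ∩ B).card + ∑ u ∈ U ∩ B, (F u).card) with hlt | hge
  · exact GN_split hk h ih' hYc Finset.inter_subset_right (A := B) (B := A)
      (fun v hv => by rcases hcov3 v hv with h' | h' | h' <;> simp only [h', true_or, or_true])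
      (hA.trans Finset.sdiff_subset) (hdY A hA) hdAB.symm (fun a ha b hb hab => hno b hb a ha hab.symm) hUB hUA (by omega)
  · exact GN_split hk h ih' hYc Finset.inter_subset_right hcov3 (hBsub.trans Finset.sdiff_subset) (hdY B hBsub) hdAB hno hUA hUB hge

theorem GN {k q : ℕ} {S : Finset V} (hk : 1 ≤ k) (hq : k ≤ q) (h : ¬ Col G S (q + 5 * k)) :
    ∃ J ⊆ S, kc G k J ∧ ¬ Col G J q := by
  by_contra hcon
  push Not at hcon
  apply h
  obtain ⟨f, h1, h2, _⟩ := GN_main hk hq rfl hcon S.card S ∅ (fun _ => 0) (fun _ => ∅) rfl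
    ⟨subset_rfl, by simp, by simp, by simp, by simp⟩
  exact ⟨f, fun v hv => (h1 v hv).1, h2⟩
end GN
end CD

namespace CD
section prune
variable {V : Type} [DecidableEq V] {G : SimpleGraph V}

lemma pth : ∀ (n : ℕ) (Y : Finset V), Y.card = n → ∀ (Pr : V → Prop) (v : V), Cn G Y → v ∈ Y → (∃ p ∈ Y, Pr p) →
    (∀ Y' ⊆ Y, Cn G Y' → v ∈ Y' → (∃ p ∈ Y', Pr p) → Y' = Y) →
    (∀ p ∈ Y, ∀ p' ∈ Y, Pr p → Pr p' → p = p') ∧ Col G Y 2 := by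
  classical
  intro n
  induction n with
  | zero =>
    intro Y hY Pr v _ hv
    rw [Finset.card_eq_zero] at hY; simp [hY] at hv
  | succ n ih =>
    intro Y hY Pr v hC hv hp hmin
    by_cases hPv : Pr v
    · have := hmin {v} (by simpa using hv) (Cn.singleton v) (by simp) ⟨v, by simp, hPv⟩
      subst this
      exact ⟨by simp, Col.single.mono (Finset.Subset.refl _) (by omega)⟩
    · obtain ⟨p, hpY, hp⟩ := hp
      obtain ⟨Y', hY', c, hc, b, hb, hvY, hY'C, hcb⟩ := FH (B := Y.filter Pr) hC hv (by simp [hPv]) hpY (by simp [hpY, hp])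
      have hbY : b ∈ Y ∧ Pr b := by simpa using hb
      have hbY' : b ∉ Y' := fun h => by
        have := hY' h
        simp [hbY] at this
      have hY'Y : Y' ⊆ Y := fun z hz => (Finset.mem_sdiff.1 (hY' hz)).1
      have e1 := hmin (insert b Y') (Finset.insert_subset hbY.1 hY'Y)
        (hY'C.insert hc hcb) (by simp [hvY]) ⟨b, by simp, hbY.2⟩
      have hcard : Y'.card = n := by
        rw [← e1, Finset.card_insert_of_notMem hbY'] at hY; omega
      obtain ⟨i1, f, i2, i3⟩ := ih Y' hcard (fun z => G.Adj z b) v hY'C hvY ⟨c, hc, hcb⟩ (fun Y'' h1 h2 h3 h4 => by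
        obtain ⟨p, hp1, hp2⟩ := h4
        have hbY'' : b ∉ Y'' := fun h => hbY' (h1 h)
        have := hmin (insert b Y'') (Finset.insert_subset hbY.1 (h1.trans hY'Y))
          (h2.insert hp1 hp2) (by simp [h3]) ⟨b, by simp, hbY.2⟩
        rw [← e1] at this
        rw [← Finset.erase_insert hbY'', ← Finset.erase_insert hbY', this])
      have key : ∀ z ∈ Y, z = b ∨ z ∈ Y' := fun z hz => by rw [← e1] at hz; simpa using hz
      have npr : ∀ z ∈ Y', ¬ Pr z := fun z hz h => by
        have := hY' hz
        simp [h] at this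
      refine ⟨fun p hp p' hp' h h' => ?_, Function.update f b (1 - f c), fun z hz => ?_, fun z hz w hw hzw => ?_⟩
      · rcases key p hp with h1 | h1
        · rcases key p' hp' with h2 | h2
          · rw [h1, h2]
          · exact absurd h' (npr _ h2)
        · exact absurd h (npr _ h1)
      · rcases key z hz with h1 | h1
        · subst h1; simp
        · have : z ≠ b := fun h => hbY' (h ▸ h1)
          simp [this, i2 z h1]
      · have hfc := i2 c hc
        rcases key z hz with h1 | h1
        · rcases key w hw with h2 | h2
          · subst h1; subst h2; exact absurd hzw G.irrefl
          · have : w ≠ b := fun h => hbY' (h ▸ h2)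
            subst h1
            have := i1 w h2 c hc hzw.symm hcb
            subst this
            simp [*]; omega
        · have hzb : z ≠ b := fun h => hbY' (h ▸ h1)
          rcases key w hw with h2 | h2
          · subst h2
            have := i1 z h1 c hc hzw hcb
            subst this
            simp [*]; omega
          · have : w ≠ b := fun h => hbY' (h ▸ h2)
            simp [this, hzb, i3 z h1 w h2 hzw]

lemma prune {T0 : Finset V} (hT0 : Cn G T0) {e : V} (he : e ∈ T0) (F : Finset V) : F ⊆ T0 →
    ∃ T ⊆ T0, Cn G T ∧ e ∈ T ∧ F ⊆ T ∧ ∃ Z : Finset V, Z.card ≤ F.card + 1 ∧ Col G (T \ Z) 2 := by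
  classical
  induction F using Finset.induction_on with
  | empty =>
    intro _
    exact ⟨{e}, by simpa using he, Cn.singleton e, by simp, by simp, {e}, by simp, by simpa using Col.empty⟩
  | insert v F hvF ih =>
    intro hF
    obtain ⟨T, hT, hTC, heT, hFT, Z, hZ, f, hf1, hf2⟩ := ih ((Finset.subset_insert _ _).trans hF)
    have hv : v ∈ T0 := hF (by simp)
    by_cases hvT : v ∈ T
    · exact ⟨T, hT, hTC, heT, Finset.insert_subset hvT hFT, Z, by
        rw [Finset.card_insert_of_notMem hvF]; omega, f, hf1, hf2⟩
    obtain ⟨Y0, hY0, c0, hc0, b0, hb0, hvY0, hY0C, hcb0⟩ := FH (B := T) hT0 hv hvT (hT heT) heT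
    let P : Finset V → Prop := fun Y => Cn G Y ∧ v ∈ Y ∧ ∃ p ∈ Y, ∃ w ∈ T, G.Adj p w
    obtain ⟨Y, hYm, hmin⟩ := Finset.exists_min_image (Y0.powerset.filter P) Finset.card
      ⟨Y0, by simp only [Finset.mem_filter, Finset.mem_powerset]; exact ⟨Finset.Subset.refl _, hY0C, hvY0, c0, hc0, b0, (Finset.mem_inter.1 hb0).2, hcb0⟩⟩
    simp only [Finset.mem_filter, Finset.mem_powerset] at hYm hmin
    obtain ⟨hYY0, hYC, hvY, p, hpY, w, hwT, hpw⟩ := hYm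
    obtain ⟨j1, g, j2, j3⟩ := pth _ Y rfl (fun p => ∃ w ∈ T, G.Adj p w) v hYC hvY ⟨p, hpY, w, hwT, hpw⟩
      (fun Y' h1 h2 h3 h4 => Finset.eq_of_subset_of_card_le h1 (hmin Y' ⟨h1.trans hYY0, h2, h3, h4⟩))
    have hYT : ∀ z ∈ Y, z ∉ T := fun z hz => (Finset.mem_sdiff.1 (hY0 (hYY0 hz))).2
    refine ⟨T ∪ Y, Finset.union_subset hT (fun z hz => (Finset.mem_sdiff.1 (hY0 (hYY0 hz))).1), ?_, by simp [heT],
      Finset.insert_subset (by simp [hvY]) (hFT.trans Finset.subset_union_left), insert p Z, ?_,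
      fun z => if z ∈ T then f z else g z, fun z hz => ?_, fun z hz u hu hzu => ?_⟩
    · exact hTC.union hYC hwT hpY (Or.inr hpw.symm)
    · rw [Finset.card_insert_of_notMem hvF]
      have := Finset.card_insert_le p Z
      omega
    · simp only [Finset.mem_sdiff, Finset.mem_union, Finset.mem_insert, not_or] at hz
      by_cases hzT : z ∈ T
      · simp only [hzT, if_true]; exact hf1 z (by simp [hzT, hz.2.2])
      · simp only [hzT, if_false]; exact j2 z (by tauto)
    · simp only [Finset.mem_sdiff, Finset.mem_union, Finset.mem_insert, not_or] at hz hu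
      by_cases hzT : z ∈ T <;> by_cases huT : u ∈ T <;> simp only [hzT, huT, if_true, if_false]
      · exact hf2 z (by simp [hzT, hz.2.2]) u (by simp [huT, hu.2.2]) hzu
      · exact absurd (j1 u (by tauto) p hpY ⟨z, hzT, hzu.symm⟩ ⟨w, hwT, hpw⟩) hu.2.1
      · exact absurd (j1 z (by tauto) p hpY ⟨u, huT, hzu⟩ ⟨w, hwT, hpw⟩) hz.2.1
      · exact j3 z (by tauto) u (by tauto) hzu

lemma Col.biUnion {ι : Type*} [DecidableEq ι] {c : ℕ} {f : ι → Finset V} (s : Finset ι) (h : ∀ i ∈ s, Col G (f i) c) :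
    Col G (s.biUnion f) (c * s.card) := by
  induction s using Finset.induction_on with
  | empty => simpa using Col.empty
  | insert a s ha ih =>
    rw [Finset.biUnion_insert, Finset.card_insert_of_notMem ha, Nat.mul_succ, Nat.add_comm]
    exact (h a (by simp)).union (ih fun i hi => h i (by simp [hi]))

lemma prune_fam {t : ℕ} {T F : Fin t → Finset V} {e : Fin t → V} (hT : ∀ i, Cn G (T i)) (he : ∀ i, e i ∈ T i)
    (hF : ∀ i, F i ⊆ T i) : ∃ T' : Fin t → Finset V, (∀ i, T' i ⊆ T i) ∧ (∀ i, Cn G (T' i)) ∧ (∀ i, e i ∈ T' i) ∧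
      (∀ i, F i ⊆ T' i) ∧ ∃ Z : Finset V, Z.card ≤ ∑ i, (F i).card + t ∧ Col G (Finset.univ.biUnion T' \ Z) (2 * t) := by
  classical
  choose T' h1 h2 h3 h4 Z h5 h6 using fun i => prune (hT i) (he i) (F i) (hF i)
  refine ⟨T', h1, h2, h3, h4, Finset.univ.biUnion Z, ?_, ?_⟩
  · refine Finset.card_biUnion_le.trans ((Finset.sum_le_sum fun i _ => h5 i).trans ?_)
    simp [Finset.sum_add_distrib]
  · have := Col.biUnion (G := G) (c := 2) (f := fun i => T' i \ Z i) (Finset.univ : Finset (Fin t)) (fun i _ => h6 i)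
    rw [Finset.card_univ, Fintype.card_fin] at this
    refine this.mono (fun z hz => ?_) le_rfl
    simp only [Finset.mem_sdiff, Finset.mem_biUnion, Finset.mem_univ, true_and, not_exists] at hz ⊢
    obtain ⟨⟨i, hi⟩, h⟩ := hz
    exact ⟨i, hi, h i⟩
end prune
end CD

namespace CD
section gam
variable {V : Type} [DecidableEq V] {G : SimpleGraph V}

lemma Cn.emb {W : Type} [DecidableEq W] {Γ : SimpleGraph W} (φ : V ↪ W) (hφ : ∀ u v, G.Adj u v ↔ Γ.Adj (φ u) (φ v))
    {Q : Finset V} : Cn Γ (Q.map φ) ↔ Cn G Q := by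
  classical
  constructor
  · rintro ⟨h1, h2⟩
    refine ⟨by simpa using h1, fun A hA hne hcl => ?_⟩
    have := h2 (A.map φ) (Finset.map_subset_map.2 hA) (by simpa using hne) (by
      intro a ha b hb hab
      obtain ⟨a, ha1, rfl⟩ := Finset.mem_map.1 ha
      obtain ⟨b, hb1, rfl⟩ := Finset.mem_map.1 hb
      exact Finset.mem_map_of_mem _ (hcl a ha1 b hb1 ((hφ _ _).2 hab)))
    exact Finset.map_injective φ this
  · rintro ⟨h1, h2⟩
    refine ⟨by simpa using h1, fun A hA hne hcl => ?_⟩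
    obtain ⟨A', rfl⟩ : ∃ A' : Finset V, A = A'.map φ := by
      refine ⟨Q.filter (fun q => φ q ∈ A), ?_⟩
      ext z
      simp only [Finset.mem_map, Finset.mem_filter]
      constructor
      · intro hz
        obtain ⟨q, hq, rfl⟩ := Finset.mem_map.1 (hA hz)
        exact ⟨q, ⟨hq, hz⟩, rfl⟩
      · rintro ⟨q, ⟨_, hq⟩, rfl⟩; exact hq
    rw [h2 A' (Finset.map_subset_map.1 hA) (by simpa using hne) (fun a ha b hb hab => by
      have := hcl (φ a) (Finset.mem_map_of_mem _ ha) (φ b) (Finset.mem_map_of_mem _ hb) ((hφ _ _).1 hab)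
      simpa using this)]

def gamG (G : SimpleGraph V) (t : ℕ) (g : V → Prop) : SimpleGraph (V ⊕ Fin t) where
  Adj a b := match a, b with
    | Sum.inl u, Sum.inl v => G.Adj u v
    | Sum.inl u, Sum.inr _ => g u
    | Sum.inr _, Sum.inl v => g v
    | Sum.inr _, Sum.inr _ => False
  symm := ⟨by
    rintro (a | a) (b | b) h
    · exact SimpleGraph.Adj.symm h
    · exact h
    · exact h
    · exact h⟩
  loopless := ⟨by
    rintro (a | a) h
    · exact G.irrefl h
    · exact h⟩

lemma gam_inl {t : ℕ} {g : V → Prop} {Q : Finset (V ⊕ Fin t)} (hQ : Cn (gamG G t g) Q) (h : ∀ j, Sum.inr j ∉ Q) :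
    Cn G Q.toLeft := by
  have e : Q = Q.toLeft.map Function.Embedding.inl := by
    ext (z | z)
    · simp
    · simp [h]
  rw [e] at hQ
  exact (Cn.emb (Function.Embedding.inl) (by intro u v; rfl)).1 hQ

lemma gam [Fintype V] {t : ℕ} {Ω H : Finset V} {e : Fin t → V} (hH : H ⊆ Ω)
    {P : Fin t → Finset V} (hP : ∀ i, P i ⊆ Ω) (hPC : ∀ i, Cn G (P i)) (hPe : ∀ i, ∃ k, e k ∈ P i)
    (hPH : ∀ i, ∃ v ∈ P i, v ∈ H) (hPd : ∀ i j, i ≠ j → Disjoint (P i) (P j))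
    {R : Fin (2 * t) → Finset V} {g : Fin (2 * t) → V} (hR : ∀ i, R i ⊆ Ω) (hRC : ∀ i, Cn G (R i)) (hRg : ∀ i, g i ∈ R i)
    (hRH : ∀ i, ∃ v ∈ R i, v ∈ H) (hRd : ∀ i j, i ≠ j → Disjoint (R i) (R j)) :
    ∃ (Q : Fin t ⊕ Fin t → Finset V) (x : Fin t ⊕ Fin t → V) (i : Fin t → Fin (2 * t)),
      (∀ s, Q s ⊆ Ω) ∧ (∀ s, Cn G (Q s)) ∧ (∀ s, x s ∈ Q s) ∧ (∀ s, x s ∈ H) ∧ (∀ s, ∀ v ∈ Q s, v ∈ H → v = x s) ∧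
      (∀ s s', s ≠ s' → Disjoint (Q s) (Q s')) ∧ (∀ k, e k ∈ Q (Sum.inl k)) ∧ ∀ k, g (i k) ∈ Q (Sum.inr k) := by
  classical
  let Γ := gamG G t (fun v => ∃ i, v = g i)
  let bb : Fin t ⊕ Fin t → V ⊕ Fin t := Sum.map e id
  obtain ⟨Q, q1, q2, q3, q4, q5⟩ := mengerIn Γ (Ω.map Function.Embedding.inl ∪ Finset.univ.map Function.Embedding.inr)
    (H.map Function.Embedding.inl) (Finset.univ.image bb)
    ((Finset.map_subset_map.2 hH).trans Finset.subset_union_left) (2 * t) (by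
      intro X hX
      by_contra hlt
      push Not at hlt
      have hl : X.toLeft.card + X.toRight.card = X.card := Finset.card_toLeft_add_card_toRight
      have find : ∀ {n : ℕ} (F : Fin n → Finset V), (∀ i j, i ≠ j → Disjoint (F i) (F j)) → X.toLeft.card < n →
          ∃ i, ∀ v ∈ F i, Sum.inl v ∉ X := by
        intro n F hF hn
        by_contra hcon
        push Not at hcon
        choose v hv hvX using hcon
        have hinj : Function.Injective v := fun i j hij => by
          by_contra hne
          exact Finset.disjoint_left.1 (hF i j hne) (hv i) (hij ▸ hv j)
        have := Finset.card_le_card (s := Finset.univ.image v) (t := X.toLeft) (fun z hz => by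
          obtain ⟨i, _, rfl⟩ := Finset.mem_image.1 hz
          simpa using hvX i)
        rw [Finset.card_image_of_injective _ hinj, Finset.card_univ, Fintype.card_fin] at this
        omega
      by_cases hr : ∃ j, Sum.inr j ∉ X
      · obtain ⟨j, hj⟩ := hr
        obtain ⟨i, hi⟩ := find R hRd (by omega)
        obtain ⟨v, hv, hvH⟩ := hRH i
        obtain ⟨z, hz, hzX⟩ := hX (insert (Sum.inr j) ((R i).map Function.Embedding.inl))
          (by
            intro z hz
            simp only [Finset.mem_insert, Finset.mem_map, Finset.mem_union] at hz ⊢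
            rcases hz with rfl | ⟨z, hz, rfl⟩
            · right; exact ⟨j, by simp, rfl⟩
            · left; exact ⟨z, hR i hz, rfl⟩)
          (Cn.insert (u := Sum.inl (g i)) ((Cn.emb Function.Embedding.inl (by intro u v; rfl)).2 (hRC i))
            (by simpa using hRg i) ⟨i, rfl⟩)
          ⟨Sum.inl v, by simp [hv], by simpa using hvH⟩
          ⟨Sum.inr j, by simp, Finset.mem_image.2 ⟨Sum.inr j, by simp, rfl⟩⟩
        simp only [Finset.mem_insert, Finset.mem_map] at hz
        rcases hz with rfl | ⟨z, hz, rfl⟩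
        · exact hj hzX
        · exact hi z hz hzX
      · push Not at hr
        have : X.toRight = Finset.univ := by ext j; simp [hr]
        rw [this, Finset.card_univ, Fintype.card_fin] at hl
        obtain ⟨i, hi⟩ := find P hPd (by omega)
        obtain ⟨v, hv, hvH⟩ := hPH i
        obtain ⟨k, hk⟩ := hPe i
        obtain ⟨z, hz, hzX⟩ := hX ((P i).map Function.Embedding.inl)
          ((Finset.map_subset_map.2 (hP i)).trans Finset.subset_union_left)
          ((Cn.emb Function.Embedding.inl (by intro u v; rfl)).2 (hPC i))
          ⟨Sum.inl v, by simp [hv], by simpa using hvH⟩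
          ⟨Sum.inl (e k), by simp [hk], Finset.mem_image.2 ⟨Sum.inl k, by simp, rfl⟩⟩
        obtain ⟨z, hz1, rfl⟩ := Finset.mem_map.1 hz
        exact hi z hz1 hzX)
  have q4' : ∀ i, ∃ c, bb c ∈ Q i := fun i => by
    obtain ⟨b, hb, hb'⟩ := q4 i
    obtain ⟨c, _, rfl⟩ := Finset.mem_image.1 hb'
    exact ⟨c, hb⟩
  choose c hc using q4'
  have hcinj : Function.Injective c := fun i j hij => by
    by_contra hne
    exact Finset.disjoint_left.1 (q5 i j hne) (hc i) (hij ▸ hc j)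
  have hcb : Function.Bijective c := (Fintype.bijective_iff_injective_and_card c).2 ⟨hcinj, by simp; omega⟩
  choose d hd using hcb.2
  have hdd : ∀ s s', s ≠ s' → Disjoint (Q (d s)) (Q (d s')) := fun s s' hne => q5 _ _ fun h => hne (by rw [← hd s, ← hd s', h])
  have hbd : ∀ s, bb s ∈ Q (d s) := fun s => by have := hc (d s); rwa [hd] at this
  -- raw sets
  have raw : ∀ s : Fin t ⊕ Fin t, ∃ Y : Finset V, (∀ v ∈ Y, Sum.inl v ∈ Q (d s)) ∧ Cn G Y ∧ (∃ v ∈ Y, v ∈ H) ∧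
      ∃ v ∈ Y, v ∈ (Sum.elim (fun k => ({e k} : Finset V)) (fun _ => Finset.univ.image g) s) := by
    rintro (k | j)
    · refine ⟨(Q (d (Sum.inl k))).toLeft, by simp, gam_inl (q2 _) (fun j hj => ?_), ?_, e k, ?_, by simp⟩
      · exact Finset.disjoint_left.1 (hdd (Sum.inl k) (Sum.inr j) (by simp)) hj (hbd (Sum.inr j))
      · obtain ⟨a, ha, ha'⟩ := q3 (d (Sum.inl k))
        obtain ⟨v, hv, rfl⟩ := Finset.mem_map.1 ha'
        exact ⟨v, by simpa using ha, hv⟩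
      · simpa [bb] using hbd (Sum.inl k)
    · obtain ⟨a, ha, ha'⟩ := q3 (d (Sum.inr j))
      obtain ⟨v, hv, rfl⟩ := Finset.mem_map.1 ha'
      obtain ⟨Y, hY, c', hc', b', hb', haY, hYC, hcb'⟩ := FH (B := {Sum.inr j}) (q2 (d (Sum.inr j))) ha (by simp)
        (hbd (Sum.inr j)) (by simp [bb])
      have hb2 : b' = Sum.inr j := by simpa using (Finset.mem_inter.1 hb').2
      subst hb2
      have hno : ∀ j', Sum.inr j' ∉ Y := fun j' hj' => by
        have h1 := Finset.mem_sdiff.1 (hY hj')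
        by_cases hjj : j' = j
        · subst hjj; simp at h1
        · exact Finset.disjoint_left.1 (hdd (Sum.inr j) (Sum.inr j') (by simpa using fun h => hjj h.symm)) h1.1 (hbd (Sum.inr j'))
      refine ⟨Y.toLeft, fun v hv => (Finset.mem_sdiff.1 (hY (by simpa using hv))).1, gam_inl hYC hno,
        ⟨v, by simpa using haY, hv⟩, ?_⟩
      rcases c' with u | j'
      · obtain ⟨i, hi⟩ : ∃ i, u = g i := hcb'
        exact ⟨u, by simpa using hc', by simp [hi]⟩
      · exact absurd hc' (hno j')
  choose Y y1 y2 y3 y4 using raw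
  choose Q' z1 x z2 z3 z4 z5 z6 _ using fun s => FHt (y2 s) (y4 s) (y3 s)
  have z5' : ∀ k, ∃ i, g i ∈ Q' (Sum.inr k) := fun k => by
    obtain ⟨v, hv, hv'⟩ := z5 (Sum.inr k)
    obtain ⟨i, _, rfl⟩ := Finset.mem_image.1 hv'
    exact ⟨i, hv⟩
  choose i hi using z5'
  refine ⟨Q', x, i, fun s v hv => ?_, z3, z2, z4, z6, fun s s' hne => ?_, fun k => ?_, hi⟩
  · have := q1 _ (y1 s v (z1 s hv))
    simpa using this
  · rw [Finset.disjoint_left]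
    intro v hv hv'
    exact Finset.disjoint_left.1 (hdd s s' hne) (y1 s v (z1 s hv)) (y1 s' v (z1 s' hv'))
  · obtain ⟨v, hv, hv'⟩ := z5 (Sum.inl k)
    have : v = e k := by simpa using hv'
    exact this ▸ hv
end gam
end CD

namespace CD
section lemA
variable {V : Type} [DecidableEq V] {G : SimpleGraph V} {κ : Type} [DecidableEq κ]

structure StA (G : SimpleGraph V) (J0 : Finset V) (k q t h : ℕ) (β : Fin t → κ) (st : Finset (κ × κ)) (J : Finset V)
    (T : Fin t → Finset V) (e : Fin t → V) (Hs : Finset V) : Prop where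
  sub : J ⊆ J0
  kc : kc G k J
  nc : ¬ Col G J q
  cn : ∀ i, Cn G (T i)
  dj : ∀ i j, i ≠ j → Disjoint (T i) (T j)
  eT : ∀ i, e i ∈ T i
  eJ : ∀ i, e i ∈ J
  ue : ∀ i, ∀ v ∈ T i, v ∈ J → v = e i
  hs : Hs.card ≤ st.card * h
  cov : ∀ p ∈ st, ∀ i j, i ≠ j → (β i = p.1 ∨ β i = p.2) → (β j = p.1 ∨ β j = p.2) → Adjs G (T i ∩ Hs) (T j ∩ Hs)

set_option maxHeartbeats 1000000 in
lemma stepA [Fintype V] {J0 : Finset V} {k N t h a m d0 r : ℕ} {β : Fin t → κ} {st : Finset (κ × κ)} {J : Finset V}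
    {T : Fin t → Finset V} {e : Fin t → V} {Hs : Finset V} (hst : StA G J0 k (N + 2 * t) t h β st J T e Hs)
    (p : κ × κ) (hp : p ∉ st) (hr : st.card + 1 ≤ r) (hk1 : 1 ≤ k)
    (hk : 2 * t ≤ k) (hkN : k ≤ N) (hdN : d0 ≤ N) (hβ : (Finset.univ.filter fun i => β i = p.1 ∨ β i = p.2).card ≤ a)
    (hpc : ∀ S, ¬ Col G S d0 → ∃ H ⊆ S, 2 * t ≤ H.card ∧ H.card ≤ h ∧ Wov G H a t)
    (hsm : ∀ S : Finset V, S.card ≤ r * h + 3 * t → Col G S m)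
    (hJ0 : ¬ Col G J0 (N + (6 * t + m + 5 * k)))
    (hins : ∀ J1 ⊆ J0, ∀ J2 ⊆ J0, ¬ Col G J1 N → ¬ Col G J2 N → ¬ Disjoint J1 J2) :
    ∃ J T e Hs, StA G J0 k (N + 2 * t) t h β (insert p st) J T e Hs := by
  classical
  have einj : Function.Injective e := fun i j hij => by
    by_contra hne
    exact Finset.disjoint_left.1 (hst.dj i j hne) (hst.eT i) (hij ▸ hst.eT j)
  have ncol : ∀ (J Y : Finset V), ¬ Col G J (N + 2 * t) → Y.card ≤ 2 * t → ¬ Col G (J \ Y) N := fun J Y h1 h2 h3 => by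
    refine h1 ((h3.union (Col.card Y)).mono (fun z hz => ?_) (by omega))
    by_cases z ∈ Y <;> simp [*]
  obtain ⟨T', p1, p2, p3, p4, Z, hZ, hZc⟩ := prune_fam (F := fun i => T i ∩ Hs) hst.cn hst.eT (fun i => Finset.inter_subset_left)
  have hsum : ∑ i, (T i ∩ Hs).card ≤ Hs.card := by
    rw [← Finset.card_biUnion]
    · exact Finset.card_le_card (Finset.biUnion_subset.2 fun i _ => Finset.inter_subset_right)
    · intro i _ j _ hij
      exact (hst.dj i j hij).mono Finset.inter_subset_left Finset.inter_subset_left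
  have hEc : (Finset.univ.image e).card = t := by
    rw [Finset.card_image_of_injective _ einj, Finset.card_univ, Fintype.card_fin]
  obtain ⟨H, hHJ, hH1, hH2, hW⟩ := hpc (J \ Finset.univ.image e) (fun h => ncol J _ hst.nc (by omega)
    (h.mono (Finset.Subset.refl _) hdN))
  have hHJ' : H ⊆ J := fun z hz => (Finset.mem_sdiff.1 (hHJ hz)).1
  have heH : ∀ i, e i ∉ H := fun i hi => (Finset.mem_sdiff.1 (hHJ hi)).2 (by simp)
  obtain ⟨P, a1, a2, a3, a4, a5⟩ := hst.kc.menger (m := t) (A := Finset.univ.image e) (B := H)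
    (fun z hz => by obtain ⟨i, _, rfl⟩ := Finset.mem_image.1 hz; exact hst.eJ i) hHJ' (by omega) (by omega) (by omega)
  choose eP b1 b2 using a3
  choose hP b3 b4 using a4
  obtain ⟨P', c1, c2, c3, c4, Z2, hZ2, hZc2⟩ := prune_fam (F := fun i => {hP i}) a2 b1 (fun i => by simpa using b3 i)
  have c4 : ∀ i, hP i ∈ P' i := fun i => c4 i (by simp)
  set stuff := Finset.univ.biUnion T' ∪ Finset.univ.biUnion P' ∪ H with hstuff
  have hcs : Col G stuff (2 * t + 2 * t + m) := by
    refine ((hZc.union hZc2).union (hsm (Z ∪ Z2 ∪ H) ?_)).mono (fun z hz => ?_) le_rfl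
    · have h1 := Finset.card_union_le (Z ∪ Z2) H
      have h2 := Finset.card_union_le Z Z2
      have h3 := hst.hs
      have h4 : (st.card + 1) * h ≤ r * h := Nat.mul_le_mul_right _ hr
      rw [Nat.succ_mul] at h4
      simp at hZ2
      omega
    · simp only [hstuff, Finset.mem_union, Finset.mem_sdiff] at hz ⊢
      tauto
  obtain ⟨J', hJ', hkc', hnc'⟩ := GN (G := G) (k := k) (q := N + 2 * t) (S := J0 \ stuff) hk1 (by omega) (fun hc => hJ0 (by
    refine (hc.union hcs).mono (fun z hz => ?_) (by omega)
    by_cases z ∈ stuff <;> simp [*]))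
  have hJ'0 : J' ⊆ J0 := fun z hz => (Finset.mem_sdiff.1 (hJ' hz)).1
  have hJ's : ∀ z ∈ J', z ∉ stuff := fun z hz => (Finset.mem_sdiff.1 (hJ' hz)).2
  have sT : ∀ i, ∀ z ∈ T' i, z ∈ stuff := fun i z hz => by
    simp only [hstuff, Finset.mem_union, Finset.mem_biUnion, Finset.mem_univ, true_and]; exact Or.inl (Or.inl ⟨i, hz⟩)
  have sP : ∀ i, ∀ z ∈ P' i, z ∈ stuff := fun i z hz => by
    simp only [hstuff, Finset.mem_union, Finset.mem_biUnion, Finset.mem_univ, true_and]; exact Or.inl (Or.inr ⟨i, hz⟩)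
  have sH : ∀ z ∈ H, z ∈ stuff := fun z hz => Finset.mem_union_right _ hz
  -- links from H to J'
  obtain ⟨R, r1, r2, r3, r4, r5⟩ := mengerIn G (J ∪ J') H J' (hHJ'.trans Finset.subset_union_left) (2 * t) (by
    intro Y hY
    by_contra hlt
    push Not at hlt
    have n1 := hins (J \ Y) (Finset.sdiff_subset.trans hst.sub) (J' \ Y) (Finset.sdiff_subset.trans hJ'0)
      (ncol J Y hst.nc hlt.le) (ncol J' Y hnc' hlt.le)
    obtain ⟨z, hz1, hz2⟩ := Finset.not_disjoint_iff.1 n1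
    have hC := (hst.kc.2 Y (by omega)).union_inter (hkc'.2 Y (by omega)) hz1 hz2
    obtain ⟨v, hv, hvY⟩ := exists_notMem_of_card_lt (S := Y) (T := H) (by omega)
    obtain ⟨w, hw, hwY⟩ := exists_notMem_of_card_lt (S := Y) (T := J') (by have := hkc'.1; omega)
    obtain ⟨x, hx, hxY⟩ := hY _ (Finset.union_subset_union Finset.sdiff_subset Finset.sdiff_subset) hC
      ⟨v, by simp [hHJ' hv, hvY], hv⟩ ⟨w, by simp [hw, hwY], hw⟩
    simp [hxY] at hx)
  choose ra ra1 ra2 using r3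
  choose rb rb1 rb2 using r4
  choose R' R'1 g gR f f1 raR' R'C gf using fun i => FH (B := J') (r2 i) (ra1 i) (fun h => hJ's _ h (sH _ (ra2 i))) (rb1 i) (rb2 i)
  have f1' : ∀ i, f i ∈ R i ∧ f i ∈ J' := fun i => Finset.mem_inter.1 (f1 i)
  have R'R : ∀ i, ∀ z ∈ R' i, z ∈ R i ∧ z ∉ J' := fun i z hz => Finset.mem_sdiff.1 (R'1 i hz)
  obtain ⟨Q, x, ii, q1, q2, q3, q4, q5, q6, q7, q8⟩ := gam (G := G) (Ω := J \ J') (H := H) (e := e) (P := P') (R := R') (g := g)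
    (fun z hz => Finset.mem_sdiff.2 ⟨hHJ' hz, fun h => hJ's z h (sH z hz)⟩)
    (fun i z hz => Finset.mem_sdiff.2 ⟨a1 i (c1 i hz), fun h => hJ's z h (sP i z hz)⟩) c2
    (fun i => by
      obtain ⟨k, _, hk⟩ := Finset.mem_image.1 (b2 i)
      exact ⟨k, hk ▸ c3 i⟩) (fun i => ⟨hP i, c4 i, b4 i⟩)
    (fun i j hij => (a5 i j hij).mono (c1 i) (c1 j))
    (fun i z hz => by
      have h1 := R'R i z hz
      have h2 := r1 i h1.1
      simp only [Finset.mem_union, Finset.mem_sdiff] at h2 ⊢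
      tauto) R'C gR (fun i => ⟨ra i, raR' i, ra2 i⟩)
    (fun i j hij => (r5 i j hij).mono (fun z hz => (R'R i z hz).1) (fun z hz => (R'R j z hz).1))
  have iinj : Function.Injective ii := fun i j hij => by
    by_contra hne
    exact Finset.disjoint_left.1 (q6 (Sum.inr i) (Sum.inr j) (by simpa using hne)) (q8 i) (hij ▸ q8 j)
  have finj : ∀ i j, i ≠ j → f (ii i) ≠ f (ii j) := fun i j hne hij => by
    exact Finset.disjoint_left.1 (r5 (ii i) (ii j) (fun h => hne (iinj h))) (f1' _).1 (hij ▸ (f1' _).1)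
  have xne : ∀ s s', s ≠ s' → x s ≠ x s' := fun s s' hne h =>
    Finset.disjoint_left.1 (q6 s s' hne) (q3 s) (h ▸ q3 s')
  obtain ⟨B, B1, B2, B3, B4, B5, B6⟩ := hW (Fin t) (fun i => x (Sum.inl i)) (fun i => x (Sum.inr i))
    (Finset.univ.filter fun i => β i = p.1 ∨ β i = p.2) (by simp) hβ (fun i => q4 _) (fun i => q4 _)
    (fun i j hij => ⟨xne _ _ (by simpa using hij), xne _ _ (by simpa using hij), xne _ _ (by simp)⟩)
  have QJ : ∀ s, ∀ v ∈ Q s, v ∈ J ∧ v ∉ J' := fun s v hv => Finset.mem_sdiff.1 (q1 s hv)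
  have QT : ∀ s i, ∀ v ∈ Q s, v ∈ T' i → s = Sum.inl i := fun s i v hv hvT => by
    have := hst.ue i v (p1 i hvT) (QJ s v hv).1
    subst this
    by_contra hne
    exact Finset.disjoint_left.1 (q6 s (Sum.inl i) hne) hv (q7 i)
  have BT : ∀ i j, ∀ v ∈ B i, v ∉ T' j := fun i j v hv hvT => by
    have := hst.ue j v (p1 j hvT) (hHJ' (B1 i hv))
    subst this
    exact heH j (B1 i hv)
  have BQ : ∀ i, ∀ v ∈ B i, ∀ s, v ∈ Q s → s = Sum.inl i ∨ s = Sum.inr i := fun i v hv s hs => by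
    have h1 := q5 s v hs (B1 i hv)
    subst h1
    by_contra hne
    push Not at hne
    rcases s with j | j
    · exact Finset.disjoint_left.1 (B3 i j (fun h => hne.1 (by rw [h]))) hv (B4 j)
    · exact Finset.disjoint_left.1 (B3 i j (fun h => hne.2 (by rw [h]))) hv (B5 j)
  let T2 : Fin t → Finset V := fun i => insert (f (ii i)) (((T' i ∪ Q (Sum.inl i)) ∪ B i) ∪ Q (Sum.inr i))
  have hT2 : ∀ i v, v ∈ T2 i ↔ v = f (ii i) ∨ v ∈ T' i ∨ v ∈ Q (Sum.inl i) ∨ v ∈ B i ∨ v ∈ Q (Sum.inr i) := fun i v => by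
    simp only [T2, Finset.mem_insert, Finset.mem_union, or_assoc]
  have oldJ' : ∀ i v, (v ∈ T' i ∨ v ∈ Q (Sum.inl i) ∨ v ∈ B i ∨ v ∈ Q (Sum.inr i)) → v ∉ J' := fun i v hv hvJ => by
    rcases hv with h | h | h | h
    · exact hJ's v hvJ (sT i v h)
    · exact (QJ _ _ h).2 hvJ
    · exact hJ's v hvJ (sH v (B1 i h))
    · exact (QJ _ _ h).2 hvJ
  have old_dj : ∀ i j, i ≠ j → ∀ v, (v ∈ T' i ∨ v ∈ Q (Sum.inl i) ∨ v ∈ B i ∨ v ∈ Q (Sum.inr i)) →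
      (v ∈ T' j ∨ v ∈ Q (Sum.inl j) ∨ v ∈ B j ∨ v ∈ Q (Sum.inr j)) → False := by
    intro i j hij v hi hj
    have QQ : ∀ s s', s ≠ s' → v ∈ Q s → v ∈ Q s' → False := fun s s' hne h h' => Finset.disjoint_left.1 (q6 s s' hne) h h'
    rcases hi with h | h | h | h <;> rcases hj with h' | h' | h' | h'
    · exact Finset.disjoint_left.1 (hst.dj i j hij) (p1 i h) (p1 j h')
    · have := QT _ _ v h' h; simp at this; exact hij this.symm
    · exact BT _ _ _ h' h
    · have := QT _ _ v h' h; simp at this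
    · have := QT _ _ v h h'; simp at this; exact hij this
    · exact QQ _ _ (by simpa using hij) h h'
    · have := BQ _ _ h' _ h; simp at this; exact hij this
    · exact QQ _ _ (by simp) h h'
    · exact BT _ _ _ h h'
    · have := BQ _ _ h _ h'; simp at this; exact hij this.symm
    · exact Finset.disjoint_left.1 (B3 i j hij) h h'
    · have := BQ _ _ h _ h'; simp at this; exact hij this.symm
    · have := QT _ _ v h h'; simp at this
    · exact QQ _ _ (by simp) h h'
    · have := BQ _ _ h' _ h; simp at this; exact hij this
    · exact QQ _ _ (by simpa using hij) h h'
  refine ⟨J', T2, fun i => f (ii i), Hs ∪ H, hJ'0, hkc', hnc', fun i => ?_, fun i j hij => ?_, fun i => by simp [T2],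
    fun i => (f1' _).2, fun i v hv hvJ => ?_, ?_, fun p' hp' i j hij hi hj => ?_⟩
  · refine Cn.insert (u := g (ii i)) ?_ (Finset.mem_union_right _ (q8 i)) (gf _)
    refine Cn.union_inter (Cn.union_inter (Cn.union_inter (p2 i) (q2 _) (p3 i) (q7 i)) (B2 i)
      (Finset.mem_union_right _ (q3 _)) (B4 i)) (q2 _) (Finset.mem_union_right _ (B5 i)) (q3 _)
  · rw [Finset.disjoint_left]
    intro v hv hv'
    rw [hT2] at hv hv'
    rcases hv with rfl | hv
    · rcases hv' with h | hv'
      · exact finj i j hij h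
      · exact oldJ' j _ hv' (f1' _).2
    · rcases hv' with rfl | hv'
      · exact oldJ' i _ hv (f1' _).2
      · exact old_dj i j hij v hv hv'
  · rw [hT2] at hv
    rcases hv with h | hv
    · exact h
    · exact absurd hvJ (oldJ' i v hv)
  · rw [Finset.card_insert_of_notMem hp, Nat.succ_mul]
    have := Finset.card_union_le Hs H
    have := hst.hs
    omega
  · rcases Finset.mem_insert.1 hp' with rfl | hp'
    · refine (B6 i j hij (by simpa using hi) (by simpa using hj)).mono ?_ ?_ <;>
      · intro v hv
        rw [Finset.mem_inter, hT2, Finset.mem_union]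
        exact ⟨Or.inr (Or.inr (Or.inr (Or.inl hv))), Or.inr (B1 _ hv)⟩
    · refine (hst.cov p' hp' i j hij hi hj).mono ?_ ?_ <;>
      · intro v hv
        have h1 := p4 _ hv
        rw [Finset.mem_inter] at hv
        rw [Finset.mem_inter, hT2, Finset.mem_union]
        exact ⟨Or.inr (Or.inl h1), Or.inl hv.2⟩

theorem lemA [Fintype V] [Fintype κ] {J0 : Finset V} {k N t h a m d0 : ℕ} {β : Fin t → κ}
    (hk1 : 1 ≤ k) (hk : 2 * t ≤ k) (hkN : k ≤ N) (hdN : d0 ≤ N)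
    (hβ : ∀ p : κ × κ, (Finset.univ.filter fun i => β i = p.1 ∨ β i = p.2).card ≤ a)
    (hpc : ∀ S, ¬ Col G S d0 → ∃ H ⊆ S, 2 * t ≤ H.card ∧ H.card ≤ h ∧ Wov G H a t)
    (hsm : ∀ S : Finset V, S.card ≤ Fintype.card (κ × κ) * h + 3 * t → Col G S m)
    (hKM : ¬ KM G Finset.univ t)
    (hJ0 : ¬ Col G J0 (N + (6 * t + m + 5 * k))) :
    ∃ J1 ⊆ J0, ∃ J2 ⊆ J0, ¬ Col G J1 N ∧ ¬ Col G J2 N ∧ Disjoint J1 J2 := by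
  classical
  by_contra hcon
  push Not at hcon
  have main : ∀ st : Finset (κ × κ), ∃ J T e Hs, StA G J0 k (N + 2 * t) t h β st J T e Hs := by
    intro st
    induction st using Finset.induction_on with
    | empty =>
      obtain ⟨J, hJ, hkc, hnc⟩ := GN (G := G) (k := k) (q := N + 2 * t) (S := J0) hk1 (by omega) (fun hc => hJ0
        (hc.mono (Finset.Subset.refl _) (by omega)))
      obtain ⟨e, e1, e2⟩ := list_lemma' (ι := Fin t) (fun _ => J) (fun i => by have := hkc.1; simp; omega)
      exact ⟨J, fun i => {e i}, e, ∅, hJ, hkc, hnc, fun i => Cn.singleton _, fun i j hij => by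
        simpa using fun h => hij (e2 h), by simp, e1, by simp, by simp, by simp⟩
    | insert p st hp ih =>
      obtain ⟨J, T, e, Hs, hst⟩ := ih
      exact stepA hst p hp (by rw [← Finset.card_insert_of_notMem hp]; exact Finset.card_le_univ _) hk1 hk hkN hdN (hβ p) hpc hsm hJ0
        (fun J1 h1 J2 h2 => hcon J1 h1 J2 h2)
  obtain ⟨J, T, e, Hs, hst⟩ := main Finset.univ
  exact hKM ⟨T, by simp, hst.cn, hst.dj, fun i j hij => (hst.cov (β i, β j) (by simp) i j hij (by simp) (by simp)).mono
    Finset.inter_subset_left Finset.inter_subset_left⟩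
end lemA
end CD

namespace CD
section lemB
variable {V : Type} [DecidableEq V] {G : SimpleGraph V} {κ : Type} [DecidableEq κ]

lemma shortcut (ch : V → Option κ) (y : V) : ∀ (n : ℕ) (Q : Finset V) (x : V), Q.card ≤ n → Cn G Q → x ∈ Q → y ∈ Q →
    ∃ O ⊆ Q, ∃ (D : Finset κ) (u v : κ → V), (∀ o ∈ O, ch o = none) ∧
      (∀ i ∈ D, u i ∈ Q ∧ v i ∈ Q ∧ ch (u i) = some i ∧ ch (v i) = some i) ∧ (∀ i, ch y = some i → i ∈ D) ∧
      ∀ B : κ → Finset V, (∀ i ∈ D, Cn G (B i) ∧ u i ∈ B i ∧ v i ∈ B i) →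
        Cn G (O ∪ D.biUnion B) ∧ x ∈ O ∪ D.biUnion B ∧ y ∈ O ∪ D.biUnion B := by
  classical
  intro n
  induction n with
  | zero =>
    intro Q x hQ _ hx
    rw [Nat.le_zero, Finset.card_eq_zero] at hQ; simp [hQ] at hx
  | succ n ih =>
    intro Q x hQ hQC hx hy
    rcases hchx : ch x with _ | i
    · by_cases hxy : y = x
      · subst hxy
        exact ⟨{y}, by simpa using hy, ∅, fun _ => y, fun _ => y, by simpa using hchx, by simp, by simp [hchx], fun B _ => by
          simpa using Cn.singleton y⟩
      obtain ⟨Y, hY, c, hc, b, hb, hyY, hYC, hcb⟩ := FH (B := {x}) hQC hy (by simpa using hxy) hx (by simp)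
      have hb : b = x := by simpa using (Finset.mem_inter.1 hb).2
      subst hb
      have hYQ : Y ⊆ Q := fun z hz => (Finset.mem_sdiff.1 (hY hz)).1
      have hbY : b ∉ Y := fun h => by have := (Finset.mem_sdiff.1 (hY h)).2; simp at this
      have hlt := Finset.card_lt_card (Finset.ssubset_iff_of_subset hYQ |>.2 ⟨b, hx, hbY⟩)
      obtain ⟨O, hO, D, u, v, h1, h2, h3, h4⟩ := ih Y c (by omega) hYC hc hyY
      refine ⟨insert b O, Finset.insert_subset hx (hO.trans hYQ), D, u, v, ?_, ?_, h3, fun B hB => ?_⟩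
      · intro o ho
        rcases Finset.mem_insert.1 ho with rfl | ho
        · exact hchx
        · exact h1 o ho
      · intro i hi
        have := h2 i hi
        exact ⟨hYQ this.1, hYQ this.2.1, this.2.2⟩
      · obtain ⟨j1, j2, j3⟩ := h4 B hB
        rw [Finset.insert_union]
        exact ⟨j1.insert j2 hcb, by simp, Finset.mem_insert_of_mem j3⟩
    · by_cases hyi : ch y = some i
      · refine ⟨∅, by simp, {i}, fun _ => x, fun _ => y, by simp, by simp [hx, hy, hchx, hyi], ?_, fun B hB => ?_⟩
        · intro j hj; rw [hyi] at hj; simp at hj; simp [hj]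
        · simpa using hB i (by simp)
      obtain ⟨Y, hY, c, hc, b, hb, hyY, hYC, hcb⟩ := FH (B := Q.filter (fun z => ch z = some i)) hQC hy (by simp [hyi]) hx (by simp [hx, hchx])
      have hbQ : b ∈ Q ∧ ch b = some i := by simpa using hb
      have hYQ : Y ⊆ Q := fun z hz => (Finset.mem_sdiff.1 (hY hz)).1
      have hYi : ∀ z ∈ Y, ch z ≠ some i := fun z hz h => by
        have := (Finset.mem_sdiff.1 (hY hz)).2
        simp [hYQ hz, h] at this
      have hlt := Finset.card_lt_card (Finset.ssubset_iff_of_subset hYQ |>.2 ⟨x, hx, fun h => hYi x h hchx⟩)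
      obtain ⟨O, hO, D, u, v, h1, h2, h3, h4⟩ := ih Y c (by omega) hYC hc hyY
      have hiD : i ∉ D := fun hi => hYi _ (h2 i hi).1 (h2 i hi).2.2.1
      have hne : ∀ j ∈ D, j ≠ i := fun j hj h => hiD (h ▸ hj)
      refine ⟨O, hO.trans hYQ, insert i D, Function.update u i x, Function.update v i b, h1, ?_, ?_, fun B hB => ?_⟩
      · intro j hj
        rcases Finset.mem_insert.1 hj with rfl | hj
        · simp [hx, hbQ, hchx]
        · have := h2 j hj
          simp only [Function.update_of_ne (hne j hj)]
          exact ⟨hYQ this.1, hYQ this.2.1, this.2.2⟩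
      · intro j hj; exact Finset.mem_insert_of_mem (h3 j hj)
      · obtain ⟨j1, j2, j3⟩ := h4 B (fun j hj => by
          have := hB j (Finset.mem_insert_of_mem hj)
          simpa only [Function.update_of_ne (hne j hj)] using this)
        have hBi := hB i (by simp)
        simp only [Function.update_self] at hBi
        have e : O ∪ (insert i D).biUnion B = (O ∪ D.biUnion B) ∪ B i := by
          rw [Finset.biUnion_insert, Finset.union_comm (B i), Finset.union_assoc]
        rw [e]
        exact ⟨j1.union hBi.1 j2 hBi.2.2 (Or.inr hcb), Finset.mem_union_right _ hBi.2.1, Finset.mem_union_left _ j3⟩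

lemma blocks {ι : Type} [DecidableEq ι] [Fintype κ] [Nonempty κ] (A : Finset ι) (a : ℕ) (h : A.card ≤ Fintype.card κ * a) :
    ∃ β : ι → κ, ∀ c, (A.filter (fun k => β k = c)).card ≤ a := by
  classical
  obtain ⟨φ⟩ := Function.Embedding.nonempty_of_card_le (α := A) (β := κ × Fin a) (by simpa using h)
  refine ⟨fun k => if h : k ∈ A then (φ ⟨k, h⟩).1 else Classical.arbitrary κ, fun c => ?_⟩
  have := Finset.card_le_card_of_injOn (s := (A.filter (fun k => (if h : k ∈ A then (φ ⟨k, h⟩).1 else Classical.arbitrary κ) = c)).attach)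
    (t := (Finset.univ : Finset (Fin a))) (fun k => (φ ⟨k.1, (Finset.mem_filter.1 k.2).1⟩).2) (by simp) (by
      intro k _ l _ hkl
      have hk := Finset.mem_filter.1 k.2
      have hl := Finset.mem_filter.1 l.2
      have e1 : (φ ⟨k.1, hk.1⟩).1 = c := by have := hk.2; rwa [dif_pos hk.1] at this
      have e2 : (φ ⟨l.1, hl.1⟩).1 = c := by have := hl.2; rwa [dif_pos hl.1] at this
      have := φ.injective (Prod.ext (e1.trans e2.symm) hkl)
      exact Subtype.ext (by simpa using this))
  simpa using this

lemma Cn.star {ι : Type*} [DecidableEq ι] {S : Finset V} {F : ι → Finset V} (hS : Cn G S) (s : Finset ι)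
    (hF : ∀ i ∈ s, Cn G (F i)) (hA : ∀ i ∈ s, Adjs G S (F i)) : Cn G (S ∪ s.biUnion F) := by
  induction s using Finset.induction_on with
  | empty => simpa using hS
  | insert i s hi ih =>
    have e : S ∪ (Insert.insert i s).biUnion F = (S ∪ s.biUnion F) ∪ F i := by
      rw [Finset.biUnion_insert, Finset.union_comm (F i), Finset.union_assoc]
    obtain ⟨u, hu, v, hv, huv⟩ := hA i (by simp)
    rw [e]
    exact (ih (fun j hj => hF j (by simp [hj])) (fun j hj => hA j (by simp [hj]))).union (hF i (by simp))
      (Finset.mem_union_left _ hu) hv (Or.inr huv)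

set_option maxHeartbeats 1000000 in
theorem lemB [Fintype κ] (hκ : Fintype.card κ = 4) {J : Finset V} {T n a : ℕ} (hT : n + 32 * a ≤ T) {C : κ × κ → Finset V}
    (hCJ : ∀ j, C j ⊆ J) (hCd : ∀ i j, i ≠ j → Disjoint (C i) (C j)) (hCc : ∀ j, 2 * T ≤ (C j).card)
    (hCW : ∀ j, Wov G (C j) (2 * a) T) (hJ : kc G (2 * T) J) (hJW : Wov G J 0 T) : Wov G J (4 * a) n := by
  classical
  intro ι _ x y A hι hA hx hy hxy
  haveI : Nonempty κ := Fintype.card_pos_iff.1 (by omega)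
  obtain ⟨β, hβ⟩ := blocks (κ := κ) A a (by rw [hκ]; exact hA)
  let Aj : κ × κ → Finset ι := fun j => A.filter (fun k => β k = j.1 ∨ β k = j.2)
  have hAj : ∀ j, (Aj j).card ≤ 2 * a := fun j => by
    have e : Aj j = A.filter (fun k => β k = j.1) ∪ A.filter (fun k => β k = j.2) := by
      simp only [Aj, Finset.filter_or]
    rw [e]
    have := Finset.card_union_le (A.filter (fun k => β k = j.1)) (A.filter (fun k => β k = j.2))
    have := hβ j.1
    have := hβ j.2
    omega
  let ε := Σ j : κ × κ, (Aj j)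
  have hε : Fintype.card ε ≤ 32 * a := by
    rw [Fintype.card_sigma]
    refine (Finset.sum_le_sum (g := fun _ => 2 * a) fun j _ => by simpa using hAj j).trans ?_
    simp [hκ]; omega
  set XY := Finset.univ.image x ∪ Finset.univ.image y with hXY
  have hXYc : XY.card ≤ 2 * n := by
    have h1 := Finset.card_union_le (Finset.univ.image x) (Finset.univ.image y)
    have h2 := Finset.card_image_le (s := Finset.univ) (f := x)
    have h3 := Finset.card_image_le (s := Finset.univ) (f := y)
    rw [Finset.card_univ] at h2 h3
    rw [hXY]
    omega
  have xXY : ∀ k, x k ∈ XY := fun k => by simp [hXY]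
  have yXY : ∀ k, y k ∈ XY := fun k => by simp [hXY]
  obtain ⟨u, u1, u2⟩ := list_lemma' (ι := ε) (fun p => nb G J (x p.2) \ XY) (fun p => by
    have h1 := Finset.le_card_sdiff XY (nb G J (x p.2))
    have h2 := hJ.deg (hx p.2)
    omega)
  have u1' : ∀ p, u p ∈ J ∧ G.Adj (x p.2) (u p) ∧ u p ∉ XY := fun p => by
    have := u1 p
    rw [Finset.mem_sdiff, mem_nb] at this
    tauto
  have huc : (Finset.univ.image u).card ≤ 32 * a := by
    have h2 := Finset.card_image_le (s := Finset.univ) (f := u)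
    rw [Finset.card_univ] at h2
    omega
  obtain ⟨z, z1, z2⟩ := list_lemma' (ι := ε) (fun p => C p.1 \ (XY ∪ Finset.univ.image u)) (fun p => by
    have h1 := Finset.le_card_sdiff (XY ∪ Finset.univ.image u) (C p.1)
    have h2 := hCc p.1
    have h3 := Finset.card_union_le XY (Finset.univ.image u)
    omega)
  have z1' : ∀ p, z p ∈ C p.1 ∧ z p ∉ XY ∧ ∀ q, u q ≠ z p := fun p => by
    have := z1 p
    simp only [Finset.mem_sdiff, Finset.mem_union, Finset.mem_image, Finset.mem_univ, true_and, not_or, not_exists] at this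
    tauto
  let X : ι ⊕ ε → V := Sum.elim x u
  let Y : ι ⊕ ε → V := Sum.elim y z
  obtain ⟨Q, q1, q2, q3, q4, q5, _⟩ := hJW (ι ⊕ ε) X Y ∅ (by rw [Fintype.card_sum]; omega) (by simp)
    (by rintro (k | p); exacts [hx k, (u1' p).1]) (by rintro (k | p); exacts [hy k, hCJ _ (z1' p).1])
    (by
      rintro (k | p) (l | q) hne
      · exact hxy k l (by simpa using hne)
      · refine ⟨fun h => (u1' q).2.2 ?_, fun h => (z1' q).2.1 ?_, fun h => (z1' q).2.1 ?_⟩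
        · rw [show u q = x k from h.symm]; exact xXY k
        · rw [show z q = y k from h.symm]; exact yXY k
        · rw [show z q = x k from h.symm]; exact xXY k
      · refine ⟨fun h => (u1' p).2.2 ?_, fun h => (z1' p).2.1 ?_, fun h => (u1' p).2.2 ?_⟩
        · rw [show u p = x l from h]; exact xXY l
        · rw [show z p = y l from h]; exact yXY l
        · rw [show u p = y l from h]; exact yXY l
      · have hne' : p ≠ q := by simpa using hne
        exact ⟨fun h => hne' (u2 h), fun h => hne' (z2 h), (z1' q).2.2 p⟩)
  let ch : V → Option (κ × κ) := fun v => if h : ∃ j, v ∈ C j then some h.choose else none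
  have ch1 : ∀ v j, ch v = some j ↔ v ∈ C j := fun v j => by
    by_cases h : ∃ j, v ∈ C j
    · simp only [ch, h, dite_true, Option.some.injEq]
      constructor
      · rintro rfl; exact h.choose_spec
      · intro hj
        by_contra hne
        exact Finset.disjoint_left.1 (hCd _ _ hne) h.choose_spec hj
    · simp only [ch, h, dite_false]
      simp only [not_exists] at h
      simp [h j]
  have ch0 : ∀ v, ch v = none → ∀ j, v ∉ C j := fun v hv j hj => by
    rw [(ch1 v j).2 hj] at hv; simp at hv
  choose O o1 D du dv o2 d1 d2 d3 using fun s => shortcut (G := G) ch (Y s) _ (Q s) (X s) le_rfl (q2 s) (q4 s) (q5 s)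
  have Qne : ∀ s s', s ≠ s' → ∀ v w, v ∈ Q s → w ∈ Q s' → v ≠ w := fun s s' hne v w hv hw h =>
    Finset.disjoint_left.1 (q3 s s' hne) hv (h ▸ hw)
  have chW : ∀ j, Rlz G (C j) (fun s : {s // j ∈ D s} => du s.1 j) (fun s => dv s.1 j)
      (· ∈ Finset.univ.filter (fun s : {s // j ∈ D s} => ∃ k, s.1 = Sum.inr ⟨j, k⟩)) := fun j => by
    refine hCW j _ _ _ _ ?_ ?_ (fun s => (ch1 _ _).1 (d1 s.1 j s.2).2.2.1) (fun s => (ch1 _ _).1 (d1 s.1 j s.2).2.2.2) ?_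
    · have := Fintype.card_subtype_le (fun s : ι ⊕ ε => j ∈ D s)
      rw [Fintype.card_sum] at this
      omega
    · rw [← Finset.card_image_of_injective _ (Subtype.val_injective (p := fun s : ι ⊕ ε => j ∈ D s))]
      refine (Finset.card_le_card (t := Finset.univ.image (fun k : Aj j => (Sum.inr ⟨j, k⟩ : ι ⊕ ε))) ?_).trans ?_
      · intro s hs
        obtain ⟨s, hs1, rfl⟩ := Finset.mem_image.1 hs
        obtain ⟨k, hk⟩ := (Finset.mem_filter.1 hs1).2
        exact Finset.mem_image.2 ⟨k, by simp, hk.symm⟩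
      · refine Finset.card_image_le.trans ?_
        simpa using hAj j
    · intro s s' hne
      have hne' : s.1 ≠ s'.1 := fun h => hne (Subtype.ext h)
      have a1 := d1 s.1 j s.2
      have a2 := d1 s'.1 j s'.2
      exact ⟨Qne _ _ hne' _ _ a1.1 a2.1, Qne _ _ hne' _ _ a1.2.1 a2.2.1, Qne _ _ hne' _ _ a1.1 a2.2.1⟩
  choose B b1 b2 b3 b4 b5 b6 using chW
  let BB : ι ⊕ ε → κ × κ → Finset V := fun s j => if h : j ∈ D s then B j ⟨s, h⟩ else ∅
  have hBB : ∀ s j (h : j ∈ D s), BB s j = B j ⟨s, h⟩ := fun s j h => by simp [BB, h]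
  have BBC : ∀ s j, ∀ v ∈ BB s j, v ∈ C j := fun s j v hv => by
    by_cases h : j ∈ D s
    · rw [hBB s j h] at hv; exact b1 j _ hv
    · simp [BB, h] at hv
  let Q' : ι ⊕ ε → Finset V := fun s => O s ∪ (D s).biUnion (BB s)
  have hQ' : ∀ s v, v ∈ Q' s ↔ v ∈ O s ∨ ∃ j ∈ D s, v ∈ BB s j := fun s v => by simp [Q']
  have Q'1 : ∀ s, Cn G (Q' s) ∧ X s ∈ Q' s ∧ Y s ∈ Q' s := fun s => d3 s (BB s) (fun j hj => by
    rw [hBB s j hj]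
    exact ⟨b2 j _, b4 j _, b5 j _⟩)
  have Q'J : ∀ s, Q' s ⊆ J := fun s v hv => by
    rcases (hQ' s v).1 hv with h | ⟨j, _, h⟩
    · exact q1 s (o1 s h)
    · exact hCJ j (BBC s j v h)
  have Q'd : ∀ s s', s ≠ s' → ∀ v, v ∈ Q' s → v ∉ Q' s' := fun s s' hne v hv hv' => by
    rcases (hQ' s v).1 hv with h | ⟨j, hj, h⟩ <;> rcases (hQ' s' v).1 hv' with h' | ⟨j', hj', h'⟩
    · exact Finset.disjoint_left.1 (q3 s s' hne) (o1 s h) (o1 s' h')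
    · exact ch0 v (o2 s v h) _ (BBC _ _ _ h')
    · exact ch0 v (o2 s' v h') _ (BBC _ _ _ h)
    · by_cases hjj : j = j'
      · subst hjj
        rw [hBB _ _ hj] at h
        rw [hBB _ _ hj'] at h'
        exact Finset.disjoint_left.1 (b3 j ⟨s, hj⟩ ⟨s', hj'⟩ (fun h => hne (by simpa using h))) h h'
      · exact Finset.disjoint_left.1 (hCd j j' hjj) (BBC _ _ _ h) (BBC _ _ _ h')
  let ow : ι ⊕ ε → ι := Sum.elim id (fun p => p.2)
  let W : ι → Finset V := fun k => Q' (Sum.inl k) ∪ (Finset.univ.filter (fun p : ε => (p.2 : ι) = k)).biUnion (fun p => Q' (Sum.inr p))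
  have hW : ∀ k v, v ∈ W k → ∃ s, ow s = k ∧ v ∈ Q' s := fun k v hv => by
    simp only [W, Finset.mem_union, Finset.mem_biUnion, Finset.mem_filter, Finset.mem_univ, true_and] at hv
    rcases hv with h | ⟨p, hp, h⟩
    · exact ⟨Sum.inl k, rfl, h⟩
    · exact ⟨Sum.inr p, hp, h⟩
  have hW2 : ∀ p : ε, Q' (Sum.inr p) ⊆ W p.2 := fun p v hv => by
    simp only [W, Finset.mem_union, Finset.mem_biUnion, Finset.mem_filter, Finset.mem_univ, true_and]
    exact Or.inr ⟨p, rfl, hv⟩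
  refine ⟨W, fun k v hv => ?_, fun k => ?_, fun k l hkl => ?_, fun k => Finset.mem_union_left _ (Q'1 (Sum.inl k)).2.1,
    fun k => Finset.mem_union_left _ (Q'1 (Sum.inl k)).2.2, fun k l hkl hk hl => ?_⟩
  · obtain ⟨s, _, hs⟩ := hW k v hv
    exact Q'J s hs
  · refine Cn.star (Q'1 _).1 _ (fun p _ => (Q'1 _).1) (fun p hp => ?_)
    have hp : (p.2 : ι) = k := (Finset.mem_filter.1 hp).2
    exact ⟨x k, (Q'1 (Sum.inl k)).2.1, u p, (Q'1 (Sum.inr p)).2.1, hp ▸ (u1' p).2.1⟩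
  · rw [Finset.disjoint_left]
    intro v hv hv'
    obtain ⟨s, h1, h2⟩ := hW k v hv
    obtain ⟨s', h1', h2'⟩ := hW l v hv'
    exact Q'd s s' (fun h => hkl (by rw [← h1, ← h1', h])) v h2 h2'
  · let j : κ × κ := (β k, β l)
    have hkj : k ∈ Aj j := by simp [Aj, j, hk]
    have hlj : l ∈ Aj j := by simp [Aj, j, hl]
    have key : ∀ i (hi : i ∈ Aj j), j ∈ D (Sum.inr ⟨j, ⟨i, hi⟩⟩) := fun i hi =>
      d2 _ j ((ch1 _ _).2 (z1' ⟨j, ⟨i, hi⟩⟩).1)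
    have sub : ∀ i (hi : i ∈ Aj j), B j ⟨_, key i hi⟩ ⊆ W i := fun i hi v hv =>
      hW2 ⟨j, ⟨i, hi⟩⟩ ((hQ' _ _).2 (Or.inr ⟨j, key i hi, by rw [hBB _ _ (key i hi)]; exact hv⟩))
    refine (b6 j ⟨_, key k hkj⟩ ⟨_, key l hlj⟩ (fun h => hkl ?_) ?_ ?_).mono (sub k hkj) (sub l hlj)
    · have h2 : (Sum.inr ⟨j, ⟨k, hkj⟩⟩ : ι ⊕ ε) = Sum.inr ⟨j, ⟨l, hlj⟩⟩ := congrArg Subtype.val h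
      exact congrArg ow h2
    · simp only [Finset.mem_filter, Finset.mem_univ, true_and]; exact ⟨_, rfl⟩
    · simp only [Finset.mem_filter, Finset.mem_univ, true_and]; exact ⟨_, rfl⟩
end lemB
end CD

namespace CD
section tower

set_option maxHeartbeats 1000000 in
theorem pieces {C : ℝ} (hC : 0 < C) (hyp : Hyp C) (K : ℕ) (hK : 1 ≤ K) : ∃ c K2 : ℕ, ∀ (V : Type) [Fintype V] [DecidableEq V]
    (G : SimpleGraph V) (t μ : ℕ), 1 ≤ t → 1 ≤ μ → t ≤ 2 ^ 2 ^ μ → ¬ G.HasMinor (⊤ : SimpleGraph (Fin t)) →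
    ∀ S : Finset V, ¬ Col G S (c * t * μ ^ 5) → ∃ H ⊆ S, kc G (K * t) H ∧ H.card ≤ K2 * (t * (2 ^ μ) ^ 2) := by
  classical
  obtain ⟨K2, hK2, hdm⟩ := dens_minor hC hyp
  obtain ⟨c, hc⟩ := exists_nat_ge (max (max 2 (2 * C)) (4 * K * (C * ((K2 : ℝ) + 2) ^ 5)))
  refine ⟨c, K2 ^ 2, ?_⟩
  intro V _ _ G t μ ht hμ htμ hG S hS
  obtain ⟨S', hS', hne, hdeg⟩ := degen _ S hS
  have hd := density_ge hne hdeg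
  set d := (sub G S').density with hdd
  have hc1 : (2 : ℝ) ≤ c := le_trans (le_trans (le_max_left _ _) (le_max_left _ _)) hc
  have hc2 : 2 * C ≤ c := le_trans (le_trans (le_max_right _ _) (le_max_left _ _)) hc
  have hc3 : 4 * K * (C * ((K2 : ℝ) + 2) ^ 5) ≤ c := le_trans (le_max_right _ _) hc
  have htR : (1 : ℝ) ≤ t := by exact_mod_cast ht
  have hμR : (1 : ℝ) ≤ μ := by exact_mod_cast hμ
  have hKR : (1 : ℝ) ≤ K := by exact_mod_cast hK
  have hK2R : (1 : ℝ) ≤ K2 := by exact_mod_cast hK2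
  push_cast at hd
  have hμ5 : (1 : ℝ) ≤ (μ : ℝ) ^ 5 := one_le_pow₀ hμR
  have htm : (1 : ℝ) ≤ t * (μ : ℝ) ^ 5 := by nlinarith
  have hdt : (c : ℝ) * (t * (μ : ℝ) ^ 5) ≤ 2 * d := by rw [← mul_assoc]; exact hd
  have htle : (t : ℝ) ≤ t * (μ : ℝ) ^ 5 := by nlinarith
  have hdt2 : (t : ℝ) ≤ d := by nlinarith
  have hdpos : 0 < d := by linarith
  have hlam : (1 : ℝ) ≤ 2 ^ μ := one_le_pow₀ (by norm_num)
  set D : ℝ := ((K2 * t * 2 ^ μ : ℕ) : ℝ) with hDdef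
  have hDe : D = K2 * t * 2 ^ μ := by rw [hDdef]; push_cast; ring
  have hDpos : 0 < D := by rw [hDe]; positivity
  have hsubm : G.HasMinor (sub G S') := (Mn.ofSub (G := G) (S := S')).hasMinor
  have hno : ∀ (W : Type) (_ : Finite W) (J : SimpleGraph W), (sub G S').HasMinor J → J.density < D := by
    intro W _ J hJ
    by_contra hcon
    push Not at hcon
    haveI := Fintype.ofFinite W
    exact hG (HasMinor.trans (HasMinor.trans hsubm hJ) (hdm W J t (2 ^ μ) ht Nat.one_le_two_pow htμ hcon))
  have hdD : d ≤ D := by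
    by_contra hcon
    push Not at hcon
    exact hG (HasMinor.trans hsubm (hdm _ _ t (2 ^ μ) ht Nat.one_le_two_pow htμ hcon.le))
  have hs : D / d ≤ K2 * 2 ^ μ := by
    rw [div_le_iff₀ hdpos, hDe]
    have : (0 : ℝ) ≤ K2 * 2 ^ μ := by positivity
    nlinarith
  have hs1 : 1 ≤ D / d := by rw [le_div_iff₀ hdpos]; linarith
  have hlog : Real.log (D / d) ≤ K2 + μ := by
    calc Real.log (D / d) ≤ Real.log (K2 * 2 ^ μ) := Real.log_le_log (by linarith) hs
      _ = Real.log K2 + μ * Real.log 2 := by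
        rw [Real.log_mul (by linarith) (by positivity), Real.log_pow]
      _ ≤ K2 + μ := by
        have h1 := Real.log_le_sub_one_of_pos (x := (K2 : ℝ)) (by linarith)
        have h2 := Real.log_two_lt_d9
        nlinarith
  have hlog0 := Real.log_nonneg hs1
  set g : ℝ := C * (((K2 : ℝ) + 2) * μ) ^ 5 with hg
  have hgpos : 0 < g := by positivity
  have hkd : 2 * ((K * t : ℕ) : ℝ) * g ≤ d := by
    have e : 2 * ((K * t : ℕ) : ℝ) * g = (4 * K * (C * ((K2 : ℝ) + 2) ^ 5)) * (t * (μ : ℝ) ^ 5) / 2 := by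
      rw [hg]; push_cast; ring
    rw [e]
    have : (4 * K * (C * ((K2 : ℝ) + 2) ^ 5)) * (t * (μ : ℝ) ^ 5) ≤ c * (t * (μ : ℝ) ^ 5) :=
      mul_le_mul_of_nonneg_right hc3 (by positivity)
    linarith
  obtain ⟨H, hH1, hH2⟩ := hyp_use hC hyp (sub G S') D g hDpos (by nlinarith) hdD (by
    apply mul_le_mul_of_nonneg_left _ hC.le
    apply pow_le_pow_left₀ (by linarith)
    nlinarith) (K * t) (Nat.mul_pos hK ht) hkd hno
  refine ⟨H.map (Function.Embedding.subtype _), fun z hz => ?_, hH1.unsub, ?_⟩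
  · obtain ⟨w, _, rfl⟩ := Finset.mem_map.1 hz
    exact hS' w.2
  · rw [Finset.card_map]
    have h1 : g * D ^ 2 / d ≤ D ^ 2 / t := by
      rw [div_le_div_iff₀ hdpos (by linarith)]
      have h2 : g * t ≤ d := by
        refine le_trans ?_ hkd
        push_cast
        have : 0 ≤ g * t := by positivity
        have hKg : g * t ≤ K * (g * t) := le_mul_of_one_le_left this hKR
        linarith
      have : 0 ≤ D ^ 2 := by positivity
      calc g * D ^ 2 * t = D ^ 2 * (g * t) := by ring
        _ ≤ D ^ 2 * d := mul_le_mul_of_nonneg_left h2 this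
    have h2 : D ^ 2 / t = ((K2 ^ 2 * (t * (2 ^ μ) ^ 2) : ℕ) : ℝ) := by
      rw [hDe]; push_cast; field_simp
    have h3 := hH2.trans (h1.trans h2.le)
    exact_mod_cast h3

variable {V : Type} [Fintype V] [DecidableEq V] {G : SimpleGraph V}

lemma fam_sq {κ : Type} {k s N0 : ℕ}
    (h : ∀ J N, N0 ≤ N → ¬ Col G J (N + s) → ∃ C : κ → Finset V, (∀ i, C i ⊆ J) ∧ (∀ i j, i ≠ j → Disjoint (C i) (C j)) ∧
      (∀ i, kc G k (C i)) ∧ ∀ i, ¬ Col G (C i) N) :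
    ∀ J N, N0 ≤ N → ¬ Col G J (N + 2 * s) → ∃ C : κ × κ → Finset V, (∀ i, C i ⊆ J) ∧ (∀ i j, i ≠ j → Disjoint (C i) (C j)) ∧
      (∀ i, kc G k (C i)) ∧ ∀ i, ¬ Col G (C i) N := by
  intro J N hN hJ
  obtain ⟨C, c1, c2, c3, c4⟩ := h J (N + s) (by omega) (by rwa [show N + s + s = N + 2 * s by ring])
  choose C' d1 d2 d3 d4 using fun i => h (C i) N hN (c4 i)
  refine ⟨fun p => C' p.1 p.2, fun p => (d1 _ _).trans (c1 _), fun p q hpq => ?_, fun p => d3 _ _, fun p => d4 _ _⟩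
  by_cases h1 : p.1 = q.1
  · show Disjoint (C' p.1 p.2) (C' q.1 q.2)
    rw [h1]
    exact d2 _ _ _ (fun h2 => hpq (Prod.ext h1 h2))
  · exact (c2 _ _ h1).mono (d1 _ _) (d1 _ _)

lemma tower {k s N0 T α : ℕ} (hk : 2 * T ≤ k)
    (hL0 : ∀ J, kc G k J → Wov G J 0 T) (hL : ∀ J, kc G k J → Wov G J (2 * α) T)
    (h : ∀ J N, N0 ≤ N → ¬ Col G J (N + s) → ∃ C : (Bool × Bool) × (Bool × Bool) → Finset V, (∀ i, C i ⊆ J) ∧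
      (∀ i j, i ≠ j → Disjoint (C i) (C j)) ∧ (∀ i, kc G k (C i)) ∧ ∀ i, ¬ Col G (C i) N) :
    ∀ i J n, kc G k J → ¬ Col G J (N0 + i * s) → n + 32 * (α * 2 ^ i) ≤ T → Wov G J (2 * (α * 2 ^ i)) n := by
  intro i
  induction i with
  | zero => intro J n hJ _ hn; exact (hL J hJ).mono (by simp) (by omega)
  | succ i ih =>
    intro J n hJ hc hn
    have e : α * 2 ^ (i + 1) = 2 * (α * 2 ^ i) := by ring
    rw [e] at hn ⊢
    obtain ⟨C, c1, c2, c3, c4⟩ := h J (N0 + i * s) (by omega) (by rwa [show N0 + i * s + s = N0 + (i + 1) * s by ring])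
    have := lemB (G := G) (κ := Bool × Bool) (by simp) (J := J) (T := n + 32 * (α * 2 ^ i)) (n := n) (a := α * 2 ^ i) le_rfl c1 c2
      (fun j => by have := (c3 j).1; omega) (fun j => ih (C j) _ (c3 j) (c4 j) (by omega)) (hJ.mono (by omega))
      ((hL0 J hJ).mono le_rfl (by omega))
    exact this.mono (by omega) le_rfl

lemma Wov.KM {J : Finset V} {a t : ℕ} (h : Wov G J a t) (ha : t ≤ a) (hJ : t ≤ J.card) : KM G Finset.univ t := by
  obtain ⟨e, e1, e2⟩ := list_lemma' (ι := Fin t) (fun _ => J) (fun i => by simpa using hJ)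
  obtain ⟨B, b1, b2, b3, b4, b5, b6⟩ := h (Fin t) e e Finset.univ (by simp) (by simpa using ha) e1 e1
    (fun k l hkl => ⟨fun h => hkl (e2 h), fun h => hkl (e2 h), fun h => hkl (e2 h)⟩)
  exact ⟨B, by simp, b2, b3, fun i j hij => b6 i j hij (by simp) (by simp)⟩
end tower
end CD

namespace CD
section main

lemma div_ge {x t : ℕ} (hx : 1 ≤ x) (h : x ≤ t) : t ≤ 2 * x * (t / x) := by
  have h1 : t < x * (t / x + 1) := Nat.lt_mul_div_succ t hx
  have h2 : 1 ≤ t / x := (Nat.one_le_div_iff hx).2 h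
  nlinarith

theorem mainN {C : ℝ} (hC : 0 < C) (hyp : Hyp C) : ∃ K0 K : ℕ, 1 ≤ K ∧ ∀ (V : Type) [Fintype V] [DecidableEq V]
    (G : SimpleGraph V) (t μ : ℕ), 1 ≤ t → 1 ≤ μ → t ≤ 2 ^ 2 ^ μ → 16 * K * 2 ^ μ ≤ t →
    ¬ G.HasMinor (⊤ : SimpleGraph (Fin t)) → Col G Finset.univ (K0 * t * μ ^ 5) := by
  obtain ⟨K, hK, hL⟩ := thmL hC hyp
  obtain ⟨c, K2, hpc⟩ := pieces hC hyp K (by omega)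
  obtain ⟨M, hM⟩ : ∃ M, M = 16 * K ^ 2 * K2 + 3 := ⟨_, rfl⟩
  refine ⟨c + 65 * K + 325 * K + (1 + 32 * K) * (4 * (15 + 2 * M + 650 * K)), K, by omega, ?_⟩
  intro V _ _ G t μ ht hμ htμ hKt hG
  have hKM : ∀ S, ¬ KM G S t := fun S ⟨X, hX⟩ => hG hX.hasMinor
  obtain ⟨lam, hlam⟩ : ∃ lam, lam = 2 ^ μ := ⟨_, rfl⟩
  have hlam1 : 1 ≤ lam := hlam ▸ Nat.one_le_two_pow
  rw [← hlam] at hKt htμ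
  have hKl : 1 ≤ K * lam := Nat.mul_pos (by omega) hlam1
  obtain ⟨m, hm⟩ : ∃ m, m = 2 * t * (4 * μ + M) + t := ⟨_, rfl⟩
  obtain ⟨k, hk⟩ : ∃ k, k = K * (65 * t) := ⟨_, rfl⟩
  have hk2 : 2 * (65 * t) ≤ k := by rw [hk]; exact Nat.mul_le_mul_right _ hK
  obtain ⟨N0, hN0⟩ : ∃ N0, N0 = c * t * μ ^ 5 + k := ⟨_, rfl⟩
  obtain ⟨s1, hs1⟩ : ∃ s1, s1 = 6 * t + m + 10 * k := ⟨_, rfl⟩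
  -- blocks
  obtain ⟨a2, ha2⟩ : ∃ a2, a2 = t / (2 * (K * lam)) := ⟨_, rfl⟩
  have ha2a : 2 * a2 * K * lam ≤ t := by
    have := Nat.div_mul_le_self t (2 * (K * lam))
    rw [← ha2] at this
    calc 2 * a2 * K * lam = a2 * (2 * (K * lam)) := by ring
      _ ≤ t := this
  have ha2b : t ≤ 4 * (K * lam) * a2 := by
    have := div_ge (x := 2 * (K * lam)) (t := t) (by omega) (by nlinarith)
    rw [← ha2] at this
    linarith
  haveI : Nonempty (Fin (4 * (K * lam))) := ⟨⟨0, by omega⟩⟩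
  obtain ⟨β, hβ⟩ := blocks (κ := Fin (4 * (K * lam))) (Finset.univ : Finset (Fin t)) a2 (by simpa using ha2b)
  have hβ' : ∀ p : Fin (4 * (K * lam)) × Fin (4 * (K * lam)),
      (Finset.univ.filter fun i => β i = p.1 ∨ β i = p.2).card ≤ 2 * a2 := fun p => by
    rw [Finset.filter_or]
    have := Finset.card_union_le (Finset.univ.filter fun i => β i = p.1) (Finset.univ.filter fun i => β i = p.2)
    have := hβ p.1
    have := hβ p.2
    omega
  have hsm : ∀ S : Finset V, S.card ≤ Fintype.card (Fin (4 * (K * lam)) × Fin (4 * (K * lam))) * (K2 * (t * lam ^ 2)) + 3 * t →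
      Col G S m := by
    intro S hS
    rw [Fintype.card_prod, Fintype.card_fin] at hS
    refine (small_col ht (4 * μ + M) (hKM S)).mono (Finset.Subset.refl _) ?_
    rw [hm]
    refine Nat.add_le_add_left (Nat.div_le_of_le_mul ?_) _
    have e : 2 ^ (4 * μ + M) = lam ^ 4 * 2 ^ M := by rw [hlam, pow_add, ← pow_mul]; ring_nf
    rw [e]
    have h1 : M ≤ 2 ^ M := Nat.lt_two_pow_self.le
    have h2 : 1 ≤ lam ^ 4 := Nat.one_le_pow _ _ hlam1
    calc S.card ≤ 16 * K ^ 2 * K2 * (lam ^ 4 * t) + 3 * t := by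
          refine hS.trans (le_of_eq ?_); ring
      _ ≤ 16 * K ^ 2 * K2 * (lam ^ 4 * t) + 3 * (lam ^ 4 * t) := by
          gcongr; exact Nat.le_mul_of_pos_left _ h2
      _ = M * (lam ^ 4 * t) := by rw [hM]; ring
      _ ≤ 2 ^ M * (lam ^ 4 * t) := Nat.mul_le_mul_right _ h1
      _ = lam ^ 4 * 2 ^ M * t := by ring
  have hpc' : ∀ S, ¬ Col G S (c * t * μ ^ 5) → ∃ H ⊆ S, 2 * t ≤ H.card ∧ H.card ≤ K2 * (t * lam ^ 2) ∧ Wov G H (2 * a2) t := by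
    intro S hS
    obtain ⟨H, h1, h2, h3⟩ := hpc V G t μ ht hμ (hlam ▸ htμ) hG S hS
    refine ⟨H, h1, ?_, hlam ▸ h3, hL V G H t (2 * a2) lam ht hlam1 htμ ha2a h2⟩
    have := h2.1
    have : 2 * t ≤ K * t := Nat.mul_le_mul_right _ hK
    omega
  have split : ∀ J N, N0 ≤ N → ¬ Col G J (N + s1) → ∃ C : Bool → Finset V, (∀ i, C i ⊆ J) ∧
      (∀ i j, i ≠ j → Disjoint (C i) (C j)) ∧ (∀ i, kc G k (C i)) ∧ ∀ i, ¬ Col G (C i) N := by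
    intro J N hN hJ
    obtain ⟨J1, h1, J2, h2, n1, n2, hd⟩ := lemA (G := G) (J0 := J) (k := k) (N := N + 5 * k) (β := β) (a := 2 * a2) (m := m) (d0 := c * t * μ ^ 5)
      (by omega) (by omega) (by omega) (by omega) hβ' hpc' hsm (hKM _)
      (by rwa [show N + 5 * k + (6 * t + m + 5 * k) = N + s1 by omega])
    obtain ⟨C1, c1, d1, e1⟩ := GN (G := G) (k := k) (by omega) (by omega) n1
    obtain ⟨C2, c2, d2, e2⟩ := GN (G := G) (k := k) (by omega) (by omega) n2
    refine ⟨fun b => if b then C1 else C2, ?_, ?_, ?_, ?_⟩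
    · rintro (_ | _)
      · simpa using c2.trans h2
      · simpa using c1.trans h1
    · rintro (_ | _) (_ | _) hne
      · exact absurd rfl hne
      · simpa using (hd.mono c1 c2).symm
      · simpa using hd.mono c1 c2
      · exact absurd rfl hne
    · rintro (_ | _)
      · simpa using d2
      · simpa using d1
    · rintro (_ | _)
      · simpa using e2
      · simpa using e1
  -- tower
  obtain ⟨α, hα⟩ : ∃ α, α = t / (16 * (K * lam)) := ⟨_, rfl⟩
  have hα1 : α * (16 * (K * lam)) ≤ t := by rw [hα]; exact Nat.div_mul_le_self _ _
  have hα2 : t ≤ 2 * (16 * (K * lam)) * α := by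
    rw [hα]; exact div_ge (by omega) (by rw [← mul_assoc]; exact hKt)
  have hαt : α ≤ t := by rw [hα]; exact Nat.div_le_self _ _
  have hT2 : 65 * t ≤ 2 ^ (8 * lam) := by
    calc 65 * t ≤ 2 ^ 7 * 2 ^ lam := Nat.mul_le_mul (by norm_num) htμ
      _ = 2 ^ (7 + lam) := by rw [pow_add]
      _ ≤ _ := Nat.pow_le_pow_right (by norm_num) (by omega)
  have tow := tower (G := G) (k := k) (s := 2 * (2 * s1)) (N0 := N0) (T := 65 * t) (α := α) hk2
    (fun J hJ => hL V G J (65 * t) 0 (8 * lam) (by omega) (by omega) hT2 (by simp) (hk ▸ hJ))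
    (fun J hJ => hL V G J (65 * t) (2 * α) (8 * lam) (by omega) (by omega) hT2 (by
      calc 2 * α * K * (8 * lam) = α * (16 * (K * lam)) := by ring
        _ ≤ 65 * t := by omega) (hk ▸ hJ))
    (fam_sq (fam_sq split))
  have hex : t ≤ α * 2 ^ (μ + 32 * K) := by
    refine hα2.trans ?_
    have h1 : 32 * K ≤ 2 ^ (32 * K) := Nat.lt_two_pow_self.le
    calc 2 * (16 * (K * lam)) * α = α * (lam * (32 * K)) := by ring
      _ ≤ α * (lam * 2 ^ (32 * K)) := by gcongr
      _ = _ := by rw [hlam, pow_add]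
  classical
  have hex' : ∃ I, t ≤ α * 2 ^ I := ⟨_, hex⟩
  obtain ⟨I, hI1, hI2, hI3⟩ : ∃ I, t ≤ α * 2 ^ I ∧ α * 2 ^ I ≤ 2 * t ∧ I ≤ μ + 32 * K := by
    refine ⟨Nat.find hex', Nat.find_spec hex', ?_, Nat.find_le hex⟩
    rcases h : Nat.find hex' with _ | i
    · simp; omega
    · have := Nat.find_min hex' (m := i) (by omega)
      rw [pow_succ]
      nlinarith
  have hfin : Col G Finset.univ (N0 + I * (2 * (2 * s1)) + 5 * k) := by
    by_contra hcon
    obtain ⟨J, _, hJ1, hJ2⟩ := GN (G := G) (k := k) (by omega) (by omega) hcon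
    exact hKM _ ((tow I J t hJ1 hJ2 (by omega)).KM (by omega) (by have := hJ1.1; omega))
  refine hfin.mono (Finset.Subset.refl _) ?_
  have hb : s1 ≤ t * μ * (15 + 2 * M + 650 * K) := by
    have h1 : t ≤ t * μ := Nat.le_mul_of_pos_right _ hμ
    calc s1 = t * μ * 8 + t * (7 + 2 * M + 650 * K) := by rw [hs1, hm, hk]; ring
      _ ≤ t * μ * 8 + t * μ * (7 + 2 * M + 650 * K) := by gcongr
      _ = _ := by ring
  have hIb : I ≤ (1 + 32 * K) * μ := by nlinarith
  have h5 : t ≤ t * μ ^ 5 := Nat.le_mul_of_pos_right _ (Nat.one_le_pow _ _ hμ)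
  have h25 : t * μ ^ 2 ≤ t * μ ^ 5 := Nat.mul_le_mul_left _ (Nat.pow_le_pow_right hμ (by norm_num))
  calc N0 + I * (2 * (2 * s1)) + 5 * k
      ≤ N0 + ((1 + 32 * K) * μ) * (2 * (2 * (t * μ * (15 + 2 * M + 650 * K)))) + 5 * k := by gcongr
    _ = c * (t * μ ^ 5) + 65 * K * t + 325 * K * t + (1 + 32 * K) * (4 * (15 + 2 * M + 650 * K)) * (t * μ ^ 2) := by
        rw [hN0, hk]; ring
    _ ≤ c * (t * μ ^ 5) + 65 * K * (t * μ ^ 5) + 325 * K * (t * μ ^ 5) + (1 + 32 * K) * (4 * (15 + 2 * M + 650 * K)) * (t * μ ^ 5) := by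
        gcongr
    _ = _ := by ring
end main
end CD

namespace CD

lemma sq_le_two_pow : ∀ q : ℕ, 4 ≤ q → q ^ 2 ≤ 2 ^ q := by
  intro q hq
  induction q, hq using Nat.le_induction with
  | base => norm_num
  | succ n hn ih =>
    rw [pow_succ 2 n]
    nlinarith

/-- the choice of parameters for large `t` -/
lemma choose_mu (K t : ℕ) (hK : 1 ≤ K) (ht : 2 ^ (64 * K + 4) ≤ t) :
    ∃ μ q : ℕ, 1 ≤ μ ∧ t ≤ 2 ^ 2 ^ μ ∧ 16 * K * 2 ^ μ ≤ t ∧ 2 ^ μ ≤ 2 * q ∧ 2 ≤ q ∧ 2 ^ (q - 1) ≤ t := by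
  have hq1 : t ≤ 2 ^ Nat.clog 2 t := Nat.le_pow_clog (by norm_num) t
  have ht2 : 1 < t := lt_of_lt_of_le (Nat.one_lt_two_pow (by omega)) ht
  have hq2 : 2 ^ (Nat.clog 2 t - 1) < t := Nat.pow_pred_clog_lt_self (by norm_num) ht2
  generalize Nat.clog 2 t = q at hq1 hq2
  have hq0 : 64 * K + 4 ≤ q := (Nat.pow_le_pow_iff_right (by norm_num : 1 < 2)).1 (ht.trans hq1)
  have hm1 : q ≤ 2 ^ Nat.clog 2 q := Nat.le_pow_clog (by norm_num) q
  have hm2 : 2 ^ (Nat.clog 2 q - 1) < q := Nat.pow_pred_clog_lt_self (by norm_num) (by omega)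
  have hm3 : 1 ≤ Nat.clog 2 q := Nat.clog_pos (by norm_num) (by omega)
  generalize Nat.clog 2 q = μ at hm1 hm2 hm3
  obtain ⟨m, rfl⟩ : ∃ m, μ = m + 1 := ⟨μ - 1, by omega⟩
  obtain ⟨p, rfl⟩ : ∃ p, q = p + 1 := ⟨q - 1, by omega⟩
  simp only [Nat.add_sub_cancel] at hm2 hq2
  have h2m : 2 ^ (m + 1) ≤ 2 * (p + 1) := by rw [pow_succ]; omega
  refine ⟨m + 1, p + 1, hm3, hq1.trans (Nat.pow_le_pow_right (by norm_num) hm1), ?_, h2m, by omega,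
    by simpa using hq2.le⟩
  have h := sq_le_two_pow (p + 1) (by omega)
  rw [pow_succ 2 p] at h
  have : 16 * K * 2 ^ (m + 1) ≤ 16 * K * (2 * (p + 1)) := Nat.mul_le_mul_left _ h2m
  nlinarith

lemma log_bound (t μ q : ℕ) (hμ : 1 ≤ μ) (hq : 2 ≤ q) (h1 : 2 ^ μ ≤ 2 * q) (h2 : 2 ^ (q - 1) ≤ t) :
    (μ : ℝ) ^ 5 ≤ 1024 * (1 + Real.log (3.2 * Real.sqrt (Real.log t))) ^ 5 := by
  have hl2 : (0.6931471803 : ℝ) < Real.log 2 := Real.log_two_gt_d9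
  have a1 : ((q : ℝ) - 1) * Real.log 2 ≤ Real.log t := by
    have : Real.log ((2 : ℝ) ^ (q - 1)) ≤ Real.log t :=
      Real.log_le_log (by positivity) (by exact_mod_cast h2)
    rw [Real.log_pow, Nat.cast_sub (by omega)] at this
    simpa using this
  have hq' : (2 : ℝ) ≤ q := by exact_mod_cast hq
  have a2 : (q : ℝ) / 4 ≤ Real.log t := by nlinarith
  have h1' : (2 : ℝ) ^ μ ≤ 2 * q := by exact_mod_cast h1
  have a3 : (2 : ℝ) ^ μ / 8 ≤ Real.log t := by linarith
  have hp : (0 : ℝ) < 2 ^ μ := by positivity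
  have a4 : Real.sqrt (2 ^ μ) ≤ 3.2 * Real.sqrt (Real.log t) := by
    have : (3.2 : ℝ) = Real.sqrt (3.2 ^ 2) := (Real.sqrt_sq (by norm_num)).symm
    rw [this, ← Real.sqrt_mul (by positivity)]
    apply Real.sqrt_le_sqrt
    norm_num
    linarith
  have a5 : (μ : ℝ) / 4 ≤ Real.log (3.2 * Real.sqrt (Real.log t)) := by
    refine le_trans ?_ (Real.log_le_log (Real.sqrt_pos.2 hp) a4)
    rw [Real.log_sqrt hp.le, Real.log_pow]
    have : (0 : ℝ) ≤ μ := by positivity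
    nlinarith
  calc (μ : ℝ) ^ 5 = 1024 * ((μ : ℝ) / 4) ^ 5 := by ring
    _ ≤ _ := by gcongr; linarith

lemma log_nonneg' (t : ℕ) (ht : 3 ≤ t) : 0 ≤ Real.log (3.2 * Real.sqrt (Real.log t)) := by
  have hl : 1 ≤ Real.log t := by
    rw [Real.le_log_iff_exp_le (by positivity)]
    have : (3 : ℝ) ≤ t := by exact_mod_cast ht
    linarith [Real.exp_one_lt_d9]
  apply Real.log_nonneg
  have := Real.one_le_sqrt.2 hl
  linarith

lemma Col.colorable {V : Type*} [Fintype V] {G : SimpleGraph V} {n : ℕ} (h : Col G Finset.univ n) :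
    G.Colorable n := by
  obtain ⟨f, h1, h2⟩ := h
  exact ⟨Coloring.mk (fun v => (⟨f v, h1 v (Finset.mem_univ v)⟩ : Fin n)) fun {u v} huv heq =>
    h2 u (Finset.mem_univ u) v (Finset.mem_univ v) huv (Fin.mk.inj_iff.1 heq)⟩

lemma hasMinor_top_mono {V : Type*} {G : SimpleGraph V} {s t : ℕ} (hst : s ≤ t)
    (h : G.HasMinor (⊤ : SimpleGraph (Fin t))) : G.HasMinor (⊤ : SimpleGraph (Fin s)) := by
  obtain ⟨X, h1, h2, h3⟩ := h
  refine ⟨fun i => X (Fin.castLE hst i), fun i j hij => h1 ?_, fun i => h2 _, fun i j hij => h3 _ _ ?_⟩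
  · exact fun h => hij (Fin.castLE_injective hst h)
  · exact fun h => hij.ne (Fin.castLE_injective hst h)

end CD

theorem chromatic_from_density_increment (C : ℝ) (hC : 0 < C)
    (hyp : ∀ (V : Type) [Fintype V] (G : SimpleGraph V) (D : ℝ), 0 < D → C ≤ G.density →
      (∃ (W : Type) (_ : Finite W) (J : SimpleGraph W), G.HasMinor J ∧ D ≤ J.density) ∨
      (∃ H : G.Subgraph,
        (Nat.card H.verts : ℝ) ≤ C * (1 + Real.log (D / G.density)) ^ 5 * D ^ 2 / G.density ∧
        G.density / (C * (1 + Real.log (D / G.density)) ^ 5) ≤ H.density)) :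
    ∃ C' : ℝ, 0 < C' ∧ ∀ t : ℕ, 3 ≤ t →
      ∀ (V : Type) [Fintype V] (G : SimpleGraph V),
        ¬ G.HasMinor (⊤ : SimpleGraph (Fin t)) →
        ∃ n : ℕ, G.Colorable n ∧
          (n : ℝ) ≤ C' * t *
            (C * (1 + Real.log (3.2 * Real.sqrt (Real.log t))) ^ 5 +
              (Real.log (Real.log t)) ^ 2) := by
  classical
  obtain ⟨K0, K, hK, hmain⟩ := CD.mainN hC hyp
  obtain ⟨μ0, q0, e1, e2, e3, -, -, -⟩ := CD.choose_mu K (2 ^ (64 * K + 4)) hK le_rfl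
  set t0 := 2 ^ (64 * K + 4) with ht0
  have ht0pos : 1 ≤ t0 := Nat.one_le_two_pow
  have hA : (0 : ℝ) ≤ 1024 * K0 := by positivity
  have hB : (0 : ℝ) ≤ ((K0 * t0 * μ0 ^ 5 : ℕ) : ℝ) := by positivity
  refine ⟨(1024 * K0 + (K0 * t0 * μ0 ^ 5 : ℕ) + 1) / C, by positivity, ?_⟩
  intro t ht V _ G hG
  have hL := CD.log_nonneg' t ht
  have htR : (3 : ℝ) ≤ t := by exact_mod_cast ht
  have key : (1024 * (K0 : ℝ) + (K0 * t0 * μ0 ^ 5 : ℕ)) * t * (1 + Real.log (3.2 * Real.sqrt (Real.log t))) ^ 5 ≤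
      (1024 * K0 + (K0 * t0 * μ0 ^ 5 : ℕ) + 1) / C * t *
            (C * (1 + Real.log (3.2 * Real.sqrt (Real.log t))) ^ 5 +
              (Real.log (Real.log t)) ^ 2) := by
    generalize ((K0 * t0 * μ0 ^ 5 : ℕ) : ℝ) = B at hB ⊢
    calc _ ≤ (1024 * (K0 : ℝ) + B + 1) * t * (1 + Real.log (3.2 * Real.sqrt (Real.log t))) ^ 5 := by
          have h0 : 1024 * (K0 : ℝ) + B ≤ 1024 * (K0 : ℝ) + B + 1 := by linarith
          exact mul_le_mul_of_nonneg_right (mul_le_mul_of_nonneg_right h0 (by positivity)) (by positivity)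
      _ = (1024 * K0 + B + 1) / C * t * (C * (1 + Real.log (3.2 * Real.sqrt (Real.log t))) ^ 5 + 0) := by
          field_simp; ring
      _ ≤ _ := by gcongr; positivity
  rcases le_or_gt t0 t with hlt | hlt
  · obtain ⟨μ, q, f1, f2, f3, f4, f5, f6⟩ := CD.choose_mu K t hK hlt
    refine ⟨K0 * t * μ ^ 5, (hmain V G t μ (by omega) f1 f2 f3 hG).colorable, le_trans ?_ key⟩
    have hb := CD.log_bound t μ q f1 f5 f4 f6
    push_cast at hB ⊢
    generalize (1 + Real.log (3.2 * Real.sqrt (Real.log t))) ^ 5 = y at hb ⊢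
    have hy : 0 ≤ y := by
      have : (0 : ℝ) ≤ (μ : ℝ) ^ 5 := by positivity
      linarith
    generalize (K0 * t0 * μ0 ^ 5 : ℝ) = B at hB ⊢
    calc (K0 : ℝ) * t * μ ^ 5 ≤ K0 * t * (1024 * y) := by gcongr
      _ = (1024 * K0 + 0) * t * y := by ring
      _ ≤ _ := by gcongr
  · refine ⟨K0 * t0 * μ0 ^ 5, (hmain V G t0 μ0 ht0pos e1 e2 e3
      fun h => hG (CD.hasMinor_top_mono hlt.le h)).colorable, le_trans ?_ key⟩
    have hy : 1 ≤ (1 + Real.log (3.2 * Real.sqrt (Real.log t))) ^ 5 := one_le_pow₀ (by linarith)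
    generalize (1 + Real.log (3.2 * Real.sqrt (Real.log t))) ^ 5 = y at hy ⊢
    generalize ((K0 * t0 * μ0 ^ 5 : ℕ) : ℝ) = B at hB ⊢
    calc B = (0 + B) * 1 * 1 := by ring
      _ ≤ _ := by gcongr; linarith
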